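/- arXiv:2505.07190 — 2 statements merged into one kernel-verified Lean document; each statement's English description precedes it below -/
import Mathlib

section
/- If X is an irreducible complete (proper) variety over the complex numbers, and U ⊆ X is a nonempty open affine subvariety with dim U ≥ 2, then the complement X \ U is connected. -/
namespace AffineComplement

section Valuations

variable {K : Type*} [Field K]

/-- A valuation subring of a `k`-algebra that contains the image of `k`. -/
def IsOver (k : Type*) [Field k] [Algebra k K] (V : ValuationSubring K) : Prop :=
  ∀ c : k, algebraMap k K c ∈ V

theorem one_lt_valuation_iff {V : ValuationSubring K} {x : K} :
    1 < V.valuation x ↔ x ∉ V := by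
  rw [← not_le, V.valuation_le_one_iff]

theorem div_mem_iff {V : ValuationSubring K} {x y : K} (hy : y ≠ 0) :
    x / y ∈ V ↔ V.valuation x ≤ V.valuation y := by
  rw [← V.valuation_le_one_iff, map_div₀, div_le_one₀]
  exact (Valuation.pos_iff _).2 hy

/-- The ultraproduct of a family of valuation subrings, as a valuation subring. -/
def ultraValuationSubring {ι : Type*} (F : Ultrafilter ι) (W : ι → ValuationSubring K) :
    ValuationSubring K where
  carrier := {f | ∀ᶠ i in F, f ∈ W i}
  mul_mem' ha hb := by
    filter_upwards [ha, hb] with i h1 h2 using mul_mem h1 h2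
  one_mem' := Filter.Eventually.of_forall fun i => one_mem _
  add_mem' ha hb := by
    filter_upwards [ha, hb] with i h1 h2 using add_mem h1 h2
  zero_mem' := Filter.Eventually.of_forall fun i => zero_mem _
  neg_mem' ha := by
    filter_upwards [ha] with i h1 using neg_mem h1
  mem_or_inv_mem' x := by
    have : ∀ᶠ i in F, x ∈ W i ∨ x⁻¹ ∈ W i :=
      Filter.Eventually.of_forall fun i => (W i).mem_or_inv_mem x
    exact Ultrafilter.eventually_or.1 this

variable (k : Type*) [Field k] [Algebra k K]

theorem adjoin_le_iff_of_isOver {V : ValuationSubring K} (hV : IsOver k V) {T : Set K} :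
    (∀ a ∈ Algebra.adjoin k T, a ∈ V) ↔ ∀ t ∈ T, t ∈ V := by
  refine ⟨fun h t ht => h t (Algebra.subset_adjoin ht), fun h a ha => ?_⟩
  induction ha using Algebra.adjoin_induction with
  | mem x hx => exact h x hx
  | algebraMap r => exact hV r
  | add x y _ _ hx hy => exact add_mem hx hy
  | mul x y _ _ hx hy => exact mul_mem hx hy

theorem compactness {ι : Type*} (T : Set K) (hT : T.Finite) (h : ι → K) (F : ι → Set K)
    (hF : ∀ i, (F i).Finite)
    (H : ∀ V : ValuationSubring K, IsOver k V → (¬ ∀ t ∈ T, t ∈ V) →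
      ∃ i, h i ∉ V ∧ ∀ r ∈ F i, r ∈ V) :
    ∃ Φ : Finset ι, ∀ V : ValuationSubring K, IsOver k V → (¬ ∀ t ∈ T, t ∈ V) →
      ∃ i ∈ Φ, h i ∉ V ∧ ∀ r ∈ F i, r ∈ V := by
  by_contra! hcon
  choose W hW1 hW2 hW3 using hcon
  let 𝓕 : Ultrafilter (Finset ι) := Ultrafilter.of Filter.atTop
  let V := ultraValuationSubring 𝓕 W
  have hV : IsOver k V := fun c => Filter.Eventually.of_forall fun i => hW1 i c
  obtain ⟨i, hi1, hi2⟩ := H V hV (by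
    intro hall
    have : ∀ᶠ Φ in (𝓕 : Filter (Finset ι)), ∀ t ∈ T, t ∈ W Φ :=
      (Filter.eventually_all_finite hT).2 fun t ht => hall t ht
    obtain ⟨Φ, hΦ⟩ := this.exists
    obtain ⟨t, ht, htn⟩ := hW2 Φ
    exact htn (hΦ t ht))
  have h1 : ∀ᶠ Φ in (𝓕 : Filter (Finset ι)), h i ∉ W Φ := Ultrafilter.eventually_not.2 hi1
  have h2 : ∀ᶠ Φ in (𝓕 : Filter (Finset ι)), ∀ r ∈ F i, r ∈ W Φ :=
    (Filter.eventually_all_finite (hF i)).2 fun r hr => hi2 r hr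
  have h3 : ∀ᶠ Φ in (𝓕 : Filter (Finset ι)), i ∈ Φ :=
    (Ultrafilter.of_le Filter.atTop) ((Filter.eventually_ge_atTop {i}).mono fun Φ hΦ => by
      simpa using hΦ)
  obtain ⟨Φ, h1, h2, h3⟩ := (h1.and (h2.and h3)).exists
  obtain ⟨r, hr, hrn⟩ := hW3 Φ i h3 h1
  exact hrn (h2 r hr)

end Valuations

section Blowup

variable {K : Type*} [Field K] (k : Type*) [Field k] [Algebra k K]

/-- The localization of the valuation subring `V` at powers of `c ∉ V`. -/
def coarsen (V : ValuationSubring K) (c : K) (hc : c ∉ V) : ValuationSubring K where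
  carrier := {f | ∃ n : ℕ, V.valuation f ≤ V.valuation c ^ n}
  mul_mem' := by
    rintro a b ⟨n, hn⟩ ⟨m, hm⟩
    refine ⟨n + m, ?_⟩
    rw [map_mul, pow_add]
    exact mul_le_mul' hn hm
  one_mem' := ⟨0, by simp⟩
  add_mem' := by
    rintro a b ⟨n, hn⟩ ⟨m, hm⟩
    have h1 := (one_lt_valuation_iff.2 hc).le
    refine ⟨n + m, (V.valuation.map_add a b).trans (max_le ?_ ?_)⟩
    · exact hn.trans (pow_le_pow_right₀ h1 (by omega))
    · exact hm.trans (pow_le_pow_right₀ h1 (by omega))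
  zero_mem' := ⟨0, by simp⟩
  neg_mem' := by
    rintro a ⟨n, hn⟩
    exact ⟨n, by rwa [Valuation.map_neg]⟩
  mem_or_inv_mem' x := by
    rcases V.mem_or_inv_mem x with h | h
    · exact Or.inl ⟨0, by simpa using (V.valuation_le_one_iff x).2 h⟩
    · exact Or.inr ⟨0, by rw [pow_zero]; exact (V.valuation_le_one_iff _).2 h⟩

theorem mem_coarsen {V : ValuationSubring K} {c : K} {hc : c ∉ V} {f : K} :
    f ∈ coarsen V c hc ↔ ∃ n : ℕ, V.valuation f ≤ V.valuation c ^ n := Iff.rfl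

theorem exists_denominator {J : Type*} (A : Subalgebra k K) (T : Set K) (hT : T.Finite)
    (hA : Algebra.adjoin k T = A) (R : J → Subalgebra k K) (G : J → Set K)
    (hG : ∀ j, (G j).Finite) (hR : ∀ j, Algebra.adjoin k (G j) = R j)
    (H1 : ∀ V : ValuationSubring K, IsOver k V → ∃ j, ∀ r ∈ R j, r ∈ V)
    (H2 : ∀ V : ValuationSubring K, IsOver k V → (∀ a ∈ A, a ∈ V) → ∀ j, (∀ r ∈ R j, r ∈ V) →
      ∃ g ∈ A, V.valuation g = 1 ∧ ∀ r ∈ R j, ∃ n : ℕ, r * g ^ n ∈ A)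
    (V : ValuationSubring K) (hV : IsOver k V) (hVA : ¬ ∀ t ∈ T, t ∈ V) :
    ∃ h ∈ A, ∃ j, h ∉ V ∧ ∀ r ∈ G j, r ∈ V ∧ h * r ∈ A := by
  push Not at hVA
  have hne : (hT.toFinset).Nonempty := by
    obtain ⟨t, ht, -⟩ := hVA
    exact ⟨t, by simpa⟩
  obtain ⟨c, hcT, hcmax⟩ := Finset.exists_max_image _ V.valuation hne
  simp only [Set.Finite.mem_toFinset] at hcT hcmax
  have hc : c ∉ V := by
    obtain ⟨t, ht, htV⟩ := hVA
    exact one_lt_valuation_iff.1 ((one_lt_valuation_iff.2 htV).trans_le (hcmax t ht))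
  have hc1 := one_lt_valuation_iff.2 hc
  have hcA : c ∈ A := hA ▸ Algebra.subset_adjoin hcT
  have hle : ∀ x ∈ V, x ∈ coarsen V c hc := fun x hx =>
    ⟨0, by simpa using (V.valuation_le_one_iff x).2 hx⟩
  have hV' : IsOver k (coarsen V c hc) := fun a => hle _ (hV a)
  have hA' : ∀ a ∈ A, a ∈ coarsen V c hc := by
    rw [← hA, adjoin_le_iff_of_isOver k hV']
    exact fun t ht => ⟨1, by simpa using hcmax t ht⟩
  obtain ⟨j, hj⟩ := H1 V hV
  obtain ⟨g, hgA, hg1, hg⟩ := H2 _ hV' hA' j fun r hr => hle _ (hj r hr)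
  have hg0 : g ≠ 0 := by
    rintro rfl
    simp at hg1
  have hginv : g⁻¹ ∈ coarsen V c hc := by
    rw [← ValuationSubring.valuation_le_one_iff, map_inv₀, hg1, inv_one]
  obtain ⟨N, hN⟩ := mem_coarsen.1 hginv
  have hpow : ∃ M : ℕ, ∀ r ∈ G j, r * g ^ M ∈ A := by
    choose! n hn using hg
    have hGR : ∀ r ∈ G j, r ∈ R j := fun r hr => hR j ▸ Algebra.subset_adjoin hr
    refine ⟨(hG j).toFinset.sup n, fun r hr => ?_⟩
    have h1 : n r ≤ (hG j).toFinset.sup n := Finset.le_sup (by simpa using hr)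
    obtain ⟨d, hd⟩ := Nat.exists_eq_add_of_le h1
    rw [hd, pow_add, ← mul_assoc]
    exact mul_mem (hn r (hGR r hr)) (pow_mem hgA _)
  obtain ⟨M, hM⟩ := hpow
  refine ⟨c ^ (N * M + 1) * g ^ M, mul_mem (pow_mem hcA _) (pow_mem hgA _), j, ?_, ?_⟩
  · rw [← one_lt_valuation_iff, map_mul, map_pow, map_pow]
    have hv0 : 0 < V.valuation g := (Valuation.pos_iff _).2 hg0
    rw [map_inv₀] at hN
    have h2 : 1 ≤ V.valuation c ^ N * V.valuation g := by
      have := mul_le_mul_left hN (V.valuation g)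
      rwa [inv_mul_cancel₀ hv0.ne'] at this
    have h3 : 1 ≤ (V.valuation c ^ N * V.valuation g) ^ M := one_le_pow₀ h2
    calc 1 < V.valuation c * 1 := by simpa
      _ ≤ V.valuation c * (V.valuation c ^ N * V.valuation g) ^ M := mul_le_mul_right h3 _
      _ = _ := by
        rw [mul_pow, ← pow_mul, pow_succ, ← mul_assoc, mul_comm (V.valuation c)]
  · intro r hr
    refine ⟨hj r (hR j ▸ Algebra.subset_adjoin hr), ?_⟩
    rw [mul_assoc, mul_comm _ r]
    exact mul_mem (pow_mem hcA _) (hM r hr)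

open scoped Pointwise in
theorem exists_generators {J : Type*} (A : Subalgebra k K) (T : Set K) (hT : T.Finite)
    (hA : Algebra.adjoin k T = A) (R : J → Subalgebra k K) (G : J → Set K)
    (hG : ∀ j, (G j).Finite) (hR : ∀ j, Algebra.adjoin k (G j) = R j)
    (H1 : ∀ V : ValuationSubring K, IsOver k V → ∃ j, ∀ r ∈ R j, r ∈ V)
    (H2 : ∀ V : ValuationSubring K, IsOver k V → (∀ a ∈ A, a ∈ V) → ∀ j, (∀ r ∈ R j, r ∈ V) →
      ∃ g ∈ A, V.valuation g = 1 ∧ ∀ r ∈ R j, ∃ n : ℕ, r * g ^ n ∈ A) :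
    ∃ S : Set K, S.Finite ∧ 1 ∈ S ∧ Algebra.adjoin k S = A ∧
      ∀ V : ValuationSubring K, IsOver k V → (¬ ∀ a ∈ A, a ∈ V) →
        ∃ a ∈ S, ∃ j, (∀ s ∈ S, V.valuation s ≤ V.valuation a) ∧ a ∉ V ∧
          ∀ r ∈ G j, r * a ∈ S := by
  classical
  let ι := {p : K × J // p.1 ∈ A ∧ ∀ r ∈ G p.2, p.1 * r ∈ A}
  obtain ⟨Φ, hΦ⟩ := compactness k T hT (fun i : ι => i.1.1) (fun i => G i.1.2) (fun i => hG _) (by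
    intro V hV hVT
    obtain ⟨h, hhA, j, hhV, hh⟩ := exists_denominator k A T hT hA R G hG hR H1 H2 V hV hVT
    exact ⟨⟨(h, j), hhA, fun r hr => (hh r hr).2⟩, hhV, fun r hr => (hh r hr).1⟩)
  let s : Option ι → Set K := fun o => match o with
    | none => insert 1 T
    | some i => insert 1 (insert i.1.1 ((fun r => i.1.1 * r) '' G i.1.2))
  have hs1 : ∀ o, (1 : K) ∈ s o := by
    rintro (_ | i) <;> simp [s]
  have hsfin : ∀ o, (s o).Finite := by
    rintro (_ | i)
    · exact hT.insert 1
    · exact (((hG _).image _).insert _).insert _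
  have hTA : T ⊆ A := hA ▸ Algebra.subset_adjoin
  have hsA : ∀ o, s o ⊆ A := by
    rintro (_ | i)
    · exact Set.insert_subset (one_mem A) hTA
    · refine Set.insert_subset (one_mem A) (Set.insert_subset i.2.1 ?_)
      rintro _ ⟨r, hr, rfl⟩
      exact i.2.2 r hr
  let Ψ : Finset (Option ι) := insert none (Φ.image some)
  refine ⟨∏ o ∈ Ψ, s o, ?_, ?_, ?_, ?_⟩
  · exact Set.Finite.subset ((Ψ.prod (fun o => (hsfin o).toFinset)).finite_toSet) (by
      rw [Finset.coe_prod]; simp)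
  · exact (Set.mem_finsetProd _ _ _).2 ⟨fun _ => 1, fun _ => hs1 _, by simp⟩
  · apply le_antisymm
    · rw [Algebra.adjoin_le_iff]
      intro x hx
      obtain ⟨g, hg, rfl⟩ := (Set.mem_finsetProd _ _ _).1 hx
      exact prod_mem fun o ho => hsA o (hg ho)
    · rw [← hA]
      apply Algebra.adjoin_mono
      intro t ht
      refine (Set.mem_finsetProd _ _ _).2 ⟨fun o => if o = none then t else 1, ?_, ?_⟩
      · intro o _
        by_cases h : o = none
        · subst h; simp [s, ht]
        · simpa [h] using hs1 o
      · rw [Finset.prod_ite_eq' Ψ none (fun _ => t)]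
        simp [Ψ]
  · intro V hV hVA
    rw [← hA, adjoin_le_iff_of_isOver k hV] at hVA
    obtain ⟨i, hi, hiV, hiG⟩ := hΦ V hV hVA
    have hex : ∀ o, ∃ a ∈ s o, (∀ x ∈ s o, V.valuation x ≤ V.valuation a) ∧
        (o = some i → a = i.1.1) := by
      intro o
      by_cases ho : o = some i
      · subst ho
        refine ⟨i.1.1, by simp [s], ?_, fun _ => rfl⟩
        have hlt := one_lt_valuation_iff.2 hiV
        rintro x (rfl | rfl | ⟨r, hr, rfl⟩)
        · simpa using hlt.le
        · exact le_rfl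
        · simp only [map_mul]
          exact mul_le_of_le_one_right' ((V.valuation_le_one_iff r).2 (hiG r hr))
      · obtain ⟨a, ha, ha'⟩ := Set.exists_max_image (s o) V.valuation (hsfin o) ⟨1, hs1 o⟩
        exact ⟨a, ha, ha', fun h => absurd h ho⟩
    choose a has hamax hai using hex
    have hmem : some i ∈ Ψ := by simp [Ψ, hi]
    refine ⟨∏ o ∈ Ψ, a o, (Set.mem_finsetProd _ _ _).2 ⟨a, fun _ => has _, rfl⟩, i.1.2, ?_, ?_, ?_⟩
    · intro x hx
      obtain ⟨g, hg, rfl⟩ := (Set.mem_finsetProd _ _ _).1 hx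
      rw [map_prod, map_prod]
      exact Finset.prod_le_prod' fun o ho => hamax o _ (hg ho)
    · rw [← one_lt_valuation_iff, map_prod, ← Finset.mul_prod_erase _ _ hmem, hai _ rfl]
      refine lt_mul_of_lt_of_one_le (one_lt_valuation_iff.2 hiV) ?_
      exact Finset.one_le_prod' fun o _ => by simpa using hamax o 1 (hs1 o)
    · intro r hr
      refine (Set.mem_finsetProd _ _ _).2 ⟨Function.update a (some i) (i.1.1 * r), ?_, ?_⟩
      · intro o _
        by_cases ho : o = some i
        · subst ho
          simp only [Function.update_self]
          exact Or.inr (Or.inr ⟨r, hr, rfl⟩)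
        · simpa [ho] using has o
      · rw [Finset.prod_update_of_mem hmem, ← Finset.mul_prod_erase _ _ hmem, hai _ rfl,
          Finset.erase_eq]
        ring

end Blowup

section Normalization

variable {K : Type*} [Field K]

theorem isIntegral_of_forall_valuationSubring (D : Subring K) {f : K}
    (h : ∀ V : ValuationSubring K, D ≤ V.toSubring → f ∈ V) : IsIntegral D f := by
  have h1 : f ∈ ⨅ V : {V : ValuationSubring K // (D : Set K) ⊆ V.toSubring},
      V.1.toSubring := by
    rw [Subring.mem_iInf]
    exact fun V => h V.1 V.2
  rw [iInf_valuationSubring_superset, Subring.closure_eq] at h1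
  exact h1

variable (k : Type*) [Field k] [Algebra k K]

theorem IsOver.aeval_div {V : ValuationSubring K} (hV : IsOver k V) {n : ℕ} (x : Fin n → K)
    {y : K} (hy : y ∉ V) (c : Fin n → k)
    (hxy : ∀ i, V.valuation (x i - algebraMap k K (c i) * y) < V.valuation y)
    (Q : MvPolynomial (Fin n) k) (hQ : MvPolynomial.aeval x Q = 0) :
    MvPolynomial.eval c (MvPolynomial.homogeneousComponent Q.totalDegree Q) = 0 := by
  have hy0 : y ≠ 0 := by rintro rfl; exact hy (zero_mem V)
  have hvy0 : 0 < V.valuation y := (Valuation.pos_iff _).2 hy0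
  have hvy := one_lt_valuation_iff.2 hy
  let φ : k →+* V := (algebraMap k K).codRestrict V.toSubring hV
  have hd : ∀ i, V.valuation (x i / y - algebraMap k K (c i)) < 1 := by
    intro i
    have : x i / y - algebraMap k K (c i) = (x i - algebraMap k K (c i) * y) / y := by
      field_simp
    rw [this, map_div₀, div_lt_one₀ hvy0]
    exact hxy i
  have hz : ∀ i, x i / y ∈ V := by
    intro i
    have h1 : x i / y - algebraMap k K (c i) ∈ V := (V.valuation_le_one_iff _).1 (hd i).le
    simpa using add_mem h1 (hV (c i))
  let z : Fin n → V := fun i => ⟨x i / y, hz i⟩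
  have hzval : ∀ P : MvPolynomial (Fin n) k,
      ((MvPolynomial.eval₂ φ z P : V) : K) = MvPolynomial.aeval (fun i => x i / y) P := by
    intro P
    rw [MvPolynomial.aeval_def]
    exact MvPolynomial.eval₂_comp_left V.subtype φ z P
  set D := Q.totalDegree with hD
  by_contra hne
  have hunit : ((MvPolynomial.eval₂ φ z (MvPolynomial.homogeneousComponent D Q) : V)) ∉
      IsLocalRing.maximalIdeal V := by
    intro hmem
    rw [← IsLocalRing.residue_eq_zero_iff, MvPolynomial.eval₂_comp_left] at hmem
    have : (IsLocalRing.residue V) ∘ z = fun i => (IsLocalRing.residue V).comp φ (c i) := by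
      funext i
      rw [RingHom.comp_apply, Function.comp_apply, ← sub_eq_zero, ← map_sub,
        IsLocalRing.residue_eq_zero_iff, V.valuation_lt_one_iff]
      exact hd i
    rw [this] at hmem
    have h2 := MvPolynomial.eval₂_comp_left ((IsLocalRing.residue V).comp φ) (RingHom.id k) c
      (MvPolynomial.homogeneousComponent D Q)
    rw [RingHom.comp_id] at h2
    erw [← h2] at hmem
    exact hne ((map_eq_zero _).1 hmem)
  have hval : V.valuation (MvPolynomial.aeval (fun i => x i / y)
      (MvPolynomial.homogeneousComponent D Q)) = 1 := by
    rw [← hzval]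
    rw [V.valuation_lt_one_iff, not_lt] at hunit
    exact le_antisymm (V.valuation_le_one _) hunit
  have hsum : ∀ d, MvPolynomial.aeval x (MvPolynomial.homogeneousComponent d Q) =
      y ^ d * MvPolynomial.aeval (fun i => x i / y) (MvPolynomial.homogeneousComponent d Q) := by
    intro d
    rw [MvPolynomial.aeval_def, MvPolynomial.aeval_def, MvPolynomial.eval₂_eq',
      MvPolynomial.eval₂_eq', Finset.mul_sum]
    refine Finset.sum_congr rfl fun μ hμ => ?_
    have hdeg : ∑ i, μ i = d := by
      have h1 := (MvPolynomial.homogeneousComponent_isHomogeneous d Q)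
        (MvPolynomial.mem_support_iff.1 hμ)
      rw [Finsupp.weight_apply, Finsupp.sum_fintype _ _ (by simp)] at h1
      simpa using h1
    have h2 : ∀ i, x i ^ μ i = y ^ μ i * (x i / y) ^ μ i := fun i => by
      rw [← mul_pow, mul_div_cancel₀ _ hy0]
    rw [Finset.prod_congr rfl fun i _ => h2 i, Finset.prod_mul_distrib, Finset.prod_pow_eq_pow_sum,
      hdeg]
    ring
  have h0 : ∑ d ∈ Finset.range (D + 1), y ^ d * MvPolynomial.aeval (fun i => x i / y)
      (MvPolynomial.homogeneousComponent d Q) = 0 := by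
    rw [← hQ]
    conv_rhs => rw [← MvPolynomial.sum_homogeneousComponent Q, map_sum]
    exact Finset.sum_congr rfl fun d _ => (hsum d).symm
  rw [Finset.sum_range_succ, add_comm, add_eq_zero_iff_eq_neg] at h0
  have h3 := congrArg V.valuation h0
  rw [Valuation.map_neg, map_mul, hval, mul_one, map_pow] at h3
  have h4 : V.valuation (∑ d ∈ Finset.range D, y ^ d * MvPolynomial.aeval (fun i => x i / y)
      (MvPolynomial.homogeneousComponent d Q)) < V.valuation y ^ D := by
    apply Valuation.map_sum_lt _ (pow_pos hvy0 _).ne'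
    intro d hd
    rw [map_mul, map_pow, ← hzval]
    calc _ ≤ V.valuation y ^ d * 1 := mul_le_mul_right (V.valuation_le_one _) _
      _ < _ := by rw [mul_one]; exact pow_lt_pow_right₀ hvy (Finset.mem_range.1 hd)
  exact h4.ne h3.symm

theorem exists_linear_normalization [Infinite k] (S : Set K) (hS : S.Finite) :
    ∃ (m : ℕ) (x : Fin m → K), (∀ i, x i ∈ Submodule.span k S) ∧ AlgebraicIndependent k x ∧
      ∀ V : ValuationSubring K, IsOver k V → ∀ s ∈ S, s ∈ V ∨
        ∃ i, V.valuation s ≤ V.valuation (x i) := by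
  classical
  let good : ℕ → Prop := fun m => ∃ x : Fin m → K, (∀ i, x i ∈ Submodule.span k S) ∧
      ∀ V : ValuationSubring K, IsOver k V → ∀ s ∈ S, s ∈ V ∨
        ∃ i, V.valuation s ≤ V.valuation (x i)
  have hex : ∃ m, good m := by
    obtain ⟨m, x, hx⟩ := hS.fin_param
    refine ⟨m, x, fun i => Submodule.subset_span (hx.2 ▸ Set.mem_range_self i), fun V _ s hs => ?_⟩
    rw [← hx.2] at hs
    obtain ⟨i, rfl⟩ := hs
    exact Or.inr ⟨i, le_rfl⟩
  obtain ⟨x, hxS, hx⟩ := Nat.find_spec hex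
  have hmin := fun m => Nat.find_min (m := m) hex
  generalize Nat.find hex = m at x hxS hx hmin
  refine ⟨m, x, hxS, ?_, hx⟩
  by_contra hind
  rw [algebraicIndependent_iff] at hind
  push Not at hind
  obtain ⟨Q, hQ, hQ0⟩ := hind
  have hP : MvPolynomial.homogeneousComponent Q.totalDegree Q ≠ 0 := by
    obtain ⟨μ, hμ, hμd⟩ := Finset.exists_mem_eq_sup Q.support
      (MvPolynomial.support_nonempty.2 hQ0) fun s => s.sum fun _ e => e
    intro h0
    have h1 := congrArg (MvPolynomial.coeff μ) h0
    rw [MvPolynomial.coeff_homogeneousComponent, if_pos (by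
      rw [MvPolynomial.totalDegree, hμd]; rfl), MvPolynomial.coeff_zero] at h1
    exact MvPolynomial.mem_support_iff.1 hμ h1
  obtain ⟨c, hc⟩ : ∃ c, MvPolynomial.eval c
      (MvPolynomial.homogeneousComponent Q.totalDegree Q) ≠ 0 := by
    by_contra! hall
    exact hP (MvPolynomial.funext fun c => by simpa using hall c)
  obtain ⟨i₀, hi₀⟩ : ∃ i, c i ≠ 0 := by
    by_contra! h0
    obtain rfl : c = 0 := funext h0
    rw [MvPolynomial.eval_zero, MvPolynomial.constantCoeff_eq,
      MvPolynomial.coeff_homogeneousComponent] at hc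
    have hdeg : Q.totalDegree = 0 := by
      by_contra hne
      rw [if_neg (by simpa using Ne.symm hne)] at hc
      exact hc rfl
    rw [MvPolynomial.totalDegree_eq_zero_iff_eq_C] at hdeg
    rw [hdeg, MvPolynomial.aeval_C, map_eq_zero] at hQ
    rw [hQ, map_zero] at hdeg
    exact hQ0 hdeg
  obtain ⟨n, rfl⟩ : ∃ n, m = n + 1 := ⟨m - 1, by have := i₀.pos; omega⟩
  let y : K := algebraMap k K (c i₀)⁻¹ * x i₀
  have hyS : y ∈ Submodule.span k S := by
    have : y = (c i₀)⁻¹ • x i₀ := (Algebra.smul_def _ _).symm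
    rw [this]
    exact Submodule.smul_mem _ _ (hxS i₀)
  let x' : Fin (n + 1) → K := fun i => x i - algebraMap k K (c i) * y
  have hx'0 : x' i₀ = 0 := by
    have : algebraMap k K (c i₀) ≠ 0 := by simpa using hi₀
    simp [x', y, this]
  refine hmin n (by omega) ⟨fun i => x' (i₀.succAbove i), fun i => ?_, ?_⟩
  · refine sub_mem (hxS _) ?_
    rw [← Algebra.smul_def]; exact Submodule.smul_mem _ _ hyS
  intro V hV
  have hsucc : ∀ i, i ≠ i₀ → ∃ j, i₀.succAbove j = i := fun i hi => Fin.exists_succAbove_eq hi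
  have hy : V.valuation y ≤ 1 ∨ ∃ i, V.valuation y ≤ V.valuation (x' (i₀.succAbove i)) := by
    by_contra! hcon
    obtain ⟨hy1, hy2⟩ := hcon
    refine hc (hV.aeval_div k x (one_lt_valuation_iff.1 hy1) c (fun i => ?_) Q hQ)
    by_cases hi : i = i₀
    · subst hi
      change V.valuation (x' i) < _
      rw [hx'0, map_zero]
      exact zero_lt_one.trans hy1
    · obtain ⟨j, rfl⟩ := hsucc i hi
      exact hy2 j
  have hxi : ∀ i, V.valuation (x i) ≤ 1 ∨ ∃ j, V.valuation (x i) ≤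
      V.valuation (x' (i₀.succAbove j)) := by
    intro i
    have h1 : V.valuation (x i) ≤ max (V.valuation (x' i)) (V.valuation y) := by
      have : x i = x' i + algebraMap k K (c i) * y := by simp [x']
      rw [this]
      refine (V.valuation.map_add _ _).trans (max_le_max le_rfl ?_)
      rw [map_mul]
      exact mul_le_of_le_one_left' ((V.valuation_le_one_iff _).2 (hV _))
    rcases le_max_iff.1 h1 with h | h
    · by_cases hi : i = i₀
      · subst hi
        rw [hx'0, map_zero] at h
        exact Or.inl (h.trans zero_le_one)
      · obtain ⟨j, rfl⟩ := hsucc i hi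
        exact Or.inr ⟨j, h⟩
    · rcases hy with hy | ⟨j, hj⟩
      · exact Or.inl (h.trans hy)
      · exact Or.inr ⟨j, h.trans hj⟩
  intro s hs
  rcases hx V hV s hs with h | ⟨i, hi⟩
  · exact Or.inl h
  · rcases hxi i with h | ⟨j, hj⟩
    · exact Or.inl ((V.valuation_le_one_iff _).1 (hi.trans h))
    · exact Or.inr ⟨j, hi.trans hj⟩

end Normalization

section Degree

open MvPolynomial
open scoped WithZero

variable {σ k : Type*} [Field k]

/-- The valuation `p ↦ exp (totalDegree p)` on a polynomial ring. -/
noncomputable def degreeValuation (σ k : Type*) [Field k] : Valuation (MvPolynomial σ k) ℤᵐ⁰ := by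
  classical
  exact
  { toFun := fun p => if p = 0 then 0 else WithZero.exp (p.totalDegree : ℤ)
    map_zero' := by simp
    map_one' := by simp
    map_mul' := fun p q => by
      by_cases hp : p = 0
      · simp [hp]
      by_cases hq : q = 0
      · simp [hq]
      simp [hp, hq, totalDegree_mul_of_isDomain hp hq, WithZero.exp_add]
    map_add_le_max' := fun p q => by
      by_cases hpq : p + q = 0
      · simp [hpq]
      by_cases hp : p = 0
      · simp [hp]
      by_cases hq : q = 0
      · simp [hq]
      simp only [hpq, hp, hq, if_false, le_max_iff, WithZero.exp_le_exp, Nat.cast_le]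
      exact le_max_iff.1 (totalDegree_add p q) }

theorem degreeValuation_of_ne_zero {p : MvPolynomial σ k} (hp : p ≠ 0) :
    degreeValuation σ k p = WithZero.exp (p.totalDegree : ℤ) := if_neg hp

theorem degreeValuation_le_exp_iff {p : MvPolynomial σ k} {n : ℤ} :
    degreeValuation σ k p ≤ WithZero.exp n ↔ ∀ μ ∈ p.support, (μ.degree : ℤ) ≤ n := by
  by_cases hp : p = 0
  · simp [hp]
  rw [degreeValuation_of_ne_zero hp, WithZero.exp_le_exp]
  constructor
  · intro h μ hμ
    exact (Nat.cast_le.2 (le_totalDegree hμ)).trans h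
  · intro h
    obtain ⟨μ, hμ, hμd⟩ := Finset.exists_mem_eq_sup p.support
      (MvPolynomial.support_nonempty.2 hp) fun s => s.sum fun _ e => e
    rw [totalDegree, hμd]
    exact h μ hμ

theorem degreeValuation_eq_zero {p : MvPolynomial σ k} : degreeValuation σ k p = 0 ↔ p = 0 := by
  constructor
  · intro h
    by_contra hp
    rw [degreeValuation_of_ne_zero hp] at h
    exact WithZero.exp_ne_zero h
  · rintro rfl; simp

variable (K₀ : Type*) [Field K₀] [Algebra (MvPolynomial σ k) K₀]
  [IsFractionRing (MvPolynomial σ k) K₀]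

/-- The degree valuation on the field of rational functions. -/
noncomputable def fracDegree : Valuation K₀ ℤᵐ⁰ :=
  (degreeValuation σ k).extendToLocalization (S := nonZeroDivisors (MvPolynomial σ k))
    (fun _ hp h => nonZeroDivisors.ne_zero hp (degreeValuation_eq_zero.1 h)) K₀

theorem fracDegree_algebraMap (p : MvPolynomial σ k) :
    fracDegree (σ := σ) (k := k) K₀ (algebraMap _ K₀ p) = degreeValuation σ k p :=
  Valuation.extendToLocalization_apply_map_apply ..

theorem fracDegree_X (i : σ) :
    fracDegree (σ := σ) (k := k) K₀ (algebraMap _ K₀ (X i : MvPolynomial σ k)) =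
      WithZero.exp 1 := by
  rw [fracDegree_algebraMap, degreeValuation_of_ne_zero (X_ne_zero i), totalDegree_X]
  simp

variable {K₀}

theorem eq_zero_of_fracDegree_lt_one {p : MvPolynomial σ k}
    (h : fracDegree (σ := σ) (k := k) K₀ (algebraMap _ K₀ p) < 1) : p = 0 := by
  by_contra hp
  rw [fracDegree_algebraMap, degreeValuation_of_ne_zero hp, ← WithZero.exp_zero,
    WithZero.exp_lt_exp] at h
  omega

theorem exists_polynomial_near {a b : σ} (hab : a ≠ b) {φ₁ φ₂ : K₀} {k₁ k₂ : ℕ}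
    {p₁ p₂ : MvPolynomial σ k}
    (h₁ : φ₁ * algebraMap _ K₀ (X a : MvPolynomial σ k) ^ k₁ = algebraMap _ K₀ p₁)
    (h₂ : φ₂ * algebraMap _ K₀ (X b : MvPolynomial σ k) ^ k₂ = algebraMap _ K₀ p₂)
    {n : ℤ} (h : fracDegree (σ := σ) (k := k) K₀ (φ₁ - φ₂) ≤ WithZero.exp n) :
    ∃ β : MvPolynomial σ k,
      fracDegree (σ := σ) (k := k) K₀ (φ₁ - algebraMap _ K₀ β) ≤ WithZero.exp n := by
  classical
  set v := fracDegree (σ := σ) (k := k) K₀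
  have hv : ∀ (c : σ) (l : ℕ), v (algebraMap _ K₀ (X c : MvPolynomial σ k) ^ l) =
      WithZero.exp (l : ℤ) := fun c l => by
    rw [map_pow, fracDegree_X, ← WithZero.exp_nsmul]; simp
  set s : σ →₀ ℕ := Finsupp.single a k₁
  refine ⟨p₁.divMonomial s, ?_⟩
  set r := p₁.modMonomial s with hr
  have hdecomp : p₁ = X a ^ k₁ * p₁.divMonomial s + r := by
    rw [X_pow_eq_monomial]; exact (divMonomial_add_modMonomial p₁ s).symm
  have h3 : (φ₁ - algebraMap _ K₀ (p₁.divMonomial s)) *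
      algebraMap _ K₀ (X a : MvPolynomial σ k) ^ k₁ = algebraMap _ K₀ r := by
    rw [sub_mul, h₁]
    nth_rewrite 1 [hdecomp]
    rw [map_add, map_mul, map_pow]
    ring
  have hq : (φ₁ - φ₂) * (algebraMap _ K₀ (X a : MvPolynomial σ k) ^ k₁ *
      algebraMap _ K₀ (X b : MvPolynomial σ k) ^ k₂) =
      algebraMap _ K₀ (p₁ * X b ^ k₂ - p₂ * X a ^ k₁) := by
    rw [map_sub, map_mul, map_mul, map_pow, map_pow, ← h₁, ← h₂]; ring
  have hqv : degreeValuation σ k (p₁ * X b ^ k₂ - p₂ * X a ^ k₁) ≤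
      WithZero.exp (n + (k₁ + k₂)) := by
    rw [← fracDegree_algebraMap K₀, ← hq, map_mul, map_mul, hv, hv, WithZero.exp_add,
      WithZero.exp_add]
    exact mul_le_mul_left h _
  rw [degreeValuation_le_exp_iff] at hqv
  have hrv : degreeValuation σ k r ≤ WithZero.exp (n + k₁) := by
    rw [degreeValuation_le_exp_iff]
    intro μ hμ
    have hμa : μ a < k₁ := by
      by_contra! hle
      apply MvPolynomial.mem_support_iff.1 hμ
      exact coeff_modMonomial_of_le _ (Finsupp.single_le_iff.2 hle)
    have hμs : ¬ s ≤ μ := fun hle => absurd (Finsupp.single_le_iff.1 hle) (by omega)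
    have hμp : coeff μ p₁ ≠ 0 := by
      rw [← coeff_modMonomial_of_not_le p₁ hμs]
      exact MvPolynomial.mem_support_iff.1 hμ
    have := hqv (μ + Finsupp.single b k₂) (by
      rw [MvPolynomial.mem_support_iff, coeff_sub, X_pow_eq_monomial, X_pow_eq_monomial,
        coeff_mul_monomial, coeff_mul_monomial', if_neg, sub_zero, mul_one]
      · exact hμp
      · intro hle
        have h4 := Finsupp.single_le_iff.1 hle
        simp only [Finsupp.add_apply, Finsupp.single_apply, if_neg hab.symm] at h4
        omega)
    rw [map_add, Finsupp.degree_single] at this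
    push_cast at this
    omega
  rw [← fracDegree_algebraMap K₀, ← h3, map_mul, hv, WithZero.exp_add] at hrv
  exact (mul_le_mul_iff_left₀ (WithZero.exp_pos)).1 hrv

theorem mem_nonunits_of_fracDegree_lt_one {K : Type*} [Field K] [Algebra K₀ K] [Algebra k K]
    [Algebra (MvPolynomial σ k) K] [IsScalarTower (MvPolynomial σ k) K₀ K]
    [IsScalarTower k (MvPolynomial σ k) K]
    {V : ValuationSubring K} (hV : IsOver k V) {a : σ}
    (ha : algebraMap _ K (X a : MvPolynomial σ k) ∉ V)
    (hchart : ∀ i, V.valuation (algebraMap _ K (X i : MvPolynomial σ k)) ≤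
      V.valuation (algebraMap _ K (X a : MvPolynomial σ k)))
    {φ : K₀} {l : ℕ} {p : MvPolynomial σ k}
    (h₁ : φ * algebraMap _ K₀ (X a : MvPolynomial σ k) ^ l = algebraMap _ K₀ p)
    (h : fracDegree (σ := σ) (k := k) K₀ φ < 1) :
    V.valuation (algebraMap K₀ K φ) < 1 := by
  set xa := algebraMap _ K (X a : MvPolynomial σ k) with hxa
  have hva := one_lt_valuation_iff.2 ha
  have hp : degreeValuation σ k p < WithZero.exp (l : ℤ) := by
    rw [← fracDegree_algebraMap K₀, ← h₁, map_mul, map_pow, fracDegree_X, ← WithZero.exp_nsmul]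
    simpa using mul_lt_mul_of_pos_right h (WithZero.exp_pos (a := (l : ℤ)))
  have hp' : ∀ μ ∈ p.support, μ.degree < l := by
    intro μ hμ
    have hp0 : p ≠ 0 := by rintro rfl; simp at hμ
    rw [degreeValuation_of_ne_zero hp0, WithZero.exp_lt_exp] at hp
    have := le_totalDegree hμ
    change μ.degree ≤ _ at this
    omega
  have h2 : algebraMap K₀ K φ * xa ^ l = algebraMap _ K p := by
    rw [IsScalarTower.algebraMap_apply (MvPolynomial σ k) K₀ K p, ← h₁, map_mul, map_pow,
      ← IsScalarTower.algebraMap_apply]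
  have h3 : V.valuation (algebraMap _ K p) < V.valuation xa ^ l := by
    rw [p.as_sum, map_sum]
    apply Valuation.map_sum_lt _ (pow_pos (zero_lt_one.trans hva) _).ne'
    intro μ hμ
    have hC : algebraMap (MvPolynomial σ k) K (C (coeff μ p)) = algebraMap k K (coeff μ p) :=
      (IsScalarTower.algebraMap_apply k (MvPolynomial σ k) K _).symm
    rw [monomial_eq, map_mul, map_mul, hC, Finsupp.prod, map_prod, map_prod]
    calc _ ≤ 1 * ∏ i ∈ μ.support, V.valuation xa ^ μ i := by
          refine mul_le_mul' ((V.valuation_le_one_iff _).2 (hV _)) ?_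
          refine Finset.prod_le_prod' fun i _ => ?_
          rw [map_pow, map_pow]
          exact pow_le_pow_left' (hchart i) _
      _ = V.valuation xa ^ μ.degree := by
          rw [one_mul, Finset.prod_pow_eq_pow_sum]; rfl
      _ < _ := pow_lt_pow_right₀ hva (hp' μ hμ)
  rw [← h2, map_mul, map_pow] at h3
  exact (mul_lt_iff_lt_one_left (pow_pos (zero_lt_one.trans hva) _)).1 h3

end Degree

section Idempotents

variable {K : Type*} [Field K] (k : Type*) [Field k] [Algebra k K]

/-- The valuation subrings over `k` at which all elements of `S` are dominated by `z`. -/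
def chart (S : Set K) (z : K) : Set (ValuationSubring K) :=
  {V | IsOver k V ∧ ∀ s ∈ S, V.valuation s ≤ V.valuation z}

/-- The intersection of all valuation subrings in a chart. -/
def chartRing (S : Set K) (z : K) : Subring K :=
  ⨅ V ∈ chart k S z, V.toSubring

variable {k} {S : Set K} {z : K}

theorem mem_chartRing {f : K} : f ∈ chartRing k S z ↔ ∀ V ∈ chart k S z, f ∈ V := by
  simp [chartRing, Subring.mem_iInf]

theorem div_mem_chartRing (hz : z ≠ 0) {s : K} (hs : s ∈ S) : s / z ∈ chartRing k S z :=
  mem_chartRing.2 fun _ hV => (div_mem_iff hz).2 (hV.2 s hs)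

theorem inv_mem_chartRing (hz : z ≠ 0) (h1 : 1 ∈ S) : z⁻¹ ∈ chartRing k S z := by
  simpa using div_mem_chartRing (k := k) hz h1

theorem algebraMap_mem_chartRing (c : k) : algebraMap k K c ∈ chartRing k S z :=
  mem_chartRing.2 fun _ hV => hV.1 c

theorem mem_chart_of_le (hz : z ≠ 0) {V : ValuationSubring K}
    (hV : chartRing k S z ≤ V.toSubring) : V ∈ chart k S z :=
  ⟨fun c => hV (algebraMap_mem_chartRing c),
    fun _ hs => (div_mem_iff hz).1 (hV (div_mem_chartRing hz hs))⟩

theorem exists_pow_mul_mem_of_adjoin {C : Subring K} (hC : ∀ c : k, algebraMap k K c ∈ C) {u : K}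
    (hu : u ∈ C) {G : Set K} (hG : ∀ r ∈ G, r * u ∈ C) {r : K}
    (hr : r ∈ Algebra.adjoin k G) : ∃ N : ℕ, r * u ^ N ∈ C := by
  induction hr using Algebra.adjoin_induction with
  | mem x hx => exact ⟨1, by simpa using hG x hx⟩
  | algebraMap c => exact ⟨0, by simpa using hC c⟩
  | add x y _ _ hx hy =>
    obtain ⟨n, hn⟩ := hx
    obtain ⟨m, hm⟩ := hy
    refine ⟨n + m, ?_⟩
    have : (x + y) * u ^ (n + m) = x * u ^ n * u ^ m + y * u ^ m * u ^ n := by ring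
    rw [this]
    exact add_mem (mul_mem hn (pow_mem hu _)) (mul_mem hm (pow_mem hu _))
  | mul x y _ _ hx hy =>
    obtain ⟨n, hn⟩ := hx
    obtain ⟨m, hm⟩ := hy
    refine ⟨n + m, ?_⟩
    have : (x * y) * u ^ (n + m) = (x * u ^ n) * (y * u ^ m) := by ring
    rw [this]
    exact mul_mem hn hm

theorem mem_of_mul_pow_mem {V : ValuationSubring K} {r u : K} (hu : V.valuation u = 1) {N : ℕ}
    (h : r * u ^ N ∈ V) : r ∈ V := by
  rw [← V.valuation_le_one_iff] at h ⊢
  simpa [hu] using h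

theorem exists_separating (hz : z ≠ 0) {J : Type*} {R : J → Subalgebra k K} {G : J → Set K}
    (hR : ∀ j, Algebra.adjoin k (G j) = R j)
    (hS : ∀ V ∈ chart k S z, z ∉ V →
      ∃ a ∈ S, ∃ j, V.valuation z ≤ V.valuation a ∧ ∀ r ∈ G j, r * a ∈ S)
    {P : ValuationSubring K → Prop} {I : J → Set K} (hI : ∀ j, I j ⊆ R j)
    (hP : ∀ V, IsOver k V → ∀ j, (∀ r ∈ R j, r ∈ V) → (P V ↔ ∀ r ∈ I j, V.valuation r < 1))
    {V : ValuationSubring K} (hV : chartRing k S z ≤ V.toSubring) (hzV : z ∉ V) (hPV : ¬ P V) :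
    ∃ f ∈ chartRing k S z, V.valuation f = 1 ∧
      ∀ W ∈ chart k S z, z ∉ W → P W → W.valuation f < 1 := by
  have hVc := mem_chart_of_le hz hV
  obtain ⟨a, haS, j, hza, haG⟩ := hS V hVc hzV
  have huC := div_mem_chartRing (k := k) hz haS
  set u := a / z with hu
  have hu1 : V.valuation u = 1 := by
    rw [hu, map_div₀, le_antisymm (hVc.2 a haS) hza, div_self]
    exact (Valuation.ne_zero_iff _).2 hz
  have hRC : ∀ r ∈ R j, ∃ N : ℕ, r * u ^ N ∈ chartRing k S z := fun r hr =>
    exists_pow_mul_mem_of_adjoin algebraMap_mem_chartRing huC (G := G j) (fun r hr => by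
      rw [hu, ← mul_div_assoc]
      exact div_mem_chartRing hz (haG r hr)) (by rwa [hR])
  rw [hP V hVc.1 j fun r hr => by
    obtain ⟨N, hN⟩ := hRC r hr
    exact mem_of_mul_pow_mem hu1 (hV hN)] at hPV
  push Not at hPV
  obtain ⟨r, hrI, hr1⟩ := hPV
  obtain ⟨N, hN⟩ := hRC r (hI j hrI)
  refine ⟨r * u ^ N * u, mul_mem hN huC, ?_, ?_⟩
  · apply le_antisymm ((V.valuation_le_one_iff _).2 (hV (mul_mem hN huC)))
    simpa [hu1] using hr1
  · intro W hW hzW hPW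
    have huW : W.valuation u ≤ 1 := (W.valuation_le_one_iff _).2 (mem_chartRing.1 huC W hW)
    rcases huW.lt_or_eq with hlt | heq
    · rw [map_mul]
      exact Right.mul_lt_one_of_le_of_lt
        ((W.valuation_le_one_iff _).2 (mem_chartRing.1 hN W hW)) hlt
    · have hRW : ∀ r ∈ R j, r ∈ W := fun r hr => by
        obtain ⟨N, hN⟩ := hRC r hr
        exact mem_of_mul_pow_mem heq (mem_chartRing.1 hN W hW)
      simpa [heq] using (hP W hW.1 j hRW).1 hPW r hrI

theorem exists_pow_mul_mem_chartRing (hz : z ≠ 0) (h1 : 1 ∈ S) {w : K}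
    (hw : w ∈ chartRing k S z) (hlt : ∀ V ∈ chart k S z, z ∉ V → V.valuation w < 1) :
    ∃ M : ℕ, z * w ^ M ∈ chartRing k S z := by
  by_cases hw0 : w = 0
  · exact ⟨1, by simp [hw0]⟩
  set C := chartRing k S z
  let D : Subring K :=
    { carrier := {d | ∃ M : ℕ, d * w ^ M ∈ C}
      mul_mem' := by
        rintro a b ⟨n, hn⟩ ⟨m, hm⟩
        refine ⟨n + m, ?_⟩
        have : (a * b) * w ^ (n + m) = (a * w ^ n) * (b * w ^ m) := by ring
        rw [this]
        exact mul_mem hn hm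
      one_mem' := ⟨0, by simp⟩
      add_mem' := by
        rintro a b ⟨n, hn⟩ ⟨m, hm⟩
        refine ⟨n + m, ?_⟩
        have : (a + b) * w ^ (n + m) = a * w ^ n * w ^ m + b * w ^ m * w ^ n := by ring
        rw [this]
        exact add_mem (mul_mem hn (pow_mem hw _)) (mul_mem hm (pow_mem hw _))
      zero_mem' := ⟨0, by simp⟩
      neg_mem' := by
        rintro a ⟨n, hn⟩
        exact ⟨n, by rw [neg_mul]; exact neg_mem hn⟩ }
  have hCD : C ≤ D := fun c hc => ⟨0, by simpa using hc⟩
  have hzD : z⁻¹ ∈ D := hCD (inv_mem_chartRing hz h1)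
  have htop : Ideal.span {(⟨z⁻¹, hzD⟩ : D)} = ⊤ := by
    by_contra hne
    obtain ⟨V, hDV, hV⟩ := Ideal.image_subset_nonunits_valuationSubring _ hne
    have hzV : V.valuation z⁻¹ < 1 := V.mem_nonunits_iff.1
      (hV ⟨_, Ideal.subset_span (Set.mem_singleton _), rfl⟩)
    have hVc : V ∈ chart k S z := mem_chart_of_le hz (hCD.trans hDV)
    have hzV' : z ∉ V := by
      rw [← one_lt_valuation_iff]
      rw [map_inv₀] at hzV
      exact (inv_lt_one₀ ((Valuation.pos_iff _).2 hz)).1 hzV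
    have hwV : w⁻¹ ∈ V := hDV ⟨1, by simp [hw0, one_mem]⟩
    have h3 := hlt V hVc hzV'
    have h4 := (V.valuation_le_one_iff _).2 hwV
    rw [map_inv₀, inv_le_one₀ ((Valuation.pos_iff _).2 hw0)] at h4
    exact absurd h3 h4.not_gt
  rw [Ideal.eq_top_iff_one, Ideal.mem_span_singleton] at htop
  obtain ⟨d, hd⟩ := htop
  have hd' : z = d := by
    have := congrArg Subtype.val hd
    simp only [OneMemClass.coe_one, MulMemClass.coe_mul] at this
    field_simp at this
    exact this
  rw [hd']
  exact d.2

theorem exists_approximate_idempotent (hz : z ≠ 0) (h1 : 1 ∈ S) {J : Type*}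
    {R : J → Subalgebra k K} {G : J → Set K} (hR : ∀ j, Algebra.adjoin k (G j) = R j)
    (hS : ∀ V ∈ chart k S z, z ∉ V →
      ∃ a ∈ S, ∃ j, V.valuation z ≤ V.valuation a ∧ ∀ r ∈ G j, r * a ∈ S)
    {P₁ P₂ : ValuationSubring K → Prop} {I₁ I₂ : J → Set K}
    (hI₁ : ∀ j, I₁ j ⊆ R j) (hI₂ : ∀ j, I₂ j ⊆ R j)
    (hP₁ : ∀ V, IsOver k V → ∀ j, (∀ r ∈ R j, r ∈ V) → (P₁ V ↔ ∀ r ∈ I₁ j, V.valuation r < 1))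
    (hP₂ : ∀ V, IsOver k V → ∀ j, (∀ r ∈ R j, r ∈ V) → (P₂ V ↔ ∀ r ∈ I₂ j, V.valuation r < 1))
    (hP : ∀ V ∈ chart k S z, z ∉ V → (P₁ V ↔ ¬ P₂ V)) (n : ℕ) :
    ∃ e ∈ chartRing k S z, ∀ V ∈ chart k S z, z ∉ V →
      (P₁ V → z ^ n * (1 - e) ∈ V) ∧ (P₂ V → z ^ n * e ∈ V) := by
  let I : (ValuationSubring K → Prop) → Ideal (chartRing k S z) := fun P =>
    { carrier := {f | ∀ V ∈ chart k S z, z ∉ V → P V → V.valuation (f : K) < 1}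
      add_mem' := fun {f g} hf hg V hV hzV hPV =>
        Valuation.map_add_lt _ (hf V hV hzV hPV) (hg V hV hzV hPV)
      zero_mem' := fun V _ _ _ => by simp
      smul_mem' := fun c f hf V hV hzV hPV => by
        rw [smul_eq_mul, Subring.coe_mul, map_mul]
        exact Right.mul_lt_one_of_le_of_lt
          ((V.valuation_le_one_iff _).2 (mem_chartRing.1 c.2 V hV)) (hf V hV hzV hPV) }
  have htop : I P₁ ⊔ I P₂ = ⊤ := by
    by_contra hne
    obtain ⟨V, hCV, hV⟩ := Ideal.image_subset_nonunits_valuationSubring _ hne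
    have hVc := mem_chart_of_le hz hCV
    have hzI : (⟨z⁻¹, inv_mem_chartRing hz h1⟩ : chartRing k S z) ∈ I P₁ := by
      intro W hW hzW _
      rw [map_inv₀]
      exact inv_lt_one_of_one_lt₀ (one_lt_valuation_iff.2 hzW)
    have hzV : z ∉ V := by
      have := V.mem_nonunits_iff.1 (hV ⟨_, Ideal.mem_sup_left hzI, rfl⟩)
      rw [← one_lt_valuation_iff]
      change V.valuation z⁻¹ < 1 at this
      rw [map_inv₀] at this
      exact (inv_lt_one₀ ((Valuation.pos_iff _).2 hz)).1 this
    by_cases hP2 : P₂ V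
    · have hP1 : ¬ P₁ V := by rw [hP V hVc hzV]; exact not_not.2 hP2
      obtain ⟨f, hfC, hf1, hf⟩ := exists_separating hz hR hS hI₁ hP₁ hCV hzV hP1
      exact (V.mem_nonunits_iff.1 (hV ⟨⟨f, hfC⟩, Ideal.mem_sup_left hf, rfl⟩)).ne hf1
    · obtain ⟨f, hfC, hf1, hf⟩ := exists_separating hz hR hS hI₂ hP₂ hCV hzV hP2
      exact (V.mem_nonunits_iff.1 (hV ⟨⟨f, hfC⟩, Ideal.mem_sup_right hf, rfl⟩)).ne hf1
  obtain ⟨e₁, he₁, e₂, he₂, he⟩ := Submodule.mem_sup.1 ((Ideal.eq_top_iff_one _).1 htop)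
  have hmem : ∀ (c : chartRing k S z) V, V ∈ chart k S z → V.valuation (c : K) ≤ 1 :=
    fun c V hV => (V.valuation_le_one_iff _).2 (mem_chartRing.1 c.2 V hV)
  obtain ⟨M, hM⟩ := exists_pow_mul_mem_chartRing hz h1 (e₁ * e₂).2 (fun V hV hzV => by
    rw [Subring.coe_mul, map_mul]
    by_cases hP2 : P₂ V
    · exact Right.mul_lt_one_of_le_of_lt (hmem e₁ V hV) (he₂ V hV hzV hP2)
    · rw [mul_comm]
      exact Right.mul_lt_one_of_le_of_lt (hmem e₂ V hV) (he₁ V hV hzV ((hP V hV hzV).2 hP2)))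
  have hcop : IsCoprime e₁ e₂ := ⟨1, 1, by simpa using he⟩
  obtain ⟨a, b, hab⟩ := hcop.pow (m := M * n) (n := M * n)
  have key : ∀ V ∈ chart k S z, ∀ c d f g : chartRing k S z, f + g = 1 →
      (e₁ * e₂ = f * g) → c * f ^ (M * n) + d * g ^ (M * n) = 1 → V.valuation (f : K) < 1 →
      z ^ n * ((c * f ^ (M * n) : chartRing k S z) : K) ∈ V := by
    intro V hV c d f g hfg hefg hcd hf
    have hg : V.valuation (g : K) = 1 := by
      have h2 : (g : K) = 1 - f := by
        have := congrArg Subtype.val hfg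
        simp only [Subring.coe_add, Subring.coe_one] at this
        rw [← this]; ring
      rw [h2]
      exact Valuation.map_one_sub_of_lt _ hf
    have h5 := (V.valuation_le_one_iff _).2 (pow_mem (mem_chartRing.1 hM V hV) n)
    rw [← V.valuation_le_one_iff]
    rw [hefg] at h5
    have hc := hmem c V hV
    simp only [Subring.coe_mul, Subring.coe_pow, map_mul, map_pow, mul_pow, hg, one_pow,
      mul_one] at h5 ⊢
    rw [← pow_mul] at h5
    calc _ = V.valuation (c : K) * (V.valuation z ^ n * V.valuation (f : K) ^ (M * n)) := by
          rw [mul_left_comm]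
      _ ≤ 1 := mul_le_one' hc h5
  refine ⟨(b * e₂ ^ (M * n) : chartRing k S z), Subtype.coe_prop _, fun V hV hzV => ⟨?_, ?_⟩⟩
  · intro h
    have h6 : (1 : K) - (b * e₂ ^ (M * n) : chartRing k S z) =
        (a * e₁ ^ (M * n) : chartRing k S z) := by
      rw [← Subring.coe_one (chartRing k S z), ← AddSubgroupClass.coe_sub, ← hab]
      congr 1; ring
    rw [h6]
    exact key V hV a b e₁ e₂ he rfl hab (he₁ V hV hzV h)
  · intro h
    exact key V hV b a e₂ e₁ (by rw [add_comm]; exact he) (mul_comm _ _)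
      (by rw [add_comm]; exact hab) (he₂ V hV hzV h)

end Idempotents

section Integrality

variable {K : Type*} [Field K]

theorem isIntegral_of_forall_mem_valuationSubring {D : Type*} [CommRing D] [Algebra D K] {f : K}
    (h : ∀ V : ValuationSubring K, (∀ d : D, algebraMap D K d ∈ V) → f ∈ V) : IsIntegral D f := by
  let R := (algebraMap D K).range
  have h1 : IsIntegral R f := isIntegral_of_forall_valuationSubring R fun V hV =>
    h V fun d => hV ⟨d, rfl⟩
  let _ : Algebra D R := (algebraMap D K).rangeRestrict.toAlgebra
  have : IsScalarTower D R K := IsScalarTower.of_algebraMap_eq fun _ => rfl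
  have : Algebra.IsIntegral D R := Algebra.IsIntegral.of_surjective (Algebra.ofId D R)
    (algebraMap D K).rangeRestrict_surjective
  exact isIntegral_trans f h1

variable {K₀ : Type*} [Field K₀] [Algebra K₀ K] [FiniteDimensional K₀ K]

theorem trace_mem_of_forall_mem {W : ValuationSubring K₀} {f : K}
    (h : ∀ V : ValuationSubring K, (∀ d ∈ W, algebraMap K₀ K d ∈ V) → f ∈ V) :
    Algebra.trace K₀ K f ∈ W := by
  let _ : Algebra W K := ((algebraMap K₀ K).comp W.subtype).toAlgebra
  have : IsScalarTower W K₀ K := IsScalarTower.of_algebraMap_eq fun _ => rfl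
  have h1 : IsIntegral W f := isIntegral_of_forall_mem_valuationSubring fun V hV =>
    h V fun d hd => hV ⟨d, hd⟩
  obtain ⟨y, hy⟩ := IsIntegrallyClosed.isIntegral_iff.1 (Algebra.isIntegral_trace (L := K₀) h1)
  rw [← hy]
  exact y.2

theorem norm_mem_nonunits {V : ValuationSubring K} {w : K}
    (h : ∀ V' : ValuationSubring K,
      (∀ d : K₀, algebraMap K₀ K d ∈ V → algebraMap K₀ K d ∈ V') → w ∈ V')
    (hw : V.valuation w < 1) : V.valuation (algebraMap K₀ K (Algebra.norm K₀ w)) < 1 := by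
  let W : ValuationSubring K₀ := V.comap (algebraMap K₀ K)
  let _ : Algebra W K := ((algebraMap K₀ K).comp W.subtype).toAlgebra
  have : IsScalarTower W K₀ K := IsScalarTower.of_algebraMap_eq fun _ => rfl
  have h1 : IsIntegral W w := isIntegral_of_forall_mem_valuationSubring fun V' hV' =>
    h V' fun d hd => hV' ⟨d, hd⟩
  have hwV : w ∈ V := (V.valuation_le_one_iff _).1 hw.le
  have h2 := minpoly.isIntegrallyClosed_eq_field_fractions' K₀ h1
  set p := minpoly K₀ w with hp
  have hcoeff : ∀ i, algebraMap K₀ K (p.coeff i) ∈ V := by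
    intro i
    rw [h2, Polynomial.coeff_map]
    exact ((minpoly W w).coeff i).2
  have h0 : V.valuation (algebraMap K₀ K (p.coeff 0)) < 1 := by
    have h3 : Polynomial.aeval w p = 0 := minpoly.aeval K₀ w
    rw [← Polynomial.divX_mul_X_add p, map_add, map_mul, Polynomial.aeval_X, Polynomial.aeval_C,
      add_comm, add_eq_zero_iff_eq_neg] at h3
    rw [h3, Valuation.map_neg, map_mul]
    refine Right.mul_lt_one_of_le_of_lt ((V.valuation_le_one_iff _).2 ?_) hw
    rw [Polynomial.aeval_eq_sum_range]
    refine sum_mem fun i _ => ?_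
    rw [Algebra.smul_def, Polynomial.coeff_divX]
    exact mul_mem (hcoeff _) (pow_mem hwV _)
  have hintegral : IsIntegral K₀ w := IsIntegral.of_finite K₀ w
  have h4 := Algebra.PowerBasis.norm_gen_eq_coeff_zero_minpoly
    (IntermediateField.adjoin.powerBasis hintegral)
  rw [IntermediateField.adjoin.powerBasis_gen, IntermediateField.minpoly_gen] at h4
  rw [Algebra.norm_eq_norm_adjoin, h4, map_pow, map_pow]
  refine pow_lt_one₀ zero_le ?_ Module.finrank_pos.ne'
  rw [map_mul, map_mul, map_pow, map_neg, map_one, map_pow, Valuation.map_neg, map_one, one_pow,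
    one_mul]
  exact h0

open MvPolynomial

variable {σ k : Type*} [Field k] [Algebra (MvPolynomial σ k) K₀]
  [IsFractionRing (MvPolynomial σ k) K₀] [Algebra (MvPolynomial σ k) K]
  [IsScalarTower (MvPolynomial σ k) K₀ K] {a : σ} {f : K}

theorem exists_numerator_trace_and_norm
    (h : ∀ V : ValuationSubring K, (∀ p : MvPolynomial σ k, algebraMap _ K p ∈ V) →
      (algebraMap _ K (X a : MvPolynomial σ k))⁻¹ ∈ V → f ∈ V) :
    (∃ (l : ℕ) (p : MvPolynomial σ k), Algebra.trace K₀ K f *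
      algebraMap _ K₀ (X a : MvPolynomial σ k) ^ l = algebraMap _ K₀ p) ∧
    (∃ (l : ℕ) (p : MvPolynomial σ k), Algebra.norm K₀ f *
      algebraMap _ K₀ (X a : MvPolynomial σ k) ^ l = algebraMap _ K₀ p) := by
  have hM : Submonoid.powers (X a : MvPolynomial σ k) ≤ nonZeroDivisors _ :=
    powers_le_nonZeroDivisors_of_noZeroDivisors (X_ne_zero a)
  let D := Localization.subalgebra.ofField K₀ _ hM
  have : IsIntegrallyClosed D := isIntegrallyClosed_of_isLocalization D _ hM
  have hX : algebraMap _ K₀ (X a : MvPolynomial σ k) ≠ 0 := by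
    simp [X_ne_zero]
  have hXD : (algebraMap _ K₀ (X a : MvPolynomial σ k))⁻¹ ∈ D :=
    ⟨1, X a, Submonoid.mem_powers _, by simp⟩
  have h1 : IsIntegral D f := isIntegral_of_forall_mem_valuationSubring fun V hV =>
    h V (fun p => by
        have := hV (algebraMap _ D p)
        rwa [IsScalarTower.algebraMap_apply D K₀ K, ← IsScalarTower.algebraMap_apply _ D K₀,
          ← IsScalarTower.algebraMap_apply _ K₀ K] at this)
      (by
        have := hV ⟨_, hXD⟩
        rw [IsScalarTower.algebraMap_apply D K₀ K] at this
        rw [IsScalarTower.algebraMap_apply (MvPolynomial σ k) K₀ K, ← map_inv₀]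
        exact this)
  have key : ∀ y : K₀, IsIntegral D y → ∃ (l : ℕ) (p : MvPolynomial σ k), y *
      algebraMap _ K₀ (X a : MvPolynomial σ k) ^ l = algebraMap _ K₀ p := by
    intro y hy
    obtain ⟨d, rfl⟩ := IsIntegrallyClosed.isIntegral_iff.1 hy
    obtain ⟨p, s, ⟨l, rfl⟩, hd⟩ := d.2
    refine ⟨l, p, ?_⟩
    change (d : K₀) * _ = _
    rw [hd, map_pow]
    field_simp
  exact ⟨key _ (Algebra.isIntegral_trace h1), key _ (Algebra.isIntegral_norm K₀ h1)⟩

end Integrality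

section Determinant

theorem valuation_det_one_sub {K₀ Γ ι : Type*} [Field K₀] [LinearOrderedCommGroupWithZero Γ]
    [Fintype ι] [DecidableEq ι] (v : Valuation K₀ Γ) (M : Matrix ι ι K₀)
    (hM : ∀ i j, v (M i j) < 1) : v ((1 - M).det - 1) < 1 := by
  let O := v.valuationSubring
  let M' : Matrix ι ι O := fun i j => ⟨M i j, (hM i j).le⟩
  have hmem : ∀ x : O, x ∈ IsLocalRing.maximalIdeal O ↔ v (x : K₀) < 1 := fun x => by
    rw [O.valuation_lt_one_iff]
    exact (Valuation.isEquiv_iff_val_lt_one.1 v.isEquiv_valuation_valuationSubring).symm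
  have h1 : (1 - M).det - 1 = (((1 - M').det - 1 : O) : K₀) := by
    have : (algebraMap O K₀).mapMatrix (1 - M') = 1 - M := by
      rw [map_sub, map_one]; rfl
    rw [show (((1 - M').det - 1 : O) : K₀) = algebraMap O K₀ ((1 - M').det - 1) from rfl,
      map_sub, map_one, RingHom.map_det, this]
  rw [h1, ← hmem, ← IsLocalRing.residue_eq_zero_iff, map_sub, map_one, RingHom.map_det, map_sub,
    map_one]
  have h2 : (IsLocalRing.residue O).mapMatrix M' = 0 := by
    ext i j
    exact (IsLocalRing.residue_eq_zero_iff _).2 ((hmem _).2 (hM i j))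
  rw [h2]
  simp

end Determinant

section NullSequences

open Filter
open scoped WithZero

variable {F : Type*} [Field F]

/-- The sequences converging to zero for a valuation. -/
def nullSequences (v : Valuation F ℤᵐ⁰) : Submodule F (ℕ → F) where
  carrier := {s | ∀ N : ℤ, ∀ᶠ n in atTop, v (s n) ≤ WithZero.exp N}
  zero_mem' := fun N => by simp
  add_mem' := fun {s t} hs ht N => by
    filter_upwards [hs N, ht N] with n h1 h2
    exact v.map_add_le h1 h2
  smul_mem' := fun c s hs N => by
    by_cases hc : c = 0
    · simp [hc]
    have hvc : v c ≠ 0 := (Valuation.ne_zero_iff _).2 hc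
    filter_upwards [hs (N - WithZero.log (v c))] with n h1
    rw [Pi.smul_apply, smul_eq_mul, map_mul]
    calc v c * v (s n) ≤ v c * WithZero.exp (N - WithZero.log (v c)) := by gcongr
      _ = WithZero.exp N := by
        conv_lhs => rw [← WithZero.exp_log hvc, ← WithZero.exp_add, WithZero.log_exp]
        simp

variable {v : Valuation F ℤᵐ⁰}

theorem mem_nullSequences_of_le {s : ℕ → F} (m : ℤ) (h : ∀ n : ℕ, v (s n) ≤ WithZero.exp (m - n)) :
    s ∈ nullSequences v := by
  intro N
  filter_upwards [eventually_ge_atTop (m - N).toNat] with n hn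
  exact (h n).trans (WithZero.exp_le_exp.2 (by omega))

theorem eq_zero_of_const_mem_nullSequences {c : F} (h : (fun _ => c) ∈ nullSequences v) :
    c = 0 := by
  by_contra hc
  have hvc : v c ≠ 0 := (Valuation.ne_zero_iff _).2 hc
  obtain ⟨n, hn⟩ := (h (WithZero.log (v c) - 1)).exists
  rw [← WithZero.exp_log hvc, WithZero.log_exp, WithZero.exp_le_exp] at hn
  omega

end NullSequences

section Charts

open MvPolynomial
open scoped WithZero

variable {σ k K₀ K : Type*} [Field k] [Field K₀] [Field K] [Algebra (MvPolynomial σ k) K₀]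
  [IsFractionRing (MvPolynomial σ k) K₀] [Algebra k K] [Algebra (MvPolynomial σ k) K]
  [Algebra K₀ K] [IsScalarTower (MvPolynomial σ k) K₀ K]

/-- The image of a variable in the extension field. -/
noncomputable def coordinate (k K : Type*) [Field k] [Field K] [Algebra (MvPolynomial σ k) K]
    (i : σ) : K := algebraMap (MvPolynomial σ k) K (X i)

variable (k) in
/-- The variables form a linear Noether normalization of `S`, in valuation-theoretic terms. -/
structure IsLinearNormalization (S : Set K) : Prop where
  one_mem : (1 : K) ∈ S
  le_coordinate : ∀ V : ValuationSubring K, IsOver k V → ∀ s ∈ S,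
    s ∈ V ∨ ∃ i : σ, V.valuation s ≤ V.valuation (coordinate k K i)
  coordinate_le : ∀ a : σ, ∀ V ∈ chart k S (coordinate k K a), ∀ i : σ,
    V.valuation (coordinate k K i) ≤ V.valuation (coordinate k K a)

theorem algebraMap_coordinate (k K₀ K : Type*) [Field k] [Field K₀] [Field K]
    [Algebra (MvPolynomial σ k) K₀] [Algebra (MvPolynomial σ k) K] [Algebra K₀ K]
    [IsScalarTower (MvPolynomial σ k) K₀ K] (i : σ) :
    algebraMap K₀ K (algebraMap _ K₀ (X i : MvPolynomial σ k)) = coordinate k K i :=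
  (IsScalarTower.algebraMap_apply (MvPolynomial σ k) K₀ K _).symm

theorem coordinate_ne_zero (k K₀ K : Type*) [Field k] [Field K₀] [Field K]
    [Algebra (MvPolynomial σ k) K₀] [IsFractionRing (MvPolynomial σ k) K₀]
    [Algebra (MvPolynomial σ k) K] [Algebra K₀ K]
    [IsScalarTower (MvPolynomial σ k) K₀ K] (i : σ) : coordinate k K i ≠ 0 := by
  rw [← algebraMap_coordinate k K₀ K]
  simp [X_ne_zero]

variable {S : Set K} {a b : σ}
  {V : ValuationSubring K}

theorem mem_chart_of_mem (K₀) [Field K₀] [Algebra (MvPolynomial σ k) K₀]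
    [IsFractionRing (MvPolynomial σ k) K₀] [Algebra K₀ K] [IsScalarTower (MvPolynomial σ k) K₀ K]
    (hS : IsLinearNormalization k (σ := σ) S) (hV : IsOver k V)
    (h1 : (coordinate k K a)⁻¹ ∈ V) (h : ∀ i : σ, coordinate k K i / coordinate k K a ∈ V) :
    V ∈ chart k S (coordinate k K a) := by
  refine ⟨hV, fun s hs => ?_⟩
  have ha := coordinate_ne_zero k K₀ K a
  rw [← one_div, div_mem_iff ha, map_one] at h1
  rcases hS.le_coordinate V hV s hs with h2 | ⟨i, hi⟩
  · exact ((V.valuation_le_one_iff _).2 h2).trans h1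
  · exact hi.trans ((div_mem_iff ha).1 (h i))

theorem exists_mul_inv_pow_mem_chartRing (K₀) [Field K₀] [Algebra (MvPolynomial σ k) K₀]
    [IsFractionRing (MvPolynomial σ k) K₀] [Algebra K₀ K] [IsScalarTower (MvPolynomial σ k) K₀ K]
    (hS : IsLinearNormalization k (σ := σ) S) (a : σ) {y : K} (hy : y ∈ Algebra.adjoin k S) :
    ∃ m, ∀ n ≥ m, y * (coordinate k K a ^ n)⁻¹ ∈ chartRing k S (coordinate k K a) := by
  have ha := coordinate_ne_zero k K₀ K a
  have hinv := inv_mem_chartRing (k := k) ha hS.one_mem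
  obtain ⟨m, hm⟩ := exists_pow_mul_mem_of_adjoin (G := S)
    (C := chartRing k S (coordinate k K a)) (fun c => algebraMap_mem_chartRing c)
    hinv (fun r hr => by rw [← div_eq_mul_inv]; exact div_mem_chartRing ha hr) hy
  refine ⟨m, fun n hn => ?_⟩
  obtain ⟨d, rfl⟩ := Nat.exists_eq_add_of_le hn
  rw [← inv_pow, pow_add, ← mul_assoc]
  exact mul_mem hm (pow_mem hinv _)

variable (k) in
/-- The sequence `e` converges to the function `ε`, with values in `{0, 1}`, along the divisor
at infinity of the chart of `a`. -/
structure IsApproximation (S : Set K) (ε : ValuationSubring K → K) (a : σ) (e : ℕ → K) :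
    Prop where
  eq_zero_or_one : ∀ V, ε V = 0 ∨ ε V = 1
  mem : ∀ n, e n ∈ chartRing k S (coordinate k K a)
  close : ∀ n, ∀ V ∈ chart k S (coordinate k K a), coordinate k K a ^ n * (e n - ε V) ∈ V

theorem IsApproximation.one_sub {ε : ValuationSubring K → K} {e : ℕ → K}
    (he : IsApproximation k S ε a e) :
    IsApproximation k S (fun V => 1 - ε V) a fun n => 1 - e n where
  eq_zero_or_one V := by rcases he.eq_zero_or_one V with h | h <;> simp [h]
  mem n := sub_mem (one_mem _) (he.mem n)
  close n V hV := by
    convert neg_mem (he.close n V hV) using 1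
    ring

variable [IsScalarTower k (MvPolynomial σ k) K]

theorem mem_chart_of_degree_le (hS : IsLinearNormalization k (σ := σ) S)
    (hV : ∀ d : K₀, fracDegree (σ := σ) (k := k) K₀ d ≤ 1 → algebraMap K₀ K d ∈ V) (a : σ) :
    V ∈ chart k S (coordinate k K a) := by
  refine mem_chart_of_mem K₀ hS (fun c => ?_) ?_ fun i => ?_
  · rw [IsScalarTower.algebraMap_apply k (MvPolynomial σ k) K,
      IsScalarTower.algebraMap_apply (MvPolynomial σ k) K₀ K]
    refine hV _ ?_
    rw [fracDegree_algebraMap, ← WithZero.exp_zero, degreeValuation_le_exp_iff]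
    intro μ hμ
    rw [MvPolynomial.algebraMap_eq] at hμ
    classical
    rw [mem_support_iff, coeff_C] at hμ
    have : μ = 0 := by_contra fun h => hμ (if_neg (Ne.symm h))
    simp [this]
  · rw [← algebraMap_coordinate k K₀ K, ← map_inv₀]
    refine hV _ ?_
    rw [map_inv₀, fracDegree_X, ← WithZero.exp_neg, ← WithZero.exp_zero, WithZero.exp_le_exp]
    norm_num
  · rw [← algebraMap_coordinate k K₀ K, ← algebraMap_coordinate k K₀ K, ← map_div₀]
    refine hV _ ?_
    rw [map_div₀, fracDegree_X, fracDegree_X, div_self WithZero.exp_ne_zero]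

theorem mem_chart_of_polynomial_mem (K₀) [Field K₀] [Algebra (MvPolynomial σ k) K₀]
    [IsFractionRing (MvPolynomial σ k) K₀] [Algebra K₀ K] [IsScalarTower (MvPolynomial σ k) K₀ K]
    (hS : IsLinearNormalization k (σ := σ) S)
    (hV : ∀ p : MvPolynomial σ k, algebraMap _ K p ∈ V) (ha : (coordinate k K a)⁻¹ ∈ V) :
    V ∈ chart k S (coordinate k K a) :=
  mem_chart_of_mem K₀ hS (fun c => by
    rw [IsScalarTower.algebraMap_apply k (MvPolynomial σ k) K]; exact hV _) ha
    fun i => by rw [div_eq_mul_inv]; exact mul_mem (hV _) ha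

variable [FiniteDimensional K₀ K]

theorem fracDegree_trace_le (hS : IsLinearNormalization k (σ := σ) S) {f : K} (a : σ) (m n : ℕ)
    (h : ∀ V : ValuationSubring K, (∀ i : σ, V ∈ chart k S (coordinate k K i)) →
      coordinate k K a ^ n * f * (coordinate k K a ^ m)⁻¹ ∈ V) :
    fracDegree (σ := σ) (k := k) K₀ (Algebra.trace K₀ K f) ≤ WithZero.exp ((m : ℤ) - n) := by
  set v := fracDegree (σ := σ) (k := k) K₀ with hv
  set x : K₀ := algebraMap _ K₀ (X a : MvPolynomial σ k) with hx
  have h1 : Algebra.trace K₀ K ((x ^ n * (x ^ m)⁻¹) • f) ∈ v.valuationSubring := by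
    refine trace_mem_of_forall_mem fun V hV => ?_
    have := h V (mem_chart_of_degree_le (K₀ := K₀) hS hV)
    rw [← algebraMap_coordinate k K₀ K a] at this
    rw [Algebra.smul_def, map_mul, map_inv₀, map_pow, map_pow]
    convert this using 1
    ring
  rw [Valuation.mem_valuationSubring_iff, map_smul, smul_eq_mul, map_mul, map_mul, map_inv₀, map_pow,
    map_pow, hx, hv,
    fracDegree_X, ← hv, ← WithZero.exp_nsmul, ← WithZero.exp_nsmul, ← WithZero.exp_neg,
    ← WithZero.exp_add] at h1
  calc v (Algebra.trace K₀ K f) = WithZero.exp ((m : ℤ) - n) *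
        (WithZero.exp ((n • (1 : ℤ)) + -(m • 1)) * v (Algebra.trace K₀ K f)) := by
        have : ((m : ℤ) - n) + (n • (1 : ℤ) + -(m • 1)) = 0 := by simp; ring
        rw [← mul_assoc, ← WithZero.exp_add, this, WithZero.exp_zero, one_mul]
    _ ≤ WithZero.exp ((m : ℤ) - n) * 1 := by gcongr
    _ = _ := mul_one _

end Charts

section TraceFunctional

open MvPolynomial Filter
open scoped WithZero

variable {σ k K₀ K : Type*} [Field k] [Field K₀] [Field K] [Algebra (MvPolynomial σ k) K₀]
  [IsFractionRing (MvPolynomial σ k) K₀] [Algebra k K] [Algebra (MvPolynomial σ k) K]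
  [Algebra K₀ K] [IsScalarTower (MvPolynomial σ k) K₀ K] {S : Set K}
  {a b : σ} {ε : ValuationSubring K → K} {e e' : ℕ → K}

theorem inv_coordinate_mem (K₀) [Field K₀] [Algebra (MvPolynomial σ k) K₀]
    [IsFractionRing (MvPolynomial σ k) K₀] [Algebra K₀ K] [IsScalarTower (MvPolynomial σ k) K₀ K]
    (hS : IsLinearNormalization k (σ := σ) S) {V : ValuationSubring K}
    (hV : V ∈ chart k S (coordinate k K a)) : (coordinate k K a)⁻¹ ∈ V :=
  mem_chartRing.1 (inv_mem_chartRing (coordinate_ne_zero k K₀ K a) hS.one_mem) V hV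

theorem IsApproximation.mul_mem_of_le (he : IsApproximation k S ε a e) (K₀) [Field K₀]
    [Algebra (MvPolynomial σ k) K₀]
    [IsFractionRing (MvPolynomial σ k) K₀] [Algebra K₀ K] [IsScalarTower (MvPolynomial σ k) K₀ K]
    (hS : IsLinearNormalization k (σ := σ) S) {V : ValuationSubring K}
    (hV : V ∈ chart k S (coordinate k K a)) {n n' : ℕ} (hn : n ≤ n') :
    coordinate k K a ^ n * (e n' - ε V) ∈ V := by
  have ha := coordinate_ne_zero k K₀ K a
  obtain ⟨d, rfl⟩ := Nat.exists_eq_add_of_le hn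
  convert mul_mem (he.close (n + d) V hV) (pow_mem (inv_coordinate_mem K₀ hS hV) d) using 1
  rw [pow_add, inv_pow]
  field_simp

variable [IsScalarTower k (MvPolynomial σ k) K] [FiniteDimensional K₀ K]

theorem exists_numerators (he : ∀ n, e n ∈ chartRing k S (coordinate k K a))
    (hS : IsLinearNormalization k (σ := σ) S) {y : K}
    (hy : y ∈ Algebra.adjoin k S) (n : ℕ) :
    ∃ (l : ℕ) (p : MvPolynomial σ k), Algebra.trace K₀ K (e n * y) *
      algebraMap _ K₀ (X a : MvPolynomial σ k) ^ l = algebraMap _ K₀ p := by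
  refine (exists_numerator_trace_and_norm fun V hV hVa => ?_).1
  have hVc := mem_chart_of_polynomial_mem K₀ hS hV hVa
  refine mul_mem (mem_chartRing.1 (he n) V hVc) ?_
  obtain ⟨m, hm⟩ := exists_mul_inv_pow_mem_chartRing K₀ hS a hy
  convert mul_mem (mem_chartRing.1 (hm m le_rfl) V hVc) (pow_mem (hV (X a)) m) using 1
  have ha := coordinate_ne_zero k K₀ K a
  change _ = _ * coordinate k K a ^ m
  field_simp

theorem exists_limit_of_mem_adjoin (hS : IsLinearNormalization k (σ := σ) S) (hab : a ≠ b)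
    (he : IsApproximation k S ε a e) (he' : IsApproximation k S ε b e') {y : K}
    (hy : y ∈ Algebra.adjoin k S) :
    ∃ β : K₀,
      (fun n => Algebra.trace K₀ K (e n * y) - β) ∈
        nullSequences (fracDegree (σ := σ) (k := k) K₀) ∧
      (fun n => Algebra.trace K₀ K (e' n * y) - β) ∈
        nullSequences (fracDegree (σ := σ) (k := k) K₀) := by
  set v := fracDegree (σ := σ) (k := k) K₀ with hv
  have ha := coordinate_ne_zero k K₀ K a
  have hb := coordinate_ne_zero k K₀ K b
  obtain ⟨m, hm⟩ := exists_mul_inv_pow_mem_chartRing K₀ hS a hy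
  have hcauchy : ∀ n n', n ≤ n' →
      v (Algebra.trace K₀ K (e n * y) - Algebra.trace K₀ K (e n' * y)) ≤
        WithZero.exp ((m : ℤ) - n) := by
    intro n n' hn
    rw [← map_sub]
    refine fracDegree_trace_le hS a m n fun V hV => ?_
    convert mul_mem (sub_mem (he.mul_mem_of_le K₀ hS (hV a) le_rfl)
      (he.mul_mem_of_le K₀ hS (hV a) hn)) (mem_chartRing.1 (hm m le_rfl) V (hV a)) using 1
    ring
  have hdiff : ∀ n, v (Algebra.trace K₀ K (e n * y) - Algebra.trace K₀ K (e' n * y)) ≤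
        WithZero.exp ((m : ℤ) - n) := by
    intro n
    rw [← map_sub]
    refine fracDegree_trace_le hS a m n fun V hV => ?_
    have h1 : coordinate k K a / coordinate k K b ∈ V :=
      (div_mem_iff hb).2 (hS.coordinate_le b V (hV b) a)
    convert mul_mem (sub_mem (he.close n V (hV a)) (mul_mem (he'.close n V (hV b))
      (pow_mem h1 n))) (mem_chartRing.1 (hm m le_rfl) V (hV a)) using 1
    have h2 : coordinate k K a ^ n =
        coordinate k K b ^ n * (coordinate k K a / coordinate k K b) ^ n := by
      rw [div_pow]; field_simp
    linear_combination (ε V - e' n) * y * (coordinate k K a ^ m)⁻¹ * h2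
  have hβ : ∀ n, ∃ β : MvPolynomial σ k,
      v (Algebra.trace K₀ K (e n * y) - algebraMap _ K₀ β) ≤ WithZero.exp ((m : ℤ) - n) := by
    intro n
    obtain ⟨l, p, h1⟩ := exists_numerators (K₀ := K₀) he.mem hS hy n
    obtain ⟨l', p', h2⟩ := exists_numerators (K₀ := K₀) he'.mem hS hy n
    exact exists_polynomial_near hab h1 h2 (hdiff n)
  choose β hβ using hβ
  have hconst : ∀ n ≥ m + 1, β n = β (m + 1) := by
    intro n hn
    rw [← sub_eq_zero]
    refine eq_zero_of_fracDegree_lt_one (K₀ := K₀) ?_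
    have h1 : v ((Algebra.trace K₀ K (e (m + 1) * y) - algebraMap _ K₀ (β (m + 1))) -
        (Algebra.trace K₀ K (e n * y) - algebraMap _ K₀ (β n)) -
        (Algebra.trace K₀ K (e (m + 1) * y) - Algebra.trace K₀ K (e n * y))) ≤
        WithZero.exp (-1) := by
      have h2 : ∀ N ≥ m + 1, WithZero.exp ((m : ℤ) - N) ≤ WithZero.exp (-1) := fun N hN => by
        rw [WithZero.exp_le_exp]; omega
      exact v.map_sub_le (v.map_sub_le ((hβ _).trans (h2 _ le_rfl)) ((hβ n).trans (h2 n hn)))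
        ((hcauchy _ _ hn).trans (h2 _ le_rfl))
    refine lt_of_le_of_lt ?_ (lt_of_le_of_lt h1 (b := WithZero.exp (-1)) ?_)
    · rw [map_sub]
      refine le_of_eq (congrArg _ ?_)
      ring
    · rw [← WithZero.exp_zero, WithZero.exp_lt_exp]
      norm_num
  have hlim : (fun n => Algebra.trace K₀ K (e n * y) - algebraMap _ K₀ (β (m + 1))) ∈
      nullSequences v := by
    intro N
    filter_upwards [mem_nullSequences_of_le (v := v) (m : ℤ) hβ N, eventually_ge_atTop (m + 1)]
      with n h1 h2
    rwa [hconst n h2] at h1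
  refine ⟨algebraMap _ K₀ (β (m + 1)), hlim, ?_⟩
  convert sub_mem hlim (mem_nullSequences_of_le (v := v) (m : ℤ) hdiff) using 1
  ext n
  simp

theorem exists_trace_representation [Algebra.IsSeparable K₀ K]
    (hS : IsLinearNormalization k (σ := σ) S) (hab : a ≠ b)
    (hspan : Submodule.span K₀ (Algebra.adjoin k S : Set K) = ⊤)
    (he : IsApproximation k S ε a e) (he' : IsApproximation k S ε b e') :
    ∃ f : K, ∀ y,
      (fun n => Algebra.trace K₀ K (e n * y) - Algebra.trace K₀ K (f * y)) ∈
        nullSequences (fracDegree (σ := σ) (k := k) K₀) ∧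
      (fun n => Algebra.trace K₀ K (e' n * y) - Algebra.trace K₀ K (f * y)) ∈
        nullSequences (fracDegree (σ := σ) (k := k) K₀) := by
  set v := fracDegree (σ := σ) (k := k) K₀ with hv
  have hlim : ∀ y : K, ∃ β : K₀,
      (fun n => Algebra.trace K₀ K (e n * y) - β) ∈ nullSequences v ∧
      (fun n => Algebra.trace K₀ K (e' n * y) - β) ∈ nullSequences v := by
    intro y
    have hy : y ∈ Submodule.span K₀ (Algebra.adjoin k S : Set K) := hspan ▸ Submodule.mem_top
    induction hy using Submodule.span_induction with
    | mem y hy => exact exists_limit_of_mem_adjoin hS hab he he' hy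
    | zero =>
      have h0 : (fun _ => 0 : ℕ → K₀) ∈ nullSequences v := zero_mem _
      exact ⟨0, by simpa using h0, by simpa using h0⟩
    | add y z _ _ hy hz =>
      obtain ⟨β, h1, h2⟩ := hy
      obtain ⟨γ, h3, h4⟩ := hz
      refine ⟨β + γ, ?_, ?_⟩
      · convert add_mem h1 h3 using 1
        ext n; simp only [mul_add, map_add, Pi.add_apply]; ring
      · convert add_mem h2 h4 using 1
        ext n; simp only [mul_add, map_add, Pi.add_apply]; ring
    | smul c y _ hy =>
      obtain ⟨β, h1, h2⟩ := hy
      refine ⟨c * β, ?_, ?_⟩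
      · convert Submodule.smul_mem _ c h1 using 1
        ext n; simp only [mul_smul_comm, map_smul, Pi.smul_apply, smul_eq_mul]; ring
      · convert Submodule.smul_mem _ c h2 using 1
        ext n; simp only [mul_smul_comm, map_smul, Pi.smul_apply, smul_eq_mul]; ring
  choose β hβ hβ' using hlim
  have huniq : ∀ y c, (fun n => Algebra.trace K₀ K (e n * y) - c) ∈ nullSequences v →
      β y = c := by
    intro y c hc
    rw [← sub_eq_zero]
    refine eq_zero_of_const_mem_nullSequences (v := v) ?_
    convert sub_mem hc (hβ y) using 1
    ext n; simp
  let φ : K →ₗ[K₀] K₀ :=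
    { toFun := β
      map_add' := fun y z => huniq _ _ (by
        convert add_mem (hβ y) (hβ z) using 1
        ext n; simp only [mul_add, map_add, Pi.add_apply]; ring)
      map_smul' := fun c y => huniq _ _ (by
        convert Submodule.smul_mem _ c (hβ y) using 1
        ext n; simp only [mul_smul_comm, map_smul, Pi.smul_apply, smul_eq_mul,
          RingHom.id_apply]; ring) }
  have hnd := traceForm_nondegenerate K₀ K
  refine ⟨(LinearMap.BilinForm.toDual _ hnd).symm φ, fun y => ?_⟩
  have h1 : Algebra.trace K₀ K ((LinearMap.BilinForm.toDual _ hnd).symm φ * y) = β y := by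
    rw [← Algebra.traceForm_apply, LinearMap.BilinForm.apply_toDual_symm_apply]
    rfl
  rw [h1]
  exact ⟨hβ y, hβ' y⟩

end TraceFunctional

section Idempotent

open MvPolynomial Filter
open scoped WithZero

variable {σ k K₀ K : Type*} [Field k] [Field K₀] [Field K] [Algebra (MvPolynomial σ k) K₀]
  [IsFractionRing (MvPolynomial σ k) K₀] [Algebra k K] [Algebra (MvPolynomial σ k) K]
  [Algebra K₀ K] [IsScalarTower (MvPolynomial σ k) K₀ K] [IsScalarTower k (MvPolynomial σ k) K]
  [FiniteDimensional K₀ K] {S : Set K}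
  {a b : σ} {ε : ValuationSubring K → K} {e e' : ℕ → K}

theorem eq_of_forall_trace_eq [Algebra.IsSeparable K₀ K] {Y : Set K}
    (hY : Submodule.span K₀ Y = ⊤) {f g : K}
    (h : ∀ y ∈ Y, Algebra.trace K₀ K (f * y) = Algebra.trace K₀ K (g * y)) : f = g := by
  have h1 : Algebra.traceForm K₀ K f = Algebra.traceForm K₀ K g :=
    LinearMap.ext_on hY fun y hy => by simpa using h y hy
  exact (LinearMap.BilinForm.toDual _ (traceForm_nondegenerate K₀ K)).injective h1

theorem isIdempotentElem_of_trace_representation [Algebra.IsSeparable K₀ K]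
    (hS : IsLinearNormalization k (σ := σ) S)
    (hspan : Submodule.span K₀ (Algebra.adjoin k S : Set K) = ⊤)
    (he : IsApproximation k S ε a e) {f : K}
    (hf : ∀ y, (fun n => Algebra.trace K₀ K (e n * y) - Algebra.trace K₀ K (f * y)) ∈
        nullSequences (fracDegree (σ := σ) (k := k) K₀)) : f * f = f := by
  set v := fracDegree (σ := σ) (k := k) K₀ with hv
  refine eq_of_forall_trace_eq hspan fun y hy => ?_
  obtain ⟨m, hm⟩ := exists_mul_inv_pow_mem_chartRing K₀ hS a hy
  have h1 : ∀ n n', n ≤ n' →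
      v (Algebra.trace K₀ K (e n' * (e n * y)) - Algebra.trace K₀ K (e n * y)) ≤
        WithZero.exp ((m : ℤ) - n) := by
    intro n n' hn
    rw [← map_sub]
    refine fracDegree_trace_le hS a m n fun V hV => ?_
    have hε : ε V ∈ V := by
      rcases he.eq_zero_or_one V with h | h <;> simp [h]
    have hε' : (1 - ε V) * ε V = 0 := by
      rcases he.eq_zero_or_one V with h | h <;> simp [h]
    convert mul_mem (sub_mem (mul_mem (he.mul_mem_of_le K₀ hS (hV a) hn)
      (mem_chartRing.1 (he.mem n) V (hV a))) (mul_mem (sub_mem (one_mem V) hε)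
        (he.close n V (hV a)))) (mem_chartRing.1 (hm m le_rfl) V (hV a)) using 1
    linear_combination (-coordinate k K a ^ n * y * (coordinate k K a ^ m)⁻¹) * hε'
  have h2 : ∀ n, v (Algebra.trace K₀ K (f * (e n * y)) - Algebra.trace K₀ K (e n * y)) ≤
      WithZero.exp ((m : ℤ) - n) := by
    intro n
    obtain ⟨n', h3, h4⟩ := ((hf (e n * y) ((m : ℤ) - n)).and (eventually_ge_atTop n)).exists
    convert v.map_sub_le (h1 n n' h4) h3 using 2
    ring
  rw [← sub_eq_zero]
  refine eq_zero_of_const_mem_nullSequences (v := v) ?_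
  convert add_mem (sub_mem (mem_nullSequences_of_le (m : ℤ) h2) (hf (f * y))) (hf y) using 1
  ext n
  simp only [Pi.sub_apply, Pi.add_apply]
  rw [show f * (e n * y) = e n * (f * y) by ring, ← mul_assoc f f y]
  ring

theorem false_of_trace_null [Algebra.IsSeparable K₀ K]
    (hS : IsLinearNormalization k (σ := σ) S) (he : IsApproximation k S ε a e)
    (hnull : ∀ y, (fun n => Algebra.trace K₀ K (e n * y)) ∈
        nullSequences (fracDegree (σ := σ) (k := k) K₀)) {V : ValuationSubring K}
    (hV : V ∈ chart k S (coordinate k K a)) (ha : coordinate k K a ∉ V) (hεV : ε V = 1) :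
    False := by
  classical
  set v := fracDegree (σ := σ) (k := k) K₀ with hv
  have hx := coordinate_ne_zero k K₀ K a
  let B := Module.finBasis K₀ K
  have hrepr : ∀ i, ∃ g : K, ∀ y, B.repr y i = Algebra.trace K₀ K (g * y) := by
    intro i
    refine ⟨(LinearMap.BilinForm.toDual _ (traceForm_nondegenerate K₀ K)).symm (B.coord i),
      fun y => ?_⟩
    rw [← Algebra.traceForm_apply, LinearMap.BilinForm.apply_toDual_symm_apply]
    rfl
  choose g hg using hrepr
  have hM : ∀ᶠ n in atTop, ∀ i j, v (Algebra.leftMulMatrix B (e n) i j) < 1 := by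
    rw [eventually_all]; intro i
    rw [eventually_all]; intro j
    filter_upwards [hnull (g i * B j) (-1)] with n hn
    rw [Algebra.leftMulMatrix_eq_repr_mul, hg,
      show g i * (e n * B j) = e n * (g i * B j) by ring]
    refine lt_of_le_of_lt hn ?_
    rw [← WithZero.exp_zero, WithZero.exp_lt_exp]
    norm_num
  obtain ⟨n, hM, hn⟩ := (hM.and (eventually_ge_atTop 1)).exists
  have hN : v (Algebra.norm K₀ (1 - e n) - 1) < 1 := by
    rw [Algebra.norm_eq_matrix_det B, map_sub (Algebra.leftMulMatrix B), map_one]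
    exact valuation_det_one_sub v _ hM
  have hw : V.valuation (1 - e n) < 1 := by
    have h1 := (V.valuation_le_one_iff _).2 (he.close n V hV)
    rw [hεV, map_mul, ← neg_sub, Valuation.map_neg, map_pow] at h1
    by_contra! h2
    exact absurd h1 (not_le.2 (one_lt_mul_of_lt_of_le
      (one_lt_pow₀ (one_lt_valuation_iff.2 ha) (by omega)) h2))
  have h2 : V.valuation (algebraMap K₀ K (Algebra.norm K₀ (1 - e n))) < 1 := by
    refine norm_mem_nonunits (fun V' hV' => ?_) hw
    refine sub_mem (one_mem _) (mem_chartRing.1 (he.mem n) V' (mem_chart_of_mem K₀ hS ?_ ?_ ?_))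
    · intro c
      rw [IsScalarTower.algebraMap_apply k (MvPolynomial σ k) K,
        IsScalarTower.algebraMap_apply (MvPolynomial σ k) K₀ K]
      refine hV' _ ?_
      rw [← IsScalarTower.algebraMap_apply (MvPolynomial σ k) K₀ K,
        ← IsScalarTower.algebraMap_apply k (MvPolynomial σ k) K]
      exact hV.1 c
    · have h3 := inv_coordinate_mem K₀ hS hV
      rw [← algebraMap_coordinate k K₀ K, ← map_inv₀] at h3 ⊢
      exact hV' _ h3
    · intro i
      have h3 := (div_mem_iff hx).2 (hS.coordinate_le a V hV i)
      rw [← algebraMap_coordinate k K₀ K, ← algebraMap_coordinate k K₀ K, ← map_div₀] at h3 ⊢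
      exact hV' _ h3
  obtain ⟨l, p, hp⟩ := (exists_numerator_trace_and_norm (K₀ := K₀) (σ := σ) (k := k) (a := a)
    (f := 1 - e n) fun W hW hWa => sub_mem (one_mem _) (mem_chartRing.1 (he.mem n) W
      (mem_chart_of_polynomial_mem K₀ hS hW hWa))).2
  have h3 : V.valuation (algebraMap K₀ K (Algebra.norm K₀ (1 - e n) - 1)) < 1 := by
    refine mem_nonunits_of_fracDegree_lt_one hV.1 ha (hS.coordinate_le a V hV)
      (l := l) (p := p - X a ^ l) ?_ hN
    rw [sub_mul, hp, one_mul, map_sub, map_pow]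
  have h4 := V.valuation.map_sub_lt h2 h3
  rw [map_sub (algebraMap K₀ K), map_one, sub_sub_cancel, map_one] at h4
  exact lt_irrefl _ h4

theorem forall_eq_zero_or_forall_eq_one [Algebra.IsSeparable K₀ K]
    (hS : IsLinearNormalization k (σ := σ) S) (hab : a ≠ b)
    (hspan : Submodule.span K₀ (Algebra.adjoin k S : Set K) = ⊤)
    (he : IsApproximation k S ε a e) (he' : IsApproximation k S ε b e') :
    (∀ c, c = a ∨ c = b → ∀ V ∈ chart k S (coordinate k K c), coordinate k K c ∉ V → ε V = 0) ∨
    ∀ c, c = a ∨ c = b → ∀ V ∈ chart k S (coordinate k K c), coordinate k K c ∉ V → ε V = 1 := by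
  obtain ⟨f, hf⟩ := exists_trace_representation hS hab hspan he he'
  have hff : f * (f - 1) = 0 := by
    rw [mul_sub, mul_one, sub_eq_zero]
    exact isIdempotentElem_of_trace_representation hS hspan he fun y => (hf y).1
  rcases mul_eq_zero.1 hff with h0 | h0
  · left
    subst h0
    simp only [zero_mul, map_zero, sub_zero] at hf
    rintro c (rfl | rfl) V hV hc
    · exact (he.eq_zero_or_one V).resolve_right fun h =>
        false_of_trace_null hS he (fun y => (hf y).1) hV hc h
    · exact (he.eq_zero_or_one V).resolve_right fun h =>
        false_of_trace_null hS he' (fun y => (hf y).2) hV hc h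
  · right
    obtain rfl := sub_eq_zero.1 h0
    have hf' : ∀ y,
        (fun n => Algebra.trace K₀ K ((1 - e n) * y)) ∈
          nullSequences (fracDegree (σ := σ) (k := k) K₀) ∧
        (fun n => Algebra.trace K₀ K ((1 - e' n) * y)) ∈
          nullSequences (fracDegree (σ := σ) (k := k) K₀) := fun y => by
      constructor
      · convert neg_mem (hf y).1 using 1
        ext n; simp [sub_mul]
      · convert neg_mem (hf y).2 using 1
        ext n; simp [sub_mul]
    rintro c (rfl | rfl) V hV hc
    · exact (he.eq_zero_or_one V).resolve_left fun h =>
        false_of_trace_null hS he.one_sub (fun y => (hf' y).1) hV hc (by simp [h])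
    · exact (he.eq_zero_or_one V).resolve_left fun h =>
        false_of_trace_null hS he'.one_sub (fun y => (hf' y).2) hV hc (by simp [h])

end Idempotent

section Main

open MvPolynomial

variable {k K : Type*} [Field k] [Field K] [Algebra k K]

theorem finite_and_span_adjoin_eq_top {K₀ : Type*} [Field K₀] [Algebra K₀ K] {S : Set K}
    (hSfin : S.Finite) (hS : ∀ s ∈ S, IsIntegral K₀ s)
    (hk : ∀ c : k, ∃ d : K₀, algebraMap k K c = algebraMap K₀ K d)
    (hfrac : ∀ f : K, ∃ a ∈ Algebra.adjoin k S, ∃ b ∈ Algebra.adjoin k S, f = a / b) :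
    FiniteDimensional K₀ K ∧ Submodule.span K₀ (Algebra.adjoin k S : Set K) = ⊤ := by
  have hle : ∀ a ∈ Algebra.adjoin k S, a ∈ Algebra.adjoin K₀ S := by
    intro a ha
    induction ha using Algebra.adjoin_induction with
    | mem x hx => exact Algebra.subset_adjoin hx
    | algebraMap r =>
      obtain ⟨d, hd⟩ := hk r
      rw [hd]
      exact Subalgebra.algebraMap_mem _ d
    | add x y _ _ hx hy => exact add_mem hx hy
    | mul x y _ _ hx hy => exact mul_mem hx hy
  have hfin := Algebra.finite_adjoin_of_finite_of_isIntegral hSfin hS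
  have htop : Algebra.adjoin K₀ S = ⊤ := by
    rw [eq_top_iff]
    intro f _
    obtain ⟨a, ha, b, hb, rfl⟩ := hfrac f
    have hbint : IsIntegral K₀ (⟨b, hle b hb⟩ : Algebra.adjoin K₀ S) := IsIntegral.of_finite K₀ _
    rw [div_eq_mul_inv]
    exact mul_mem (hle a ha)
      ((hbint.map (Algebra.adjoin K₀ S).val).inv_mem (hle b hb))
  refine ⟨?_, ?_⟩
  · rw [htop] at hfin
    exact Module.Finite.equiv (Subalgebra.topEquiv (R := K₀) (A := K)).toLinearEquiv
  · rw [eq_top_iff, ← Algebra.top_toSubmodule, ← htop, Algebra.adjoin_eq_span]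
    refine Submodule.span_mono ?_
    exact (Submonoid.closure_le (S := (Algebra.adjoin k S).toSubmonoid)).2 Algebra.subset_adjoin

theorem valuation_le_of_mem_span {V : ValuationSubring K} (hV : IsOver k V) {S : Set K}
    {γ : V.ValueGroup} (hγ : ∀ s ∈ S, V.valuation s ≤ γ) {y : K} (hy : y ∈ Submodule.span k S) :
    V.valuation y ≤ γ := by
  induction hy using Submodule.span_induction with
  | mem y hy => exact hγ y hy
  | zero => simp
  | add y z _ _ hy hz => exact V.valuation.map_add_le hy hz
  | smul c y _ hy =>
    rw [Algebra.smul_def, map_mul]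
    exact mul_le_of_le_one_of_le ((V.valuation_le_one_iff _).2 (hV c)) hy

theorem forall_of_exists_of_not_subset [CharZero k] {A : Subalgebra k K} {T : Set K}
    (hT : T.Finite) (hA : Algebra.adjoin k T = A)
    (hdim : ∀ x ∈ A, ∃ a ∈ A, ¬ IsIntegral (Algebra.adjoin k {x}) a)
    (hfrac : ∀ f : K, ∃ a ∈ A, ∃ b ∈ A, f = a / b)
    {J : Type*} {R : J → Subalgebra k K} {G : J → Set K}
    (hG : ∀ j, (G j).Finite) (hR : ∀ j, Algebra.adjoin k (G j) = R j)
    (H1 : ∀ V : ValuationSubring K, IsOver k V → ∃ j, ∀ r ∈ R j, r ∈ V)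
    (H2 : ∀ V : ValuationSubring K, IsOver k V → (∀ a ∈ A, a ∈ V) → ∀ j, (∀ r ∈ R j, r ∈ V) →
      ∃ g ∈ A, V.valuation g = 1 ∧ ∀ r ∈ R j, ∃ n : ℕ, r * g ^ n ∈ A)
    {P₁ P₂ : ValuationSubring K → Prop} {I₁ I₂ : J → Set K}
    (hI₁ : ∀ j, I₁ j ⊆ R j) (hI₂ : ∀ j, I₂ j ⊆ R j)
    (hP₁ : ∀ V, IsOver k V → ∀ j, (∀ r ∈ R j, r ∈ V) → (P₁ V ↔ ∀ r ∈ I₁ j, V.valuation r < 1))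
    (hP₂ : ∀ V, IsOver k V → ∀ j, (∀ r ∈ R j, r ∈ V) → (P₂ V ↔ ∀ r ∈ I₂ j, V.valuation r < 1))
    (hP : ∀ V : ValuationSubring K, IsOver k V → (¬ ∀ a ∈ A, a ∈ V) → (P₁ V ↔ ¬ P₂ V))
    {V₁ : ValuationSubring K} (hV₁ : IsOver k V₁) (hAV₁ : ¬ ∀ a ∈ A, a ∈ V₁) (hPV₁ : P₁ V₁) :
    ∀ V : ValuationSubring K, IsOver k V → (¬ ∀ a ∈ A, a ∈ V) → P₁ V := by
  classical
  obtain ⟨S, hSfin, h1S, hSA, hgen⟩ := exists_generators k A T hT hA R G hG hR H1 H2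
  obtain ⟨m, x, hxspan, hxind, hxS⟩ := exists_linear_normalization k S hSfin
  have hxA : ∀ i, x i ∈ A := fun i => by
    rw [← hSA]
    exact (Submodule.span_le (p := Subalgebra.toSubmodule (Algebra.adjoin k S))).2
      Algebra.subset_adjoin (hxspan i)
  have hSV : ∀ V : ValuationSubring K, IsOver k V → (∀ i, x i ∈ V) → ∀ s ∈ S, s ∈ V := by
    intro V hV hx s hs
    rcases hxS V hV s hs with h | ⟨i, hi⟩
    · exact h
    · exact (V.valuation_le_one_iff _).1 (hi.trans ((V.valuation_le_one_iff _).2 (hx i)))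
  have hne : ∀ y ∈ A, ∃ i, x i ≠ y := by
    intro y hy
    by_contra! h
    obtain ⟨a, haA, ha⟩ := hdim y hy
    refine ha (isIntegral_of_forall_mem_valuationSubring fun V hV => ?_)
    have hVk : IsOver k V := fun c => hV (algebraMap k _ c)
    rw [← hSA] at haA
    refine (adjoin_le_iff_of_isOver k hVk).2 (hSV V hVk fun i => ?_) a haA
    rw [h i]
    exact hV ⟨y, Algebra.self_mem_adjoin_singleton k y⟩
  let B := MvPolynomial (Fin m) k
  let _ : Algebra B K := (aeval x).toAlgebra
  have hBX : ∀ i, coordinate k K i = x i := fun i => aeval_X x i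
  have : IsScalarTower k B K := IsScalarTower.of_algebraMap_eq fun c => (aeval_C x c).symm
  have : FaithfulSMul B K := (faithfulSMul_iff_algebraMap_injective B K).2 hxind
  let K₀ := FractionRing B
  let _ : Algebra K₀ K := FractionRing.liftAlgebra B K
  have : IsScalarTower B K₀ K := FractionRing.isScalarTower_liftAlgebra B K
  have : CharZero K₀ := charZero_of_injective_algebraMap (algebraMap k K₀).injective
  have hSint : ∀ s ∈ S, IsIntegral K₀ s := fun s hs => by
    have : IsIntegral B s := isIntegral_of_forall_mem_valuationSubring fun V hV => by
      refine hSV V (fun c => ?_) (fun i => ?_) s hs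
      · rw [IsScalarTower.algebraMap_apply k B K]
        exact hV _
      · rw [← hBX]
        exact hV _
    exact this.tower_top
  obtain ⟨hfin, hspan⟩ := finite_and_span_adjoin_eq_top (k := k) (K₀ := K₀) hSfin hSint
    (fun c => ⟨algebraMap B K₀ (C c), by
      rw [← IsScalarTower.algebraMap_apply B K₀ K]; exact IsScalarTower.algebraMap_apply k B K c⟩)
    (by rwa [hSA])
  have hS : IsLinearNormalization k (σ := Fin m) S :=
    { one_mem := h1S
      le_coordinate := fun V hV s hs => by simpa only [hBX] using hxS V hV s hs
      coordinate_le := fun a V hV i => by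
        rw [hBX i]
        exact valuation_le_of_mem_span hV.1 hV.2 (hxspan i) }
  obtain ⟨i₀, -⟩ := hne 0 (zero_mem A)
  have hchart : ∀ V : ValuationSubring K, IsOver k V → (¬ ∀ a ∈ A, a ∈ V) →
      ∃ a : Fin m, V ∈ chart k S (coordinate k K a) ∧ coordinate k K a ∉ V := by
    intro V hV hVA
    have : Nonempty (Fin m) := ⟨i₀⟩
    obtain ⟨a, ha⟩ := Finite.exists_max fun i => V.valuation (x i)
    have hxa : x a ∉ V := by
      intro h
      refine hVA ?_
      rw [← hSA]
      exact (adjoin_le_iff_of_isOver k hV).2 (hSV V hV fun i =>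
        (V.valuation_le_one_iff _).1 ((ha i).trans ((V.valuation_le_one_iff _).2 h)))
    refine ⟨a, ⟨hV, fun s hs => ?_⟩, by rwa [hBX]⟩
    rw [hBX]
    rcases hxS V hV s hs with h | ⟨i, hi⟩
    · exact ((V.valuation_le_one_iff _).2 h).trans (one_lt_valuation_iff.2 hxa).le
    · exact hi.trans (ha i)
  have hnot : ∀ a : Fin m, ∀ V : ValuationSubring K, coordinate k K a ∉ V →
      ¬ ∀ a ∈ A, a ∈ V := fun a V ha h => ha (by rw [hBX]; exact h _ (hxA a))
  let ε : ValuationSubring K → K := fun V => if P₁ V then 1 else 0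
  have happrox : ∀ a : Fin m, ∃ e, IsApproximation k S ε a e := by
    intro a
    have h := exists_approximate_idempotent (k := k) (coordinate_ne_zero k K₀ K a) h1S hR
      (fun V hV ha => by
        obtain ⟨c, hcS, j, hc, -, hj⟩ := hgen V hV.1 (hnot a V ha)
        refine ⟨c, hcS, j, ?_, hj⟩
        rw [hBX]
        exact valuation_le_of_mem_span hV.1 hc (hxspan a)) hI₁ hI₂ hP₁ hP₂
      fun V hV ha => hP V hV.1 (hnot a V ha)
    choose e he he' using h
    refine ⟨e, fun V => ?_, he, fun n V hV => ?_⟩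
    · by_cases h : P₁ V <;> simp [ε, h]
    · by_cases ha : coordinate k K a ∈ V
      · refine mul_mem (pow_mem ha n) (sub_mem (mem_chartRing.1 (he n) V hV) ?_)
        by_cases h : P₁ V <;> simp [ε, h]
      · by_cases h : P₁ V
        · convert neg_mem ((he' n V hV ha).1 h) using 1
          simp only [ε, if_pos h]
          ring
        · convert (he' n V hV ha).2 (by_contra fun h2 => h ((hP V hV.1 (hnot a V ha)).2 h2)) using 1
          simp only [ε, if_neg h]
          ring
  choose e he using happrox
  intro V hV hVA
  obtain ⟨a₁, ha₁, hna₁⟩ := hchart V₁ hV₁ hAV₁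
  obtain ⟨a₂, ha₂, hna₂⟩ := hchart V hV hVA
  obtain ⟨b, hab, hb⟩ : ∃ b, a₁ ≠ b ∧ (a₂ = a₁ ∨ a₂ = b) := by
    by_cases h : a₁ = a₂
    · obtain ⟨b, hb⟩ := hne (x a₁) (hxA a₁)
      exact ⟨b, fun h' => hb (by rw [h']), Or.inl h.symm⟩
    · exact ⟨a₂, h, Or.inr rfl⟩
  rcases forall_eq_zero_or_forall_eq_one (K₀ := K₀) hS hab hspan (he a₁) (he b) with h | h
  · have := h a₁ (Or.inl rfl) V₁ ha₁ hna₁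
    simp [ε, hPV₁] at this
  · have := h a₂ hb V ha₂ hna₂
    by_contra hPV
    simp [ε, hPV] at this

end Main

section Center

open AlgebraicGeometry CategoryTheory TopologicalSpace

universe u

variable {X : Scheme.{u}} [IsIntegral X]

/-- A valuation subring of the function field dominates the local ring at a point. -/
def Dominates (V : ValuationSubring X.functionField) (x : X) : Prop :=
  ∀ s : X.presheaf.stalk x, algebraMap _ X.functionField s ∈ V ∧
    (V.valuation (algebraMap (X.presheaf.stalk x) X.functionField s) < 1 ↔ ¬ IsUnit s)

theorem dominates_of_isLocalHom {V : ValuationSubring X.functionField} {x : X}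
    (φ : X.presheaf.stalk x →+* V) [IsLocalHom φ]
    (hφ : ∀ s, (φ s : X.functionField) = algebraMap _ X.functionField s) : Dominates V x := by
  intro s
  rw [← hφ s]
  refine ⟨(φ s).2, ?_⟩
  rw [← V.valuation_lt_one_iff, IsLocalRing.mem_maximalIdeal, mem_nonunits_iff, isUnit_map_iff]

theorem Dominates.exists_isLocalHom {V : ValuationSubring X.functionField} {x : X}
    (h : Dominates V x) : ∃ φ : X.presheaf.stalk x →+* V, IsLocalHom φ ∧
      ∀ s, (φ s : X.functionField) = algebraMap _ X.functionField s := by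
  refine ⟨(algebraMap _ X.functionField).codRestrict V.toSubring fun s => (h s).1, ⟨fun s hs => ?_⟩,
    fun s => rfl⟩
  by_contra hs'
  have h1 := (h s).2.mpr hs'
  exact (V.valuation_lt_one_iff
    ((algebraMap (X.presheaf.stalk x) X.functionField).codRestrict V.toSubring
      (fun s => (h s).1) s)).mpr h1 hs

theorem algebraMap_stalk_functionField (x : X) :
    CommRingCat.ofHom (algebraMap (X.presheaf.stalk x) X.functionField) =
      X.presheaf.stalkSpecializes ((genericPoint_spec X).specializes trivial) := rfl

theorem dominates_closedPoint {V : ValuationSubring X.functionField}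
    (l : Spec (.of V) ⟶ X)
    (hl : Spec.map (CommRingCat.ofHom (algebraMap V X.functionField)) ≫ l =
      X.fromSpecStalk (genericPoint X)) :
    Dominates V (l (IsLocalRing.closedPoint V)) := by
  refine dominates_of_isLocalHom (Scheme.stalkClosedPointTo l).hom fun s => ?_
  have h1 : Scheme.stalkClosedPointTo l ≫ CommRingCat.ofHom (algebraMap V X.functionField) =
      X.presheaf.stalkSpecializes ((genericPoint_spec X).specializes trivial) := by
    apply Spec.map_injective
    rw [← cancel_mono (X.fromSpecStalk _), Spec.map_comp, Category.assoc,
      Scheme.Spec_stalkClosedPointTo_fromSpecStalk, Scheme.SpecMap_stalkSpecializes_fromSpecStalk]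
    exact hl
  exact RingHom.congr_fun (congrArg CommRingCat.Hom.hom h1) s

theorem Dominates.exists_lift {V : ValuationSubring X.functionField} {x : X}
    (h : Dominates V x) : ∃ l : Spec (.of V) ⟶ X,
      Spec.map (CommRingCat.ofHom (algebraMap V X.functionField)) ≫ l =
      X.fromSpecStalk (genericPoint X) ∧ l (IsLocalRing.closedPoint V) = x := by
  obtain ⟨φ, hloc, hφ⟩ := h.exists_isLocalHom
  refine ⟨Spec.map (CommRingCat.ofHom φ) ≫ X.fromSpecStalk x, ?_, ?_⟩
  · rw [← Category.assoc, ← Spec.map_comp, ← Scheme.SpecMap_stalkSpecializes_fromSpecStalk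
      ((genericPoint_spec X).specializes (y := x) trivial)]
    congr 2
    rw [← algebraMap_stalk_functionField]
    ext s
    exact hφ s
  · refine (Scheme.Hom.comp_apply _ _ _).trans ?_
    exact (congrArg _ (IsLocalRing.comap_closedPoint φ)).trans Scheme.fromSpecStalk_closedPoint

variable {k : Type u} [Field k] {f : X ⟶ Spec (.of k)}

theorem exists_dominates [Algebra k X.functionField] [IsProper f]
    (hf : Spec.map (CommRingCat.ofHom (algebraMap k X.functionField)) =
      X.fromSpecStalk (genericPoint X) ≫ f)
    {V : ValuationSubring X.functionField} (hV : IsOver k V) : ∃ x, Dominates V x := by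
  have hval : ValuativeCriterion f := by
    have : IsProper f := inferInstance
    rw [IsProper.eq_valuativeCriterion] at this
    exact this.1.1.1
  let φ : k →+* V := (algebraMap k X.functionField).codRestrict V.toSubring hV
  let S : ValuativeCommSq f :=
    { R := V
      K := X.functionField
      i₁ := X.fromSpecStalk (genericPoint X)
      i₂ := Spec.map (CommRingCat.ofHom φ)
      commSq := ⟨by
        rw [← hf, ← Spec.map_comp]
        rfl⟩ }
  obtain ⟨⟨l⟩⟩ := hval.existence S
  exact ⟨_, dominates_closedPoint l.l l.fac_left⟩

theorem lift_unique [IsSeparated f] {V : ValuationSubring X.functionField}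
    {l₁ l₂ : Spec (.of V) ⟶ X}
    (h₁ : Spec.map (CommRingCat.ofHom (algebraMap V X.functionField)) ≫ l₁ =
      X.fromSpecStalk (genericPoint X))
    (h₂ : Spec.map (CommRingCat.ofHom (algebraMap V X.functionField)) ≫ l₂ =
      X.fromSpecStalk (genericPoint X)) : l₁ = l₂ := by
  have hcomp : l₂ ≫ f = l₁ ≫ f := by
    have : Mono (CommRingCat.ofHom (algebraMap V X.functionField)) :=
      ConcreteCategory.mono_of_injective _ Subtype.val_injective
    rw [← Spec.map_preimage (l₂ ≫ f), ← Spec.map_preimage (l₁ ≫ f)]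
    congr 1
    rw [← cancel_mono (CommRingCat.ofHom (algebraMap V X.functionField))]
    apply Spec.map_injective
    rw [Spec.map_comp, Spec.map_comp, Spec.map_preimage, Spec.map_preimage, ← Category.assoc, h₂,
      ← Category.assoc, h₁]
  let S : ValuativeCommSq f :=
    { R := V
      K := X.functionField
      i₁ := X.fromSpecStalk (genericPoint X)
      i₂ := l₁ ≫ f
      commSq := ⟨by rw [← Category.assoc]; exact congrArg (· ≫ f) h₁.symm⟩ }
  have := IsSeparated.valuativeCriterion f S
  exact congrArg CommSq.LiftStruct.l (Subsingleton.elim (α := S.commSq.LiftStruct)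
    ⟨l₁, h₁, rfl⟩ ⟨l₂, h₂, hcomp⟩)

theorem Dominates.unique [IsSeparated f] {V : ValuationSubring X.functionField} {x y : X}
    (hx : Dominates V x) (hy : Dominates V y) : x = y := by
  obtain ⟨l₁, h₁, rfl⟩ := hx.exists_lift
  obtain ⟨l₂, h₂, rfl⟩ := hy.exists_lift
  rw [lift_unique (f := f) h₁ h₂]

theorem exists_dominating_valuationSubring (x : X) :
    ∃ V : ValuationSubring X.functionField, Dominates V x := by
  obtain ⟨V, hV⟩ := (LocalSubring.range
    (algebraMap (X.presheaf.stalk x) X.functionField)).exists_le_valuationSubring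
  have hle := hV.1
  have hmem : ∀ s, algebraMap (X.presheaf.stalk x) X.functionField s ∈ V := fun s => hle ⟨s, rfl⟩
  refine ⟨V, @dominates_of_isLocalHom _ _ V x
    ((algebraMap _ X.functionField).codRestrict V.toSubring hmem) ⟨fun s hs => ?_⟩ fun s => rfl⟩
  obtain ⟨hle', hloc⟩ := hV
  have := hloc.map_nonunit ⟨algebraMap _ X.functionField s, ⟨s, rfl⟩⟩ hs
  obtain ⟨t, ht⟩ := this.exists_right_inv
  obtain ⟨_, t, rfl⟩ := t
  refine IsUnit.of_mul_eq_one t (IsFractionRing.injective _ X.functionField ?_)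
  rw [map_mul, map_one]
  exact congrArg Subtype.val ht

end Center

section Sections

open AlgebraicGeometry CategoryTheory TopologicalSpace

universe u

section Constants

variable {X : Scheme.{u}} {k : Type u} [Field k] {f : X ⟶ Spec (.of k)}

/-- The ring homomorphism from the base field to the sections over an open subset. -/
noncomputable def constants (f : X ⟶ Spec (.of k)) (W : X.Opens) :
    CommRingCat.of k ⟶ Γ(X, W) :=
  (Scheme.ΓSpecIso _).inv ≫ f.appLE ⊤ W le_top

theorem constants_finiteType [LocallyOfFiniteType f] {W : X.Opens} (hW : IsAffineOpen W) :
    (constants f W).hom.FiniteType := by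
  rw [constants, CommRingCat.hom_comp]
  exact (f.finiteType_appLE (isAffineOpen_top _) hW _).comp
    (.of_surjective _ (ConcreteCategory.bijective_of_isIso (Scheme.ΓSpecIso (.of k)).inv).2)

end Constants

variable {X : Scheme.{u}} [IsIntegral X] {k : Type u} [Field k] {f : X ⟶ Spec (.of k)}

theorem genericPoint_mem (W : X.Opens) [hW : Nonempty W] : genericPoint X ∈ W :=
  ((genericPoint_spec X).mem_open_set_iff W.isOpen).mpr
    (by simpa using Set.nonempty_coe_sort.mp hW)

theorem Dominates.germToFunctionField_mem {V : ValuationSubring X.functionField} {x : X}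
    (h : Dominates V x) {W : X.Opens} [Nonempty W] (hx : x ∈ W) (s : Γ(X, W)) :
    X.germToFunctionField W s ∈ V := by
  rw [← Scheme.algebraMap_germ_eq_germToFunctionField X hx]
  exact (h _).1

theorem Dominates.valuation_germToFunctionField_lt_one_iff
    {V : ValuationSubring X.functionField} {x : X}
    (h : Dominates V x) {W : X.Opens} [Nonempty W] (hx : x ∈ W) (s : Γ(X, W)) :
    V.valuation (X.germToFunctionField W s) < 1 ↔ x ∉ X.basicOpen s := by
  rw [← Scheme.algebraMap_germ_eq_germToFunctionField X hx, (h _).2, Scheme.mem_basicOpen X s x hx]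

theorem Dominates.valuation_germToFunctionField_eq_one
    {V : ValuationSubring X.functionField} {x : X}
    (h : Dominates V x) {W : X.Opens} [Nonempty W] (s : Γ(X, W)) (hx : x ∈ X.basicOpen s) :
    V.valuation (X.germToFunctionField W s) = 1 := by
  have hxW := X.basicOpen_le s hx
  refine le_antisymm ((V.valuation_le_one_iff _).mpr (h.germToFunctionField_mem hxW s)) ?_
  rw [← not_lt, h.valuation_germToFunctionField_lt_one_iff hxW]
  exact not_not.mpr hx

theorem Dominates.mem_iff_of_isClosed {V : ValuationSubring X.functionField} {x : X}
    (h : Dominates V x) {W : X.Opens} (hW : IsAffineOpen W) [Nonempty W] (hx : x ∈ W) {Z : Set X}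
    (hZ : IsClosed Z) :
    x ∈ Z ↔ ∀ r ∈ {r | ∃ s : Γ(X, W), (X.basicOpen s : Set X) ∩ Z = ∅ ∧
      X.germToFunctionField W s = r}, V.valuation r < 1 := by
  constructor
  · rintro hxZ _ ⟨s, hs, rfl⟩
    rw [h.valuation_germToFunctionField_lt_one_iff hx]
    intro hxs
    exact (Set.ext_iff.mp hs x).mp ⟨hxs, hxZ⟩
  · intro hr
    by_contra hxZ
    obtain ⟨s, hs, hxs⟩ := hW.exists_basicOpen_le (V := ⟨Zᶜ, hZ.isOpen_compl⟩) ⟨x, hxZ⟩ hx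
    refine (h.valuation_germToFunctionField_lt_one_iff hx s).mp (hr _ ⟨s, ?_, rfl⟩) hxs
    rw [← Set.disjoint_iff_inter_eq_empty, ← Set.subset_compl_iff_disjoint_right]
    exact hs

theorem exists_dominates_of_isAffineOpen {V : ValuationSubring X.functionField} {W : X.Opens}
    (hW : IsAffineOpen W) [Nonempty W] (h : ∀ s, X.germToFunctionField W s ∈ V) :
    ∃ x ∈ W, Dominates V x := by
  let φ : Γ(X, W) →+* V := (X.germToFunctionField W).hom.codRestrict V.toSubring h
  refine ⟨(Spec.map (CommRingCat.ofHom φ) ≫ hW.fromSpec) (IsLocalRing.closedPoint V), ?_,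
    dominates_closedPoint _ ?_⟩
  · change _ ∈ (W : Set X)
    rw [← hW.range_fromSpec]
    exact ⟨_, (Scheme.Hom.comp_apply _ _ _).symm⟩
  · rw [← Category.assoc, ← Spec.map_comp]
    exact hW.fromSpecStalk_eq_fromSpecStalk
      (genericPoint_mem W)

theorem constants_comp_germToFunctionField [Algebra k X.functionField]
    (hf : Spec.map (CommRingCat.ofHom (algebraMap k X.functionField)) =
      X.fromSpecStalk (genericPoint X) ≫ f) {W : X.Opens} (hW : IsAffineOpen W) [Nonempty W] :
    constants f W ≫ X.germToFunctionField W =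
      CommRingCat.ofHom (algebraMap k X.functionField) := by
  apply Spec.map_injective
  have hη : genericPoint X ∈ W := genericPoint_mem W
  rw [hf, ← hW.fromSpecStalk_eq_fromSpecStalk hη, IsAffineOpen.fromSpecStalk, Category.assoc,
    ← IsAffineOpen.SpecMap_appLE_fromSpec f (isAffineOpen_top _) hW le_top,
    IsAffineOpen.fromSpec_top, Scheme.isoSpec_Spec_inv, ← Spec.map_comp, ← Spec.map_comp]
  rfl

theorem Dominates.isOver [Algebra k X.functionField]
    (hf : Spec.map (CommRingCat.ofHom (algebraMap k X.functionField)) =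
      X.fromSpecStalk (genericPoint X) ≫ f)
    {V : ValuationSubring X.functionField} {x : X} (h : Dominates V x) : IsOver k V := by
  intro c
  obtain ⟨_, ⟨W, hW, rfl⟩, hxW, -⟩ := X.isBasis_affineOpens.exists_subset_of_mem_open
    (Set.mem_univ x) isOpen_univ
  have : Nonempty W := ⟨⟨x, hxW⟩⟩
  have h1 := constants_comp_germToFunctionField hf hW
  have h2 : algebraMap k X.functionField c = X.germToFunctionField W (constants f W c) :=
    (RingHom.congr_fun (congrArg CommRingCat.Hom.hom h1) c).symm
  rw [h2]
  exact h.germToFunctionField_mem hxW _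

theorem exists_finite_adjoin_eq [LocallyOfFiniteType f] [Algebra k X.functionField]
    (hf : Spec.map (CommRingCat.ofHom (algebraMap k X.functionField)) =
      X.fromSpecStalk (genericPoint X) ≫ f) {W : X.Opens} (hW : IsAffineOpen W) [Nonempty W] :
    ∃ T : Set X.functionField, T.Finite ∧
      ∀ r, r ∈ Algebra.adjoin k T ↔ ∃ s, X.germToFunctionField W s = r := by
  let _ : Algebra k Γ(X, W) := (constants f W).hom.toAlgebra
  have hft : Algebra.FiniteType k Γ(X, W) := constants_finiteType hW
  have h1 := constants_comp_germToFunctionField hf hW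
  let φ : Γ(X, W) →ₐ[k] X.functionField :=
    { (X.germToFunctionField W).hom with
      commutes' := fun c => RingHom.congr_fun (congrArg CommRingCat.Hom.hom h1) c }
  obtain ⟨T, hT⟩ := hft.out.map φ
  refine ⟨T, T.finite_toSet, fun r => ?_⟩
  rw [hT, Algebra.map_top]
  exact Iff.rfl

theorem exists_mul_pow_eq {U W : X.Opens} (hU : IsAffineOpen U) (hW : IsAffineOpen W)
    [Nonempty U] [Nonempty W] {x : X} (hxU : x ∈ U) (hxW : x ∈ W) :
    ∃ g : Γ(X, U), x ∈ X.basicOpen g ∧ ∀ r : Γ(X, W), ∃ (n : ℕ) (a : Γ(X, U)),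
      X.germToFunctionField W r * X.germToFunctionField U g ^ n = X.germToFunctionField U a := by
  obtain ⟨g, g', hgg', hxg⟩ := exists_basicOpen_le_affine_inter hU hW x ⟨hxU, hxW⟩
  refine ⟨g, hxg, fun r => ?_⟩
  have hle : X.basicOpen g ≤ W := hgg' ▸ X.basicOpen_le g'
  have hloc := hU.isLocalization_basicOpen g
  have : Nonempty (X.basicOpen g) := ⟨⟨x, hxg⟩⟩
  obtain ⟨⟨a, ⟨_, n, rfl⟩⟩, ha⟩ :=
    IsLocalization.surj (Submonoid.powers g) (X.presheaf.map (homOfLE hle).op r)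
  refine ⟨n, a, ?_⟩
  have h1 := congrArg (X.germToFunctionField (X.basicOpen g)) ha
  rw [map_mul] at h1
  have h2 : ∀ b : Γ(X, U), X.germToFunctionField (X.basicOpen g)
      (algebraMap Γ(X, U) Γ(X, X.basicOpen g) b) = X.germToFunctionField U b := fun b =>
    X.presheaf.germ_res_apply _ _ _ b
  rw [h2, h2, map_pow] at h1
  rw [← h1]
  congr 1
  exact (X.presheaf.germ_res_apply _ _ _ r).symm

theorem ringKrullDim_le_of_isIntegral {R S : Type*} [CommRing R] [CommRing S] [Algebra R S]
    [Algebra.IsIntegral R S] : ringKrullDim S ≤ ringKrullDim R :=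
  Order.krullDim_le_of_strictMono (PrimeSpectrum.comap (algebraMap R S)) fun _ _ h =>
    Ideal.IsIntegral.comap_lt_comap h

theorem ringKrullDim_le_one_of_isIntegral_adjoin {k K : Type*} [Field k] [Field K] [Algebra k K]
    {A : Subalgebra k K} {x : K} (hx : x ∈ A)
    (h : ∀ a ∈ A, _root_.IsIntegral (Algebra.adjoin k {x}) a) : ringKrullDim A ≤ 1 := by
  have hle : Algebra.adjoin k {x} ≤ A := Algebra.adjoin_le (by simpa using hx)
  let _ : Algebra (Algebra.adjoin k {x}) A := (Subalgebra.inclusion hle).toRingHom.toAlgebra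
  have : IsScalarTower (Algebra.adjoin k {x}) A K := IsScalarTower.of_algebraMap_eq fun _ => rfl
  have : Algebra.IsIntegral (Algebra.adjoin k {x}) A :=
    ⟨fun a => (isIntegral_algebraMap_iff (B := K) Subtype.val_injective).mp (h a a.2)⟩
  refine ringKrullDim_le_of_isIntegral (R := Algebra.adjoin k {x}) |>.trans ?_
  have h1 := ringKrullDim_le_of_surjective (Polynomial.aeval (R := k) x).rangeRestrict.toRingHom
    (Polynomial.aeval (R := k) x).rangeRestrict_surjective
  rw [Polynomial.ringKrullDim_of_isNoetherianRing, ringKrullDim_eq_zero_of_field, zero_add] at h1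
  exact (ringKrullDim_eq_of_ringEquiv (Subalgebra.equivOfEq _ _
    (Algebra.adjoin_singleton_eq_range_aeval k x)).toRingEquiv).trans_le h1

theorem topologicalKrullDim_eq_ringKrullDim {X : Scheme.{u}} {U : X.Opens} (hU : IsAffineOpen U) :
    topologicalKrullDim U = ringKrullDim Γ(X, U) := by
  rw [← PrimeSpectrum.topologicalKrullDim_eq_ringKrullDim]
  exact IsHomeomorph.topologicalKrullDim_eq _ hU.isoSpec.hom.homeomorph.isHomeomorph

end Sections

section Connectedness

open AlgebraicGeometry CategoryTheory TopologicalSpace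

universe u

variable {X : Scheme.{u}} [IsIntegral X] {k : Type u} [Field k] [Algebra k X.functionField]
  {f : X ⟶ Spec (.of k)} [IsProper f]

theorem exists_not_isIntegral_adjoin {U : X.Opens} (hU : IsAffineOpen U) [Nonempty U]
    (hdim : 2 ≤ topologicalKrullDim U) {A : Subalgebra k X.functionField}
    (hA : ∀ r, r ∈ A ↔ ∃ s, X.germToFunctionField U s = r) {x : X.functionField} (hx : x ∈ A) :
    ∃ a ∈ A, ¬ _root_.IsIntegral (Algebra.adjoin k {x}) a := by
  by_contra! h
  have h1 := ringKrullDim_le_one_of_isIntegral_adjoin hx h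
  let e : Γ(X, U) →+* A := (X.germToFunctionField U).hom.codRestrict A fun s => (hA _).mpr ⟨s, rfl⟩
  have he : Function.Bijective e := by
    refine ⟨fun a b hab => X.germToFunctionField_injective U (congrArg Subtype.val hab), ?_⟩
    rintro ⟨r, hr⟩
    obtain ⟨s, rfl⟩ := (hA r).mp hr
    exact ⟨s, rfl⟩
  rw [topologicalKrullDim_eq_ringKrullDim hU,
    ringKrullDim_eq_of_ringEquiv (RingEquiv.ofBijective e he)] at hdim
  exact absurd (hdim.trans h1) (by decide)

theorem Dominates.mem_iff (f : X ⟶ Spec (.of k)) [IsProper f] {U : X.Opens}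
    (hU : IsAffineOpen U) [Nonempty U] {A : Subalgebra k X.functionField} (hA : ∀ r, r ∈ A ↔ ∃ s, X.germToFunctionField U s = r)
    {V : ValuationSubring X.functionField} {x : X} (h : Dominates V x) :
    x ∈ U ↔ ∀ a ∈ A, a ∈ V := by
  constructor
  · intro hx a ha
    obtain ⟨s, rfl⟩ := (hA a).mp ha
    exact h.germToFunctionField_mem hx s
  · intro hAV
    obtain ⟨y, hy, hVy⟩ := exists_dominates_of_isAffineOpen hU fun s => hAV _ ((hA _).mpr ⟨s, rfl⟩)
    rwa [h.unique (f := f) hVy]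

theorem not_nonempty_of_disjoint_cover [CharZero k]
    (hf : Spec.map (CommRingCat.ofHom (algebraMap k X.functionField)) =
      X.fromSpecStalk (genericPoint X) ≫ f) {U : X.Opens} (hU : IsAffineOpen U) [Nonempty U]
    (hdim : 2 ≤ topologicalKrullDim U) {Z₁ Z₂ : Set X} (hZ₁ : IsClosed Z₁) (hZ₂ : IsClosed Z₂)
    (hcover : (U : Set X)ᶜ = Z₁ ∪ Z₂) (hdisj : Disjoint Z₁ Z₂) (h₁ : Z₁.Nonempty) :
    ¬ Z₂.Nonempty := by
  rintro ⟨x₂, hx₂⟩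
  obtain ⟨x₁, hx₁⟩ := h₁
  obtain ⟨T, hT, hA⟩ := exists_finite_adjoin_eq hf hU
  have hfg : ∀ j : {W : X.Opens // IsAffineOpen W ∧ Nonempty W}, ∃ G : Set X.functionField,
      G.Finite ∧ ∀ r, r ∈ Algebra.adjoin k G ↔
        ∃ s, letI := j.2.2; X.germToFunctionField j.1 s = r := fun j =>
    letI := j.2.2
    exists_finite_adjoin_eq hf j.2.1
  choose G hG hR using hfg
  have hmem : ∀ {V : ValuationSubring X.functionField} {x : X}, Dominates V x →
      (x ∈ U ↔ ∀ a ∈ Algebra.adjoin k T, a ∈ V) := fun h => h.mem_iff f hU hA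
  have hmemj : ∀ {V : ValuationSubring X.functionField} {x : X}, Dominates V x →
      ∀ j, (x ∈ j.1 ↔ ∀ a ∈ Algebra.adjoin k (G j), a ∈ V) := fun h j =>
    letI := j.2.2
    h.mem_iff f j.2.1 (hR j)
  have hunique : ∀ {V : ValuationSubring X.functionField} {x y : X}, Dominates V x →
      Dominates V y → x = y := fun h h' => h.unique (f := f) h'
  let I (Z : Set X) (j : {W : X.Opens // IsAffineOpen W ∧ Nonempty W}) : Set X.functionField :=
    letI := j.2.2
    {r | ∃ s : Γ(X, j.1), (X.basicOpen s : Set X) ∩ Z = ∅ ∧ X.germToFunctionField j.1 s = r}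
  have hI : ∀ Z j, I Z j ⊆ Algebra.adjoin k (G j) := by
    rintro Z j _ ⟨s, -, rfl⟩
    exact (hR j _).mpr ⟨s, rfl⟩
  have hP : ∀ Z : Set X, IsClosed Z → ∀ V : ValuationSubring X.functionField, IsOver k V →
      ∀ j, (∀ r ∈ Algebra.adjoin k (G j), r ∈ V) →
        ((∃ x ∈ Z, Dominates V x) ↔ ∀ r ∈ I Z j, V.valuation r < 1) := by
    intro Z hZ V hV j hRV
    obtain ⟨x, hx⟩ := exists_dominates hf hV
    have := j.2.2
    rw [← hx.mem_iff_of_isClosed j.2.1 ((hmemj hx j).mpr hRV) hZ]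
    exact ⟨fun ⟨y, hy, hVy⟩ => hunique hVy hx ▸ hy, fun h => ⟨x, h, hx⟩⟩
  obtain ⟨V₁, hV₁⟩ := exists_dominating_valuationSubring x₁
  obtain ⟨V₂, hV₂⟩ := exists_dominating_valuationSubring x₂
  have hUx₁ : x₁ ∉ U := hcover.ge (Or.inl hx₁)
  have hUx₂ : x₂ ∉ U := hcover.ge (Or.inr hx₂)
  have hfrac := functionField_isFractionRing_of_isAffineOpen X U hU
  obtain ⟨y, hy, hVy⟩ := forall_of_exists_of_not_subset (k := k)
    (P₁ := fun V => ∃ x ∈ Z₁, Dominates V x) (P₂ := fun V => ∃ x ∈ Z₂, Dominates V x)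
    (I₁ := I Z₁) (I₂ := I Z₂) (R := fun j => Algebra.adjoin k (G j)) hT rfl
    (fun x hx => exists_not_isIntegral_adjoin hU hdim hA hx)
    (fun r => by
      obtain ⟨a, b, -, rfl⟩ := IsFractionRing.div_surjective (A := Γ(X, U)) r
      exact ⟨_, (hA _).mpr ⟨a, rfl⟩, _, (hA _).mpr ⟨b, rfl⟩, rfl⟩)
    hG (fun _ => rfl)
    (fun V hV => by
      obtain ⟨x, hx⟩ := exists_dominates hf hV
      obtain ⟨_, ⟨W, hW, rfl⟩, hxW, -⟩ := X.isBasis_affineOpens.exists_subset_of_mem_open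
        (Set.mem_univ x) isOpen_univ
      exact ⟨⟨W, hW, ⟨⟨x, hxW⟩⟩⟩, (hmemj hx _).mp hxW⟩)
    (fun V hV hAV j hRV => by
      obtain ⟨x, hx⟩ := exists_dominates hf hV
      have := j.2.2
      obtain ⟨g, hxg, hg⟩ := exists_mul_pow_eq hU j.2.1 ((hmem hx).mpr hAV) ((hmemj hx j).mpr hRV)
      refine ⟨_, (hA _).mpr ⟨g, rfl⟩, hx.valuation_germToFunctionField_eq_one g hxg, fun r hr => ?_⟩
      obtain ⟨s, rfl⟩ := (hR j r).mp hr
      obtain ⟨n, a, ha⟩ := hg s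
      exact ⟨n, (hA _).mpr ⟨a, ha.symm⟩⟩)
    (hI Z₁) (hI Z₂) (hP Z₁ hZ₁) (hP Z₂ hZ₂)
    (fun V hV hAV => by
      obtain ⟨x, hx⟩ := exists_dominates hf hV
      have hxU : x ∈ (U : Set X)ᶜ := mt (hmem hx).mp hAV
      rw [hcover] at hxU
      constructor
      · rintro ⟨y, hy, hVy⟩ ⟨z, hz, hVz⟩
        exact Set.disjoint_left.mp hdisj hy (hunique hVz hVy ▸ hz)
      · intro h
        exact ⟨x, hxU.resolve_right fun h2 => h ⟨x, h2, hx⟩, hx⟩)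
    (hV₁.isOver hf) (mt (hmem hV₁).mpr hUx₁) ⟨x₁, hx₁, hV₁⟩ V₂ (hV₂.isOver hf)
    (mt (hmem hV₂).mpr hUx₂)
  exact Set.disjoint_left.mp hdisj hy (hunique hV₂ hVy ▸ hx₂)

theorem compl_nonempty
    (hf : Spec.map (CommRingCat.ofHom (algebraMap k X.functionField)) =
      X.fromSpecStalk (genericPoint X) ≫ f) {U : X.Opens} (hU : IsAffineOpen U) [Nonempty U]
    (hdim : 2 ≤ topologicalKrullDim U) : ((U : Set X)ᶜ).Nonempty := by
  obtain ⟨T, -, hA⟩ := exists_finite_adjoin_eq hf hU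
  obtain ⟨a, ha, hintegral⟩ := exists_not_isIntegral_adjoin hU hdim hA (zero_mem _)
  contrapose! hintegral
  refine isIntegral_of_forall_mem_valuationSubring fun V hV => ?_
  have hVk : IsOver k V := fun c => hV (algebraMap k _ c)
  obtain ⟨x, hx⟩ := exists_dominates hf hVk
  exact (hx.mem_iff f hU hA).mp ((Set.compl_empty_iff.mp hintegral).ge (Set.mem_univ x)) a ha

theorem isConnected_compl [CharZero k]
    (hf : Spec.map (CommRingCat.ofHom (algebraMap k X.functionField)) =
      X.fromSpecStalk (genericPoint X) ≫ f) {U : X.Opens} (hU : IsAffineOpen U) [Nonempty U]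
    (hdim : 2 ≤ topologicalKrullDim U) : IsConnected ((U : Set X)ᶜ) := by
  refine ⟨compl_nonempty hf hU hdim, isPreconnected_closed_iff.mpr ?_⟩
  intro t₁ t₂ ht₁ ht₂ hcover h₁ h₂
  by_contra hempty
  have hc : IsClosed ((U : Set X)ᶜ) := U.isOpen.isClosed_compl
  refine not_nonempty_of_disjoint_cover hf hU hdim (hc.inter ht₁) (hc.inter ht₂) ?_ ?_ h₁ h₂
  · rw [← Set.inter_union_distrib_left, Set.inter_eq_left.mpr hcover]
  · refine Set.disjoint_left.mpr fun x hx hx' => hempty ⟨x, hx.1, hx.2, hx'.2⟩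

end Connectedness

end AffineComplement

open AlgebraicGeometry CategoryTheory TopologicalSpace

/-- If `X` is an irreducible complete (proper) variety over `ℂ` and `U ⊆ X` is a nonempty
open affine subvariety with `dim U ≥ 2`, then the complement `X \ U` is connected. -/
theorem complement_of_affine_open_connected
    (X : Scheme) [IsIntegral X]
    (f : X ⟶ Spec (CommRingCat.of ℂ)) [IsProper f]
    (U : X.Opens) (hUaff : IsAffineOpen U) (hUne : (U : Set X).Nonempty)
    (hdim : 2 ≤ topologicalKrullDim ↥U) :
    IsConnected ((U : Set X)ᶜ) := by
  let _ : Algebra ℂ X.functionField :=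
    (Spec.preimage (X.fromSpecStalk (genericPoint X) ≫ f)).hom.toAlgebra
  have : Nonempty U := hUne.to_subtype
  exact AffineComplement.isConnected_compl (f := f) (Spec.map_preimage _) hUaff hdim
end

section
/- Affineness descends along finite surjective morphisms: if f : X → Y is a finite surjective morphism of Noetherian schemes and X is affine, then Y is affine. -/
open AlgebraicGeometry CategoryTheory

section Trace

variable {A B K : Type*} [CommRing A] [CommRing B] [CommRing K]

lemma exists_addMonoidHom_leftInverse (hK : IsField K) [Nontrivial B] (φ : K →+* B) :
    ∃ τ : B →+ K, τ 1 = 1 ∧ ∀ k b, τ (φ k * b) = k * τ b := by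
  let _ := hK.toField
  let _ := φ.toAlgebra
  obtain ⟨g, hg⟩ := LinearMap.exists_leftInverse_of_injective (Algebra.linearMap K B)
    (LinearMap.ker_eq_bot.mpr φ.injective)
  refine ⟨g.toAddMonoidHom, ?_, fun k b ↦ ?_⟩
  · have := LinearMap.congr_fun hg 1
    simpa using this
  · have := g.map_smul k b
    rwa [Algebra.smul_def] at this

variable {φ : A →+* B} {ι : A →+* K} {τ : B →+ K}

lemma exists_common_denominator [IsDomain A] (hφ : φ.Finite)
    (hι : ∀ k, ∃ d ≠ 0, ∃ c, ι d * k = ι c) (hτ : ∀ a b, τ (φ a * b) = ι a * τ b) :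
    ∃ d ≠ 0, ∀ b, ∃ c, ι d * τ b = ι c := by
  classical
  let _ := φ.toAlgebra
  obtain ⟨s, hs⟩ : (⊤ : Submodule A B).FG := hφ.1
  choose d hd c hc using hι
  refine ⟨∏ b ∈ s, d (τ b), Finset.prod_ne_zero_iff.mpr fun b _ ↦ hd _, fun b ↦ ?_⟩
  have hb : b ∈ Submodule.span A (s : Set B) := hs.ge trivial
  induction hb using Submodule.span_induction with
  | mem b hb =>
    refine ⟨(∏ b ∈ s.erase b, d (τ b)) * c (τ b), ?_⟩
    rw [← Finset.prod_erase_mul _ _ hb, map_mul, map_mul, mul_assoc, hc]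
  | zero => exact ⟨0, by simp⟩
  | add x y _ _ hx hy =>
    obtain ⟨x', hx⟩ := hx
    obtain ⟨y', hy⟩ := hy
    exact ⟨x' + y', by rw [map_add, mul_add, hx, hy, map_add]⟩
  | smul a x _ hx =>
    obtain ⟨x', hx⟩ := hx
    refine ⟨a * x', ?_⟩
    have : τ (a • x) = ι a * τ x := by rw [Algebra.smul_def, ← hτ]; rfl
    rw [this, map_mul, ← hx, mul_left_comm]

lemma exists_mem_of_mem_map_mul_span (hτ : ∀ a b, τ (φ a * b) = ι a * τ b) {d : A}
    (hd : ∀ b, ∃ c, ι d * τ b = ι c) (I : Ideal A) {b : B}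
    (hb : b ∈ (I * Ideal.span {d}).map φ) : ∃ j ∈ I, τ b = ι j := by
  suffices ∀ b', ∃ j ∈ I, τ (b * b') = ι j by simpa using this 1
  induction hb using Submodule.span_induction with
  | mem b hb =>
    intro b'
    obtain ⟨a, ha, rfl⟩ := hb
    obtain ⟨j, hj, rfl⟩ := Ideal.mem_mul_span_singleton.mp ha
    obtain ⟨c, hc⟩ := hd b'
    exact ⟨j * c, I.mul_mem_right _ hj, by rw [hτ, map_mul, mul_assoc, hc, map_mul]⟩
  | zero => exact fun b' ↦ ⟨0, I.zero_mem, by simp⟩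
  | add x y _ _ hx hy =>
    intro b'
    obtain ⟨x', hx, hx'⟩ := hx b'
    obtain ⟨y', hy, hy'⟩ := hy b'
    exact ⟨x' + y', I.add_mem hx hy, by rw [add_mul, map_add, hx', hy', map_add]⟩
  | smul a x _ hx =>
    intro b'
    obtain ⟨j, hj, hj'⟩ := hx (a * b')
    exact ⟨j, hj, by rw [← hj', smul_eq_mul, mul_assoc, mul_left_comm]⟩

end Trace

namespace AlgebraicGeometry.Scheme

universe u

open TopologicalSpace

variable {X Y : Scheme.{u}}

/-- Restriction of sections, as a ring homomorphism. -/
noncomputable def res (X : Scheme.{u}) {V U : X.Opens} (h : V ≤ U) : Γ(X, U) →+* Γ(X, V) :=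
  (X.presheaf.map (homOfLE h).op).hom

@[simp]
lemma res_res {U V W : X.Opens} (h : V ≤ U) (h' : W ≤ V) (a : Γ(X, U)) :
    X.res h' (X.res h a) = X.res (h'.trans h) a := by
  simp only [res, ← CommRingCat.comp_apply, ← Functor.map_comp]
  rfl

@[simp]
lemma res_self {U : X.Opens} (h : U ≤ U) (a : Γ(X, U)) : X.res h a = a := by
  change X.presheaf.map (𝟙 _) a = a
  simp

lemma germ_res {U V : X.Opens} (h : V ≤ U) (x : X) (hx : x ∈ V) (a : Γ(X, U)) :
    X.presheaf.germ V x hx (X.res h a) = X.presheaf.germ U x (h hx) a :=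
  X.presheaf.germ_res_apply (homOfLE h) x hx a

lemma app_res (f : X ⟶ Y) {U V : Y.Opens} (h : V ≤ U) (a : Γ(Y, U)) :
    f.app V (Y.res h a) = X.res (f.preimage_mono h) (f.app U a) := by
  have := congr($(f.naturality (homOfLE h).op) a)
  exact this

lemma basicOpen_res' {U V : X.Opens} (h : V ≤ U) (a : Γ(X, U)) :
    X.basicOpen (X.res h a) = V ⊓ X.basicOpen a :=
  X.basicOpen_res a (homOfLE h).op

lemma eq_of_res_eq {U : X.Opens} {a b : Γ(X, U)}
    (h : ∀ x ∈ U, ∃ (V : X.Opens) (hV : V ≤ U), x ∈ V ∧ X.res hV a = X.res hV b) : a = b := by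
  refine X.IsSheaf.section_ext fun x hx ↦ ?_
  obtain ⟨V, hV, hxV, e⟩ := h x hx
  exact ⟨V, hV, hxV, e⟩

lemma exists_glue {ι : Type*} (U : ι → X.Opens) (V : X.Opens) (hU : ∀ i, U i ≤ V)
    (hV : V ≤ ⨆ i, U i) (a : ∀ i, Γ(X, U i))
    (ha : ∀ i j, X.res (inf_le_left : U i ⊓ U j ≤ U i) (a i) =
      X.res (inf_le_right : U i ⊓ U j ≤ U j) (a j)) :
    ∃ b : Γ(X, V), ∀ i, X.res (hU i) b = a i :=
  (X.sheaf.existsUnique_gluing' U V (fun i ↦ homOfLE (hU i)) hV a ha).exists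

lemma exists_glue_two {U V W : X.Opens} (hU : U ≤ W) (hV : V ≤ W) (hW : W ≤ U ⊔ V)
    (a : Γ(X, U)) (b : Γ(X, V))
    (h : X.res (inf_le_left : U ⊓ V ≤ U) a = X.res (inf_le_right : U ⊓ V ≤ V) b) :
    ∃ c : Γ(X, W), X.res hU c = a ∧ X.res hV c = b := by
  have swap : X.res (inf_le_left : V ⊓ U ≤ V) b = X.res (inf_le_right : V ⊓ U ≤ U) a := by
    have := congr(X.res (le_of_eq (inf_comm V U)) $h)
    simpa using this.symm
  obtain ⟨c, hc⟩ := exists_glue (fun i : Bool ↦ bif i then U else V) W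
    (by rintro (_ | _) <;> simpa) (by simpa [iSup_bool_eq] using hW)
    (fun i ↦ match i with | true => a | false => b)
    (by rintro (_ | _) (_ | _) <;> first | rfl | exact h | exact swap)
  exact ⟨c, hc true, hc false⟩

lemma ideal_comap_top_le_of_isAffine [IsAffine X] [IsAffine Y] (I : Y.IdealSheafData)
    (f : X ⟶ Y) :
    (I.comap f).ideal ⟨⊤, isAffineOpen_top X⟩ ≤
      (I.ideal ⟨⊤, isAffineOpen_top Y⟩).map f.appTop.hom := by
  have : I.comap f ≤ .ofIdealTop ((I.ideal ⟨⊤, isAffineOpen_top Y⟩).map f.appTop.hom) := by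
    rw [← IdealSheafData.le_map_iff_comap_le]
    refine IdealSheafData.le_of_isAffine fun a ha ↦ ?_
    rw [IdealSheafData.ideal_map_of_isAffineHom, Ideal.mem_comap, IdealSheafData.ofIdealTop_ideal]
    have := Ideal.mem_map_of_mem (X.presheaf.map (homOfLE (le_refl (⊤ : X.Opens))).op).hom
      (Ideal.mem_map_of_mem f.appTop.hom ha)
    convert! this
    exact (res_self le_rfl _).symm
  refine (this _).trans ?_
  rw [IdealSheafData.ofIdealTop_ideal, Ideal.map_le_iff_le_comap]
  intro a ha
  rw [Ideal.mem_comap]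
  convert ha
  exact res_self le_rfl _

/-- The inverse image ideal sheaf along an affine morphism is generated by pulled back sections. -/
lemma ideal_comap_le_of_isAffineHom (I : Y.IdealSheafData) (f : X ⟶ Y) [IsAffineHom f]
    (U : Y.affineOpens) :
    (I.comap f).ideal ⟨f ⁻¹ᵁ U, U.2.preimage f⟩ ≤ (I.ideal U).map (f.app U).hom := by
  intro a ha
  have : IsAffine U.1 := U.2
  have : IsAffine (f ⁻¹ᵁ U.1) := U.2.preimage f
  have h₁ : (f ⁻¹ᵁ U.1).ι ''ᵁ ⊤ ≤ f ⁻¹ᵁ U.1 := by simp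
  have h₂ : f ⁻¹ᵁ U.1 ≤ (f ⁻¹ᵁ U.1).ι ''ᵁ ⊤ := by simp
  have h₃ : U.1 ≤ U.1.ι ''ᵁ ⊤ := by simp
  have e : (I.comap f).comap (f ⁻¹ᵁ U.1).ι = (I.comap U.1.ι).comap (f ∣_ U.1) := by
    rw [← IdealSheafData.comap_comp, ← IdealSheafData.comap_comp, morphismRestrict_ι]
  have key := ideal_comap_top_le_of_isAffine (I.comap U.1.ι) (f ∣_ U.1)
  rw [← e] at key
  have k₁ := IdealSheafData.ideal_comap_of_isOpenImmersion (I.comap f) (f ⁻¹ᵁ U.1).ι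
    ⟨⊤, isAffineOpen_top (f ⁻¹ᵁ U.1)⟩
  have k₂ := IdealSheafData.ideal_comap_of_isOpenImmersion I U.1.ι
    ⟨⊤, isAffineOpen_top U.1⟩
  replace key := (k₁.symm.le.trans key).trans (Ideal.map_mono k₂.le)
  have ha' := Ideal.mem_map_of_mem (f ⁻¹ᵁ U.1).topIso.hom.hom
    (key (x := (f ⁻¹ᵁ U.1).topIso.inv.hom a) (by
      rw [Ideal.mem_comap]
      have := (I.comap f).ideal_le_comap_ideal
        (U := ⟨_, (isAffineOpen_top (f ⁻¹ᵁ U.1)).image_of_isOpenImmersion (f ⁻¹ᵁ U.1).ι⟩)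
        (V := ⟨f ⁻¹ᵁ U, U.2.preimage f⟩) h₁ ha
      rw [Ideal.mem_comap] at this
      convert this
      rw [Scheme.Opens.ι_appIso]
      rfl))
  rw [Ideal.map_map, ← CommRingCat.comp_apply, Iso.inv_hom_id, CommRingCat.id_apply] at ha'
  refine (Ideal.map_le_iff_le_comap.mpr fun b hb ↦ ?_ : Ideal.map _ _ ≤ _) ha'
  rw [Ideal.mem_comap] at hb ⊢
  have := Ideal.mem_map_of_mem (f.app U).hom (I.ideal_le_comap_ideal
    (V := ⟨_, (isAffineOpen_top U.1).image_of_isOpenImmersion U.1.ι⟩) (U := U) h₃ hb)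
  convert this
  rw [Scheme.Opens.ι_appIso]
  have e' : (f ∣_ U.1).appTop.hom b =
      X.res (image_morphismRestrict_preimage f U.1 ⊤).le (f.app (U.1.ι ''ᵁ ⊤) b) :=
    congr($(morphismRestrict_appTop f U.1) b)
  refine (congrArg (f ⁻¹ᵁ U.1).topIso.hom.hom e').trans ?_
  exact (res_res _ _ _).trans (app_res f h₃ b).symm

lemma eq_of_forall_isAffineOpen {U : X.Opens} {a b : Γ(X, U)}
    (h : ∀ (V : X.Opens) (hV : V ≤ U), IsAffineOpen V → X.res hV a = X.res hV b) : a = b :=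
  eq_of_res_eq fun _ hx ↦
    let ⟨V, hV, hxV, hVU⟩ := exists_isAffineOpen_mem_and_subset hx
    ⟨V, hVU, hxV, h V hVU hV⟩

lemma eq_of_res_eq_of_le_sup {U V W : X.Opens} (hV : V ≤ U) (hW : W ≤ U) (hU : U ≤ V ⊔ W)
    {a b : Γ(X, U)} (h : X.res hV a = X.res hV b) (h' : X.res hW a = X.res hW b) : a = b :=
  eq_of_res_eq fun _ hx ↦ (hU hx).elim (⟨V, hV, ·, h⟩) (⟨W, hW, ·, h'⟩)

lemma eq_of_res_eq_of_le_iSup {ι : Sort*} {U : X.Opens} (V : ι → X.Opens) (hV : ∀ i, V i ≤ U)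
    (hU : U ≤ ⨆ i, V i)
    {a b : Γ(X, U)} (h : ∀ i, X.res (hV i) a = X.res (hV i) b) : a = b :=
  eq_of_res_eq fun _ hx ↦
    let ⟨i, hi⟩ := Opens.mem_iSup.mp (hU hx)
    ⟨V i, hV i, hi, h i⟩

lemma app_res_eq_zero (f : X ⟶ Y) {U V : Y.Opens} (h : V ≤ U) {a : Γ(Y, U)}
    (ha : f.app U a = 0) : f.app V (Y.res h a) = 0 := by
  rw [app_res, ha, map_zero]

lemma exists_pow_mul_eq_zero {U : X.Opens} (hU : IsCompact (U : Set X)) (f x : Γ(X, U))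
    (h : X.res (X.basicOpen_le f) x = 0) : ∃ n : ℕ, f ^ n * x = 0 :=
  exists_pow_mul_eq_zero_of_res_basicOpen_eq_zero_of_isCompact X hU x f h

lemma eq_zero_of_disjoint_range {T V : Scheme.{u}} (ι : T ⟶ Y) (κ : V ⟶ Y)
    (hz : ∀ (W : Y.Opens) (a b : Γ(Y, W)), ι.app W a = 0 → κ.app W b = 0 → a * b = 0)
    {W : Y.Opens} (hW : Disjoint (W : Set Y) (Set.range ι)) {y : Γ(Y, W)}
    (hy : κ.app W y = 0) : y = 0 := by
  have hD : ι ⁻¹ᵁ W = ⊥ := by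
    ext t
    simpa using fun ht ↦ Set.disjoint_left.mp hW ht ⟨t, rfl⟩
  have : Subsingleton Γ(T, ι ⁻¹ᵁ W) := by
    rw [hD]; infer_instance
  rw [← one_mul y]
  exact hz _ _ _ (Subsingleton.elim _ _) hy

/-- A function killed by the ideal of `T` is killed by a power of every function whose
non-vanishing locus on `T` lies where the former vanishes. -/
lemma exists_pow_mul_eq_zero_of_annihilator {T V : Scheme.{u}} (ι : T ⟶ Y) (κ : V ⟶ Y)
    [IsClosedImmersion ι]
    (hz : ∀ (W : Y.Opens) (a b : Γ(Y, W)), ι.app W a = 0 → κ.app W b = 0 → a * b = 0)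
    {W O : Y.Opens} (hO : O ≤ W) (hW : IsCompact (W : Set Y)) {x : Γ(Y, W)} (hx : κ.app W x = 0)
    (hxO : Y.res hO x = 0) (g : Γ(Y, W)) (hg : ι ⁻¹ᵁ Y.basicOpen g ≤ ι ⁻¹ᵁ O) :
    ∃ n : ℕ, g ^ n * x = 0 := by
  refine exists_pow_mul_eq_zero hW g x (eq_of_res_eq fun y hy ↦ ?_)
  by_cases hyO : y ∈ O
  · refine ⟨Y.basicOpen g ⊓ O, inf_le_left, ⟨hy, hyO⟩, ?_⟩
    rw [res_res, ← res_res hO inf_le_right, hxO]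
    simp
  · let D : Y.Opens := ⟨(Set.range ι)ᶜ, ι.isClosedEmbedding.isClosed_range.isOpen_compl⟩
    refine ⟨Y.basicOpen g ⊓ D, inf_le_left, ⟨hy, ?_⟩, ?_⟩
    · rintro ⟨t, rfl⟩
      exact hyO (hg hy)
    · rw [map_zero, res_res]
      exact eq_zero_of_disjoint_range ι κ hz
        (disjoint_compl_left.mono_left Set.inter_subset_right) (app_res_eq_zero κ _ hx)

lemma exists_extension_of_annihilator {T V : Scheme.{u}} (ι : T ⟶ Y) (κ : V ⟶ Y)
    [IsClosedImmersion ι] [IsClosedImmersion κ] [IsNoetherian Y]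
    (hz : ∀ (W : Y.Opens) (a b : Γ(Y, W)), ι.app W a = 0 → κ.app W b = 0 → a * b = 0)
    {W O : Y.Opens} (hO : O ≤ W) (hW : IsAffineOpen W) {x : Γ(Y, O)} (hx : κ.app O x = 0)
    (g : Γ(Y, W)) (hg : ι ⁻¹ᵁ Y.basicOpen g ≤ ι ⁻¹ᵁ O) :
    ∃ (n : ℕ) (e : Γ(Y, W)), κ.app W e = 0 ∧ Y.res hO e = Y.res hO g ^ n * x := by
  let D : Y.Opens := ⟨(Set.range ι)ᶜ, ι.isClosedEmbedding.isClosed_range.isOpen_compl⟩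
  have hcov : Y.basicOpen g ≤ (Y.basicOpen g ⊓ O) ⊔ (Y.basicOpen g ⊓ D) := by
    intro y hy
    by_cases hyO : y ∈ O
    · exact Or.inl ⟨hy, hyO⟩
    · refine Or.inr ⟨hy, ?_⟩
      rintro ⟨t, rfl⟩
      exact hyO (hg hy)
  obtain ⟨z, hz₁, hz₂⟩ := exists_glue_two (W := Y.basicOpen g) (U := Y.basicOpen g ⊓ O)
    (V := Y.basicOpen g ⊓ D) inf_le_left inf_le_left hcov (Y.res inf_le_right x) 0 (by
      rw [map_zero, res_res]
      exact eq_zero_of_disjoint_range ι κ hz (disjoint_compl_left.mono_left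
        (Set.inter_subset_right.trans Set.inter_subset_right)) (app_res_eq_zero κ _ hx))
  have hκz : κ.app _ z = 0 := by
    refine eq_of_res_eq_of_le_sup (κ.preimage_mono inf_le_left) (κ.preimage_mono inf_le_left)
      (κ.preimage_mono hcov) ?_ ?_
    · rw [← app_res κ inf_le_left, hz₁, app_res_eq_zero κ _ hx, map_zero]
    · rw [← app_res κ inf_le_left, hz₂, map_zero, map_zero]
  obtain ⟨n, y, hy⟩ := exists_eq_pow_mul_of_isAffineOpen Y W hW g z
  replace hy : Y.res (Y.basicOpen_le g) y = Y.res (Y.basicOpen_le g) g ^ n * z := hy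
  obtain ⟨m, hm⟩ := exists_pow_mul_eq_zero (X := V) (hW.preimage κ).isCompact (κ.app W g)
    (κ.app W y) (by
      have h : κ.app _ (Y.res (Y.basicOpen_le g) y) = 0 := by
        rw [hy, map_mul, hκz, mul_zero]
      rw [app_res] at h
      have := congr(V.res (κ.preimage_basicOpen g).ge $h)
      simpa using this)
  rw [← map_pow, ← map_mul] at hm
  obtain ⟨l, hl⟩ := exists_pow_mul_eq_zero_of_annihilator ι κ hz (W := O)
    (O := Y.basicOpen g ⊓ O) inf_le_right (TopologicalSpace.NoetherianSpace.isCompact _)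
    (x := Y.res hO (g ^ m * y) - Y.res hO g ^ (m + n) * x) (by
      rw [map_sub, app_res_eq_zero κ _ hm, map_mul, hx, mul_zero, sub_zero])
    (by
      have h := congr(Y.res (inf_le_left : Y.basicOpen g ⊓ O ≤ _) $hy)
      simp only [map_mul, map_pow, map_sub, res_res, hz₁] at h ⊢
      rw [h]
      ring)
    (Y.res hO g) (by
      rw [basicOpen_res', inf_comm])
  refine ⟨l + m + n, g ^ l * (g ^ m * y), by rw [map_mul, hm, mul_zero], ?_⟩
  rw [mul_sub, sub_eq_zero] at hl
  rw [map_mul, map_pow, hl]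
  ring

/-- The elements of `Γ(T, ⊤)` which turn the cocycle `h i - h j` into a coboundary. -/
def coboundaryIdeal {T V : Scheme.{u}} (ι : T ⟶ Y) (κ : V ⟶ Y) [IsClosedImmersion ι]
    (hz : ∀ (W : Y.Opens) (a b : Γ(Y, W)), ι.app W a = 0 → κ.app W b = 0 → a * b = 0)
    {σ : Type*} (U : σ → Y.Opens) (hU : ∀ i, IsAffineOpen (U i)) (h : ∀ i, Γ(Y, U i))
    (hh : ∀ i j (W : Y.Opens) (hi : W ≤ U i) (hj : W ≤ U j),
      κ.app W (Y.res hi (h i) - Y.res hj (h j)) = 0) : Ideal Γ(T, ⊤) where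
  carrier := {c | ∃ e : ∀ i, Γ(Y, U i), (∀ i, κ.app (U i) (e i) = 0) ∧
    ∀ i j (W : Y.Opens) (hi : W ≤ U i) (hj : W ≤ U j), IsAffineOpen W →
      ∀ w : Γ(Y, W), ι.app W w = T.res le_top c →
        w * (Y.res hi (h i) - Y.res hj (h j)) = Y.res hi (e i) - Y.res hj (e j)}
  zero_mem' := ⟨0, by simp, fun i j W hi hj hW w hw ↦ by
    simpa using hz W w _ (by simpa using hw) (hh i j W hi hj)⟩
  add_mem' := by
    rintro c d ⟨e, he, hc⟩ ⟨e', he', hd⟩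
    refine ⟨e + e', fun i ↦ by simp [he, he'], fun i j W hi hj hW w hw ↦ ?_⟩
    obtain ⟨v, hv⟩ := ι.app_surjective W hW (T.res le_top c)
    have h₁ := hc i j W hi hj hW v hv
    have h₂ := hd i j W hi hj hW (w - v) (by rw [map_sub, hv, hw, map_add]; ring)
    simp only [Pi.add_apply, map_add]
    linear_combination h₁ + h₂
  smul_mem' := by
    rintro d c ⟨e, he, hc⟩
    choose f hf using fun i ↦ ι.app_surjective (U i) (hU i) (T.res le_top d)
    refine ⟨f * e, fun i ↦ by simp [he], fun i j W hi hj hW w hw ↦ ?_⟩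
    obtain ⟨v, hv⟩ := ι.app_surjective W hW (T.res le_top c)
    have hf' (i) (hi : W ≤ U i) : ι.app W (Y.res hi (f i)) = T.res le_top d := by
      rw [app_res, hf, res_res]
    have h₁ := hc i j W hi hj hW v hv
    have h₂ := hz W (w - Y.res hi (f i) * v) _
      (by rw [map_sub, map_mul, hf', hv, hw, smul_eq_mul, map_mul, sub_self]) (hh i j W hi hj)
    have h₃ := hz W (Y.res hi (f i) - Y.res hj (f j)) (Y.res hj (e j))
      (by rw [map_sub, hf', hf', sub_self]) (app_res_eq_zero κ _ (he j))
    simp only [Pi.mul_apply, map_mul]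
    linear_combination h₂ + Y.res hi (f i) * h₁ - h₃

lemma coboundaryIdeal_eq_top {T V : Scheme.{u}} (ι : T ⟶ Y) (κ : V ⟶ Y) [IsClosedImmersion ι]
    [IsClosedImmersion κ] [IsNoetherian Y] [IsAffine T]
    (hz : ∀ (W : Y.Opens) (a b : Γ(Y, W)), ι.app W a = 0 → κ.app W b = 0 → a * b = 0)
    {σ : Type*} [Finite σ] (U : σ → Y.Opens) (hU : ∀ i, IsAffineOpen (U i)) (hU' : ⨆ i, U i = ⊤)
    (h : ∀ i, Γ(Y, U i))
    (hh : ∀ i j (W : Y.Opens) (hi : W ≤ U i) (hj : W ≤ U j),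
      κ.app W (Y.res hi (h i) - Y.res hj (h j)) = 0) :
    coboundaryIdeal ι κ hz U hU h hh = ⊤ := by
  cases nonempty_fintype σ
  rw [← Ideal.span_eq (coboundaryIdeal ι κ hz U hU h hh),
    ← (isAffineOpen_top T).iSup_basicOpen_eq_self_iff, eq_top_iff]
  intro t _
  obtain ⟨k, hk⟩ := Opens.mem_iSup.mp (hU'.ge (Set.mem_univ (ι t)))
  obtain ⟨g, hg, htg⟩ := (isAffineOpen_top T).exists_basicOpen_le (V := ι ⁻¹ᵁ U k) ⟨t, hk⟩ trivial
  choose f hf using fun i ↦ ι.app_surjective (U i) (hU i) (T.res le_top g)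
  have hf' (i) (W) (hi : W ≤ U i) : ι.app W (Y.res hi (f i)) = T.res le_top g := by
    rw [app_res, hf, res_res]
  have hfg (i) (W) (hi : W ≤ U i) : ι ⁻¹ᵁ Y.basicOpen (Y.res hi (f i)) ≤ ι ⁻¹ᵁ (W ⊓ U k) := by
    rw [preimage_basicOpen, hf', basicOpen_res']
    exact fun x hx ↦ ⟨hx.1, hg hx.2⟩
  have hff (i j W) (hi : W ≤ U i) (hj : W ≤ U j) (n : ℕ) {x : Γ(Y, W)} (hx : κ.app W x = 0) :
      (Y.res hi (f i)) ^ n * x = (Y.res hj (f j)) ^ n * x := by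
    have := hz W (Y.res hi (f i) ^ n - Y.res hj (f j) ^ n) x (by simp [hf']) hx
    linear_combination this
  choose N e he₀ he using fun i ↦ exists_extension_of_annihilator ι κ hz
    (inf_le_left : U i ⊓ U k ≤ U i) (hU i) (hh i k _ inf_le_left inf_le_right) (f i)
    (by simpa using hfg i (U i) le_rfl)
  obtain ⟨n, hn⟩ : ∃ n, ∀ i, N i ≤ n :=
    ⟨Finset.univ.sup N, fun i ↦ Finset.le_sup (Finset.mem_univ i)⟩
  let e' : ∀ i, Γ(Y, U i) := fun i ↦ f i ^ (n - N i) * e i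
  have he'₀ (i) : κ.app (U i) (e' i) = 0 := by simp [e', he₀]
  have he' (i W) (hi : W ≤ U i) (hk : W ≤ U k) : Y.res hi (e' i) =
      Y.res hi (f i) ^ n * (Y.res hi (h i) - Y.res hk (h k)) := by
    have := congr(Y.res (le_inf hi hk) $(he i))
    simp only [map_mul, map_pow, map_sub, res_res, e'] at this ⊢
    rw [this, ← mul_assoc, ← pow_add, Nat.sub_add_cancel (hn i)]
  have key (p : σ × σ) : ∃ m : ℕ, (Y.res (inf_le_left : U p.1 ⊓ U p.2 ≤ _) (f p.1)) ^ m *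
      ((Y.res inf_le_left (f p.1)) ^ n * (Y.res inf_le_left (h p.1) - Y.res inf_le_right (h p.2)) -
        (Y.res inf_le_left (e' p.1) - Y.res inf_le_right (e' p.2))) = 0 := by
    refine exists_pow_mul_eq_zero_of_annihilator ι κ hz
      (inf_le_left : (U p.1 ⊓ U p.2) ⊓ U k ≤ _) (TopologicalSpace.NoetherianSpace.isCompact _)
      ?_ ?_ _ (hfg p.1 _ _)
    · rw [map_sub, map_mul, hh, mul_zero, map_sub, app_res_eq_zero κ _ (he'₀ _),
        app_res_eq_zero κ _ (he'₀ _), sub_zero, sub_zero]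
    · simp only [map_mul, map_pow, map_sub, res_res]
      rw [he' p.1 _ _ inf_le_right, he' p.2 _ _ inf_le_right,
        ← hff p.1 p.2 _ (inf_le_left.trans inf_le_left) _ _ (hh p.2 k _ _ _)]
      ring
  choose M hM using key
  obtain ⟨m, hm⟩ : ∃ m, ∀ i, M i ≤ m :=
    ⟨Finset.univ.sup M, fun i ↦ Finset.le_sup (Finset.mem_univ i)⟩
  have hmem : g ^ (m + n + 1) ∈ coboundaryIdeal ι κ hz U hU h hh := by
    refine ⟨fun i ↦ f i ^ (m + 1) * e' i, fun i ↦ by simp [he'₀],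
      fun i j W hi hj hW w hw ↦ ?_⟩
    have h₁ := hz W (w - Y.res hi (f i) ^ (m + n + 1)) _
      (by rw [map_sub, hw, map_pow, map_pow, hf', sub_self]) (hh i j W hi hj)
    have h₂ := congr(Y.res (le_inf hi hj) $(hM (i, j)))
    have h₃ := hff i j W hi hj (m + 1) (app_res_eq_zero κ hj (he'₀ j))
    obtain ⟨l, hl⟩ := Nat.exists_eq_add_of_le (hm (i, j))
    simp only [map_mul, map_pow, map_sub, res_res, map_zero] at h₂ ⊢
    rw [hl] at h₁ h₃ ⊢
    rw [← h₃]
    linear_combination h₁ + Y.res hi (f i) ^ (l + 1) * h₂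
  refine Opens.mem_iSup.mpr ⟨⟨_, hmem⟩, ?_⟩
  rw [basicOpen_pow]
  · exact htg
  · simp

/-- If `T` and `V` are closed subschemes such that the product of their ideals vanishes and `T` is
affine, then functions on `V` lift. -/
lemma appTop_surjective_of_mul_eq_zero {T V : Scheme.{u}} (ι : T ⟶ Y) (κ : V ⟶ Y)
    [IsClosedImmersion ι] [IsClosedImmersion κ] [IsNoetherian Y] [IsAffine T]
    (hz : ∀ (W : Y.Opens) (a b : Γ(Y, W)), ι.app W a = 0 → κ.app W b = 0 → a * b = 0) :
    Function.Surjective κ.appTop := by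
  intro s
  let σ := Y.affineCover.finiteSubcover.I₀
  let U : σ → Y.Opens := fun i ↦ (Y.affineCover.finiteSubcover.f i).opensRange
  have hU (i) : IsAffineOpen (U i) := isAffineOpen_opensRange _
  have hU' : ⨆ i, U i = ⊤ := Y.affineCover.finiteSubcover.iSup_opensRange
  choose h hs using fun i ↦ κ.app_surjective (U i) (hU i) (V.res le_top s)
  have hh (i j) (W : Y.Opens) (hi : W ≤ U i) (hj : W ≤ U j) :
      κ.app W (Y.res hi (h i) - Y.res hj (h j)) = 0 := by
    rw [map_sub, app_res, app_res, hs, hs, res_res, res_res, sub_self]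
  obtain ⟨e, he, H⟩ : 1 ∈ coboundaryIdeal ι κ hz U hU h hh := by
    rw [coboundaryIdeal_eq_top ι κ hz U hU hU' h hh]
    trivial
  obtain ⟨x, hx⟩ := exists_glue U ⊤ (fun _ ↦ le_top) hU'.ge (fun i ↦ h i - e i) (by
    intro i j
    refine eq_of_forall_isAffineOpen fun W hW hW' ↦ ?_
    have := H i j W (hW.trans inf_le_left) (hW.trans inf_le_right) hW' 1 (by simp)
    simp only [map_sub, res_res]
    linear_combination this)
  refine ⟨x, eq_of_res_eq_of_le_iSup (fun i ↦ κ ⁻¹ᵁ U i) (fun _ ↦ le_top) ?_ fun i ↦ ?_⟩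
  · rw [← Hom.preimage_iSup, hU']
    rfl
  · have := app_res κ (le_top : U i ≤ ⊤) x
    rw [hx, map_sub, he, hs, sub_zero] at this
    exact this.symm

lemma subschemeι_app_eq_zero_iff (I : Y.IdealSheafData) (U : Y.affineOpens) (a : Γ(Y, U)) :
    I.subschemeι.app U a = 0 ↔ a ∈ I.ideal U := by
  rw [← I.ker_subschemeι_app U]
  rfl

lemma mul_eq_zero_of_mul_eq_bot {I J : Y.IdealSheafData} (hIJ : I * J = ⊥) (W : Y.Opens)
    (a b : Γ(Y, W)) (ha : I.subschemeι.app W a = 0) (hb : J.subschemeι.app W b = 0) :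
    a * b = 0 := by
  refine eq_of_forall_isAffineOpen fun U hUW hU ↦ ?_
  have h : Y.res hUW a * Y.res hUW b ∈ (I * J).ideal ⟨U, hU⟩ :=
    Ideal.mul_mem_mul ((subschemeι_app_eq_zero_iff I ⟨U, hU⟩ _).mp (app_res_eq_zero _ _ ha))
      ((subschemeι_app_eq_zero_iff J ⟨U, hU⟩ _).mp (app_res_eq_zero _ _ hb))
  rw [hIJ] at h
  rw [map_mul, map_zero]
  exact h

lemma subschemeι_appTop_surjective_of_mul_eq_bot [IsNoetherian Y] {I J : Y.IdealSheafData}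
    (hIJ : I * J = ⊥) [IsAffine I.subscheme] : Function.Surjective J.subschemeι.appTop :=
  appTop_surjective_of_mul_eq_zero I.subschemeι J.subschemeι (mul_eq_zero_of_mul_eq_bot hIJ)

lemma isReduced_of_nilradical_eq_bot (h : Y.nilradical = ⊥) : IsReduced Y := by
  refine ⟨fun U ↦ ⟨fun a ha ↦ eq_of_forall_isAffineOpen fun V hV hVa ↦ ?_⟩⟩
  have : Y.res hV a ∈ Y.nilradical.ideal ⟨V, hVa⟩ := ha.map (Y.res hV)
  rw [h] at this
  rw [map_zero]
  exact this

lemma isNilpotent_nilradical [IsNoetherian Y] : IsNilpotent Y.nilradical := by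
  let 𝒰 := Y.affineCover.finiteSubcover
  let U : 𝒰.I₀ → Y.affineOpens := fun i ↦ ⟨(𝒰.f i).opensRange, isAffineOpen_opensRange _⟩
  have hU : ⨆ i, (U i).1 = ⊤ := 𝒰.iSup_opensRange
  have key (i) : ∃ n, _root_.nilradical Γ(Y, (U i).1) ^ n = ⊥ :=
    have : IsNoetherianRing Γ(Y, (U i).1) := IsLocallyNoetherian.component_noetherian (U i)
    IsNoetherianRing.isNilpotent_nilradical _
  choose n hn using key
  refine ⟨Finset.univ.sup n, IdealSheafData.ext_of_iSup_eq_top U hU fun i ↦ ?_⟩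
  exact le_bot_iff.mp ((Ideal.pow_le_pow_right (Finset.le_sup (Finset.mem_univ i))).trans
    (hn i).le)

lemma exists_mul_eq_bot_of_not_isReduced [IsNoetherian Y] (h : ¬ IsReduced Y) :
    ∃ I J : Y.IdealSheafData, I ≠ ⊥ ∧ J ≠ ⊥ ∧ I * J = ⊥ := by
  classical
  have h₀ : Y.nilradical ≠ ⊥ := fun e ↦ h (isReduced_of_nilradical_eq_bot e)
  obtain ⟨n, hn, hn'⟩ : ∃ n, Y.nilradical ^ n ≠ ⊥ ∧ Y.nilradical ^ (n + 1) = ⊥ := by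
    by_contra! H
    obtain ⟨n, hn⟩ := isNilpotent_nilradical (Y := Y)
    have key (n : ℕ) : Y.nilradical ^ (n + 1) ≠ ⊥ := by
      induction n with
      | zero => simpa using h₀
      | succ n ih => exact H _ ih
    exact key n (by rw [pow_succ, hn]; exact IdealSheafData.bot_mul _)
  exact ⟨_, _, hn, h₀, by rw [← pow_succ, hn']⟩

lemma support_vanishingIdeal (Z : Closeds Y) : (IdealSheafData.vanishingIdeal Z).support = Z :=
  SetLike.coe_injective (IdealSheafData.coe_support_vanishingIdeal Z)

lemma vanishingIdeal_ne_bot {Z : Closeds Y} (hZ : Z ≠ ⊤) : IdealSheafData.vanishingIdeal Z ≠ ⊥ := by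
  intro h
  apply hZ
  rw [← support_vanishingIdeal Z, h, IdealSheafData.support_bot]

lemma exists_mul_eq_bot_of_not_isIntegral [IsNoetherian Y] [Nonempty Y] (h : ¬ IsIntegral Y) :
    ∃ I J : Y.IdealSheafData, I ≠ ⊥ ∧ J ≠ ⊥ ∧ I * J = ⊥ := by
  by_cases hr : IsReduced Y
  · have : ¬ PreirreducibleSpace Y := fun _ ↦
      have : IrreducibleSpace Y := { toNonempty := inferInstance }
      h (isIntegral_of_irreducibleSpace_of_isReduced Y)
    obtain ⟨U, V, hU, hV, hU₀, hV₀, hUV⟩ : ∃ U V : Set Y, IsOpen U ∧ IsOpen V ∧ U.Nonempty ∧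
        V.Nonempty ∧ ¬ (U ∩ V).Nonempty := by
      by_contra! H
      exact this ⟨fun U V hU hV ⟨x, _, hx⟩ ⟨y, _, hy⟩ ↦ by
        simpa using H U V hU hV ⟨x, hx⟩ ⟨y, hy⟩⟩
    refine ⟨.vanishingIdeal ⟨Uᶜ, hU.isClosed_compl⟩, .vanishingIdeal ⟨Vᶜ, hV.isClosed_compl⟩,
      vanishingIdeal_ne_bot fun e ↦ ?_, vanishingIdeal_ne_bot fun e ↦ ?_, ?_⟩
    · obtain ⟨x, hx⟩ := hU₀
      exact (e.ge (Set.mem_univ x) : x ∈ Uᶜ) hx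
    · obtain ⟨x, hx⟩ := hV₀
      exact (e.ge (Set.mem_univ x) : x ∈ Vᶜ) hx
    · rw [← IdealSheafData.support_eq_top_iff, IdealSheafData.support_mul, support_vanishingIdeal,
        support_vanishingIdeal]
      refine eq_top_iff.mpr fun x _ ↦ ?_
      by_cases hx : x ∈ U
      · exact Or.inr fun hx' ↦ hUV ⟨x, hx, hx'⟩
      · exact Or.inl hx
  · exact exists_mul_eq_bot_of_not_isReduced hr

lemma exists_isAffineOpen_basicOpen_of_isClosed [IsNoetherian Y]
    (hA : ∀ J : Y.IdealSheafData, J ≠ ⊥ → IsAffine J.subscheme)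
    (hL : ∀ J : Y.IdealSheafData, J ≠ ⊥ → ∃ I ≤ J, I ≠ ⊥ ∧
      Function.Surjective I.subschemeι.appTop) (y : Y) (hy : IsClosed {y}) :
    ∃ s : Γ(Y, ⊤), y ∈ Y.basicOpen s ∧ IsAffineOpen (Y.basicOpen s) := by
  obtain ⟨U, hU, hyU, -⟩ := exists_isAffineOpen_mem_and_subset (X := Y) (U := ⊤) (x := y) trivial
  let Z : Closeds Y := ⟨(U : Set Y)ᶜ ∪ {y}, U.2.isClosed_compl.union hy⟩
  suffices ∃ s : Γ(Y, ⊤), y ∈ Y.basicOpen s ∧ Y.basicOpen s ≤ U by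
    obtain ⟨s, hs, hsU⟩ := this
    refine ⟨s, hs, ?_⟩
    have := hU.basicOpen (Y.res le_top s)
    rwa [basicOpen_res', inf_eq_right.mpr hsU] at this
  by_cases hJ : IdealSheafData.vanishingIdeal Z = ⊥
  · have hZ : Z = ⊤ := by
      rw [← support_vanishingIdeal Z, hJ, IdealSheafData.support_bot]
    let V : Y.Opens := ⟨{y}ᶜ, hy.isOpen_compl⟩
    have hUV : U ⊓ V = ⊥ := by
      ext x
      have hx : x ∈ Z := hZ.ge (Set.mem_univ x)
      simp only [Opens.coe_inf, Set.mem_inter_iff, Opens.coe_bot, Set.mem_empty_iff_false,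
        iff_false, not_and]
      intro hxU hxV
      exact hx.elim (fun h ↦ h hxU) hxV
    have : Subsingleton Γ(Y, U ⊓ V) := by
      rw [hUV]; infer_instance
    obtain ⟨s, hs₁, hs₂⟩ := exists_glue_two (U := U) (V := V) (W := ⊤) le_top le_top
      (fun x _ ↦ by
        by_cases hx : x = y
        · exact Or.inl (hx ▸ hyU)
        · exact Or.inr hx) 1 0 (Subsingleton.elim _ _)
    refine ⟨s, ?_, fun x hx ↦ ?_⟩
    · have : y ∈ Y.basicOpen (Y.res (le_top : U ≤ ⊤) s) := by
        rw [hs₁, basicOpen_one]; exact hyU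
      rw [basicOpen_res'] at this
      exact this.2
    · by_contra hxU
      have : x ∈ Y.basicOpen (Y.res (le_top : V ≤ ⊤) s) := by
        rw [basicOpen_res']
        exact ⟨fun h ↦ hxU (by rw [Set.mem_singleton_iff.mp h]; exact hyU), hx⟩
      rw [hs₂, basicOpen_zero] at this
      exact this
  · obtain ⟨I, hIJ, hI, hL⟩ := hL _ hJ
    have := hA I hI
    have hZI : (Z : Set Y) ⊆ Set.range I.subschemeι := by
      rw [I.range_subschemeι, ← IdealSheafData.coe_support_vanishingIdeal Z]
      exact IdealSheafData.support_antitone hIJ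
    obtain ⟨t, ht⟩ := hZI (Or.inr rfl : y ∈ Z)
    obtain ⟨s, hs, hts⟩ := (isAffineOpen_top I.subscheme).exists_basicOpen_le
      (V := I.subschemeι ⁻¹ᵁ U) ⟨t, by simpa [ht] using hyU⟩ trivial
    obtain ⟨s, rfl⟩ := hL s
    replace hs : I.subschemeι ⁻¹ᵁ Y.basicOpen s ≤ I.subschemeι ⁻¹ᵁ U := by
      rwa [preimage_basicOpen]
    replace hts : t ∈ I.subschemeι ⁻¹ᵁ Y.basicOpen s := by
      rwa [preimage_basicOpen]
    refine ⟨s, ht ▸ hts, fun x hx ↦ ?_⟩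
    by_contra hxU
    obtain ⟨z, rfl⟩ := hZI (Or.inl hxU : x ∈ Z)
    exact hxU (hs hx)

lemma iSup_basicOpen_eq_top [IsNoetherian Y]
    (hA : ∀ J : Y.IdealSheafData, J ≠ ⊥ → IsAffine J.subscheme)
    (hL : ∀ J : Y.IdealSheafData, J ≠ ⊥ → ∃ I ≤ J, I ≠ ⊥ ∧
      Function.Surjective I.subschemeι.appTop) :
    ⨆ s : {s : Γ(Y, ⊤) // IsAffineOpen (Y.basicOpen s)}, Y.basicOpen s.1 = ⊤ := by
  by_contra h
  obtain ⟨y, hy, hyc⟩ := IsClosed.exists_closed_singleton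
    (⨆ s : {s : Γ(Y, ⊤) // IsAffineOpen (Y.basicOpen s)}, Y.basicOpen s.1).2.isClosed_compl (by
      rw [Set.nonempty_compl]
      exact fun e ↦ h (Opens.ext e))
  obtain ⟨s, hs, hs'⟩ := exists_isAffineOpen_basicOpen_of_isClosed hA hL y hyc
  exact hy (Opens.mem_iSup.mpr ⟨⟨s, hs'⟩, hs⟩)

lemma exists_mem_span_of_surjective {S : Set Γ(Y, ⊤)} (hS : ⨆ s : S, Y.basicOpen s.1 = ⊤)
    (I : Y.IdealSheafData) [IsAffine I.subscheme] (hI : Function.Surjective I.subschemeι.appTop) :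
    ∃ x ∈ Ideal.span S, I.subschemeι.app ⊤ (1 - x) = 0 := by
  have h : Ideal.map I.subschemeι.appTop.hom (Ideal.span S) = ⊤ := by
    rw [Ideal.map_span, ← (isAffineOpen_top I.subscheme).iSup_basicOpen_eq_self_iff, eq_top_iff]
    intro t _
    obtain ⟨s, hs⟩ := Opens.mem_iSup.mp (hS.ge (Set.mem_univ (I.subschemeι t)))
    refine Opens.mem_iSup.mpr ⟨⟨_, Set.mem_image_of_mem _ s.2⟩, ?_⟩
    have : t ∈ I.subschemeι ⁻¹ᵁ Y.basicOpen s.1 := hs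
    rwa [preimage_basicOpen] at this
  obtain ⟨x, hx, hx'⟩ := (Ideal.mem_map_iff_of_surjective _ hI).mp
    (h.ge (Submodule.mem_top (x := 1)))
  refine ⟨x, hx, ?_⟩
  rw [map_sub, map_one, sub_eq_zero]
  exact hx'.symm

lemma eq_of_res_mul_eq [IsIntegral Y] {s : Γ(Y, ⊤)} (hs : s ≠ 0) {W : Y.Opens} {a b : Γ(Y, W)}
    (h : Y.res le_top s * a = Y.res le_top s * b) : a = b := by
  by_cases hW : Nonempty W
  · refine mul_left_cancel₀ (fun h₀ ↦ hs ?_) h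
    refine map_injective_of_isIntegral Y (homOfLE (le_top : W ≤ ⊤)) ?_
    rw [map_zero]
    exact h₀
  · have : W = ⊥ := by
      ext x
      simpa using fun hx ↦ hW ⟨x, hx⟩
    subst this
    exact Subsingleton.elim _ _

/-- On an integral scheme, being a multiple of a nonzero global section is a local property. -/
lemma dvd_of_forall_res_dvd [IsIntegral Y] {s : Γ(Y, ⊤)} (hs : s ≠ 0) {u : Γ(Y, ⊤)}
    (h : ∀ U : Y.affineOpens, Y.res le_top s ∣ Y.res (le_top : U.1 ≤ ⊤) u) : s ∣ u := by
  choose t ht using h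
  obtain ⟨x, hx⟩ := exists_glue (fun U : Y.affineOpens ↦ U.1) ⊤ (fun _ ↦ le_top)
    (iSup_affineOpens_eq_top Y).ge t (fun U V ↦ eq_of_res_mul_eq hs (by
      have h₁ := congr(Y.res (inf_le_left : U.1 ⊓ V.1 ≤ _) $(ht U))
      have h₂ := congr(Y.res (inf_le_right : U.1 ⊓ V.1 ≤ _) $(ht V))
      simp only [map_mul, res_res] at h₁ h₂
      rw [← h₁, ← h₂]))
  refine ⟨x, eq_of_forall_isAffineOpen fun U hU hU' ↦ ?_⟩
  rw [map_mul, ht ⟨U, hU'⟩, hx ⟨U, hU'⟩]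

lemma span_eq_top_of_isIntegral [IsIntegral Y]
    (hA : ∀ J : Y.IdealSheafData, J ≠ ⊥ → IsAffine J.subscheme)
    (hL : ∀ J : Y.IdealSheafData, J ≠ ⊥ → Function.Surjective J.subschemeι.appTop)
    {S : Set Γ(Y, ⊤)} (hS : ⨆ s : S, Y.basicOpen s.1 = ⊤) : Ideal.span S = ⊤ := by
  obtain ⟨s, hs⟩ := Opens.mem_iSup.mp (hS.ge (Set.mem_univ (Classical.arbitrary Y)))
  have hs₀ : s.1 ≠ 0 := by
    intro h
    rw [h, basicOpen_zero] at hs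
    exact hs
  let J : Y.IdealSheafData := .ofIdealTop (Ideal.span {s.1})
  have hJU (U : Y.affineOpens) : J.ideal U = Ideal.span {Y.res le_top s.1} := by
    simp only [J, IdealSheafData.ofIdealTop_ideal, Ideal.map_span, Set.image_singleton]
    rfl
  have hJ : J ≠ ⊥ := by
    intro h
    refine hs₀ (eq_of_forall_isAffineOpen fun U hU hU' ↦ ?_)
    have : Y.res hU s.1 ∈ J.ideal ⟨U, hU'⟩ := by
      rw [hJU]; exact Ideal.subset_span rfl
    rw [h] at this
    rw [map_zero]
    exact this
  have := hA J hJ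
  obtain ⟨x, hx, hx'⟩ := exists_mem_span_of_surjective hS J (hL J hJ)
  have hdvd : s.1 ∣ 1 - x := dvd_of_forall_res_dvd hs₀ fun U ↦ by
    rw [← Ideal.mem_span_singleton, ← hJU, ← subschemeι_app_eq_zero_iff]
    exact app_res_eq_zero _ _ hx'
  rw [Ideal.eq_top_iff_one]
  have := add_mem (Ideal.mem_of_dvd _ hdvd (Ideal.subset_span s.2)) hx
  rwa [sub_add_cancel] at this

/-- A Noetherian scheme is affine if all its proper closed subschemes are affine, and, in the
integral case, if functions on these lift. -/
lemma isAffine_of_forall_isAffine_subscheme [IsNoetherian Y] [Nonempty Y]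
    (hA : ∀ J : Y.IdealSheafData, J ≠ ⊥ → IsAffine J.subscheme)
    (hL : IsIntegral Y → ∀ J : Y.IdealSheafData, J ≠ ⊥ →
      Function.Surjective J.subschemeι.appTop) : IsAffine Y := by
  let S : Set Γ(Y, ⊤) := {s | IsAffineOpen (Y.basicOpen s)}
  suffices Ideal.span S = ⊤ from isAffine_of_isAffineOpen_basicOpen S this fun _ ↦ id
  by_cases hY : IsIntegral Y
  · exact span_eq_top_of_isIntegral hA (hL hY)
      (iSup_basicOpen_eq_top hA fun J hJ ↦ ⟨J, le_rfl, hJ, hL hY J hJ⟩)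
  obtain ⟨I₁, I₂, h₁, h₂, h₁₂⟩ := exists_mul_eq_bot_of_not_isIntegral hY
  have := hA I₁ h₁
  have := hA I₂ h₂
  have hS : ⨆ s : S, Y.basicOpen s.1 = ⊤ := by
    refine iSup_basicOpen_eq_top hA fun J hJ ↦ ?_
    by_cases hJI : J * I₁ = ⊥
    · exact ⟨J, le_rfl, hJ,
        subschemeι_appTop_surjective_of_mul_eq_bot (by rwa [mul_comm])⟩
    · refine ⟨J * I₁, fun U ↦ Ideal.mul_le_left, hJI,
        subschemeι_appTop_surjective_of_mul_eq_bot (I := I₂) ?_⟩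
      rw [mul_left_comm, mul_comm I₂, h₁₂, IdealSheafData.mul_bot]
  obtain ⟨x₁, hx₁, hx₁'⟩ := exists_mem_span_of_surjective hS I₁
    (subschemeι_appTop_surjective_of_mul_eq_bot (I := I₂) (by rwa [mul_comm]))
  obtain ⟨x₂, hx₂, hx₂'⟩ := exists_mem_span_of_surjective hS I₂
    (subschemeι_appTop_surjective_of_mul_eq_bot h₁₂)
  have h : (1 - x₁) * (1 - x₂) = 0 := mul_eq_zero_of_mul_eq_bot h₁₂ ⊤ _ _ hx₁' hx₂'
  rw [Ideal.eq_top_iff_one]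
  have : (1 : Γ(Y, ⊤)) = x₁ * (1 - x₂) + x₂ := by linear_combination h
  rw [this]
  exact add_mem (Ideal.mul_mem_right _ _ hx₁) hx₂

lemma exists_germ_mul_eq [IsIntegral Y] {U : Y.Opens} (hU : IsAffineOpen U) (y : Y) (hy : y ∈ U)
    (k : Y.presheaf.stalk y) :
    ∃ d ≠ 0, ∃ c, Y.presheaf.germ U y hy d * k = Y.presheaf.germ U y hy c := by
  let _ := TopCat.Presheaf.algebra_section_stalk Y.presheaf (⟨y, hy⟩ : U)
  have := hU.isLocalization_stalk ⟨y, hy⟩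
  obtain ⟨⟨c, d⟩, h⟩ := IsLocalization.surj (hU.primeIdealOf ⟨y, hy⟩).asIdeal.primeCompl k
  refine ⟨d.1, fun h₀ ↦ d.2 (h₀ ▸ Ideal.zero_mem _), c, ?_⟩
  rw [mul_comm]
  exact h

lemma mul_ne_bot [IsIntegral Y] {I J : Y.IdealSheafData} (hI : I ≠ ⊥) (hJ : J ≠ ⊥) :
    I * J ≠ ⊥ := by
  rw [ne_eq, ← IdealSheafData.support_eq_top_iff] at hI hJ ⊢
  rw [IdealSheafData.support_mul]
  intro h
  have h' : Set.univ ⊆ (I.support : Set Y) ∪ J.support := fun y _ ↦ h.ge (Set.mem_univ y)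
  rcases isPreirreducible_iff_isClosed_union_isClosed.mp
    (PreirreducibleSpace.isPreirreducible_univ (X := Y)) _ _ I.support.isClosed J.support.isClosed
    h' with h | h
  · exact hI (eq_top_iff.mpr fun y _ ↦ h trivial)
  · exact hJ (eq_top_iff.mpr fun y _ ↦ h trivial)

lemma one_ne_bot [Nonempty Y] : (1 : Y.IdealSheafData) ≠ ⊥ := by
  intro h
  have : (⊤ : Y.IdealSheafData).support = ⊤ := by
    rw [← IdealSheafData.one_eq_top, h, IdealSheafData.support_bot]
  rw [IdealSheafData.support_top] at this
  exact this.ge (Set.mem_univ (Classical.arbitrary Y))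

lemma pow_ne_bot [IsIntegral Y] {I : Y.IdealSheafData} (hI : I ≠ ⊥) (n : ℕ) :
    I ^ n ≠ ⊥ := by
  induction n with
  | zero => rw [pow_zero]; exact one_ne_bot
  | succ n ih => rw [pow_succ]; exact mul_ne_bot ih hI

lemma exists_ideal_le_span [IsIntegral Y] [IsNoetherian Y] (U : Y.affineOpens) (d : Γ(Y, U))
    (hd : d ≠ 0) : ∃ I : Y.IdealSheafData, I ≠ ⊥ ∧ I.ideal U ≤ Ideal.span {d} := by
  let Z : Closeds Y := (Y.basicOpen d).compl
  have hZ : Z ≠ ⊤ := by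
    intro h
    refine hd (eq_zero_of_basicOpen_eq_bot d ?_)
    refine eq_bot_iff.mpr fun y hy ↦ h.ge (Set.mem_univ y) hy
  have : IsNoetherianRing Γ(Y, U) := IsLocallyNoetherian.component_noetherian U
  have h : (IdealSheafData.vanishingIdeal Z).ideal U ≤ (Ideal.span {d}).radical := by
    rw [IdealSheafData.vanishingIdeal_ideal, ← PrimeSpectrum.vanishingIdeal_zeroLocus_eq_radical]
    refine PrimeSpectrum.vanishingIdeal_anti_mono fun p hp hp' ↦ ?_
    have : p ∈ PrimeSpectrum.basicOpen d := by
      rw [← U.2.fromSpec_preimage_basicOpen]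
      exact hp'
    exact this (hp (Ideal.subset_span rfl))
  obtain ⟨n, hn⟩ := Ideal.exists_pow_le_of_le_radical_of_fg h (IsNoetherian.noetherian _)
  refine ⟨IdealSheafData.vanishingIdeal Z ^ n, pow_ne_bot (vanishingIdeal_ne_bot hZ) n, ?_⟩
  rw [IdealSheafData.ideal_pow]
  exact hn

lemma exists_forall_ideal_le_span [IsIntegral Y] [IsNoetherian Y] {ι : Type*} [Finite ι]
    (U : ι → Y.affineOpens) (d : ∀ i, Γ(Y, (U i).1)) (hd : ∀ i, d i ≠ 0) :
    ∃ I : Y.IdealSheafData, I ≠ ⊥ ∧ ∀ i, I.ideal (U i) ≤ Ideal.span {d i} := by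
  classical
  cases nonempty_fintype ι
  choose I hI hId using fun i ↦ exists_ideal_le_span (U i) (d i) (hd i)
  refine ⟨∏ i, I i, Finset.prod_induction I (· ≠ ⊥) (fun _ _ ↦ mul_ne_bot) ?_ fun i _ ↦ hI i,
    fun i ↦ ?_⟩
  · exact one_ne_bot
  · rw [← Finset.mul_prod_erase _ _ (Finset.mem_univ i)]
    exact Ideal.mul_le_left.trans (hId i)

lemma app_eq_res_app {f g : X ⟶ Y} (e : f = g) (U : Y.Opens) (a : Γ(Y, U)) :
    f.app U a = X.res (by rw [e]) (g.app U a) := by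
  subst e
  simp

lemma exists_app_sub_mem_map (f : X ⟶ Y) [IsAffineHom f] [IsAffine X] (M : Y.IdealSheafData)
    (s : Γ(M.subscheme, ⊤)) : ∃ g : Γ(X, ⊤), ∀ (U : Y.affineOpens) (h : Γ(Y, U)),
      M.subschemeι.app U h = M.subscheme.res le_top s →
      f.app U h - X.res le_top g ∈ (M.ideal U).map (f.app U).hom := by
  let q : (M.comap f).subscheme ⟶ M.subscheme :=
    (M.comap f).subschemeMap M f (M.le_map_comap f)
  have hq : (M.comap f).subschemeι ≫ f = q ≫ M.subschemeι :=
    ((M.comap f).subschemeMap_subschemeι M f _).symm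
  obtain ⟨g, hg⟩ := (IsClosedImmersion.isAffine_surjective_of_isAffine
    (M.comap f).subschemeι).2 (q.appTop s)
  refine ⟨g, fun U h hs ↦ ideal_comap_le_of_isAffineHom M f U ?_⟩
  refine (subschemeι_app_eq_zero_iff (M.comap f) ⟨f ⁻¹ᵁ U, U.2.preimage f⟩ _).mp ?_
  have h₁ : (M.comap f).subschemeι.app (f ⁻¹ᵁ U) (f.app U h) =
      (M.comap f).subscheme.res (by rw [← Hom.comp_preimage, hq]; rfl)
        (q.app (M.subschemeι ⁻¹ᵁ U) (M.subschemeι.app U h)) := app_eq_res_app hq U h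
  have hg' : (M.comap f).subschemeι.app ⊤ g = q.app ⊤ s := hg
  change (M.comap f).subschemeι.app (f ⁻¹ᵁ U) _ = 0
  rw [map_sub, sub_eq_zero, h₁, hs, app_res, app_res, hg', res_res]
  rfl

lemma exists_finite_affine_cover_mem [IsIntegral Y] [IsNoetherian Y] {y : Y}
    (hy : y = genericPoint Y) : ∃ (ι : Type u) (_ : Finite ι) (U : ι → Y.affineOpens),
      ⨆ i, (U i).1 = ⊤ ∧ ∀ i, y ∈ (U i).1 := by
  let 𝒰 := Y.affineCover.finiteSubcover
  refine ⟨{i : 𝒰.I₀ // y ∈ (𝒰.f i).opensRange}, inferInstance,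
    fun i ↦ ⟨(𝒰.f i.1).opensRange, isAffineOpen_opensRange _⟩, eq_top_iff.mpr fun z _ ↦ ?_,
    fun i ↦ i.2⟩
  obtain ⟨i, hi⟩ := Opens.mem_iSup.mp (𝒰.iSup_opensRange.ge (Set.mem_univ z))
  exact Opens.mem_iSup.mpr
    ⟨⟨i, hy ▸ (genericPoint_specializes z).mem_open (𝒰.f i).opensRange.2 hi⟩, hi⟩

lemma exists_addMonoidHom_stalk [IsIntegral Y] (f : X ⟶ Y) {x : X} (hx : f x = genericPoint Y) :
    ∃ τ : X.presheaf.stalk x →+ Y.presheaf.stalk (f x), ∀ (U : Y.Opens) (hU : f x ∈ U),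
      (∀ a b, τ (X.presheaf.germ (f ⁻¹ᵁ U) x hU (f.app U a * b)) =
        Y.presheaf.germ U (f x) hU a * τ (X.presheaf.germ (f ⁻¹ᵁ U) x hU b)) ∧
      ∀ a, τ (X.presheaf.germ (f ⁻¹ᵁ U) x hU (f.app U a)) = Y.presheaf.germ U (f x) hU a := by
  have hK : IsField (Y.presheaf.stalk (f x)) := by
    rw [hx]
    exact Semifield.toIsField Y.functionField
  obtain ⟨τ, hτ₁, hτ⟩ := exists_addMonoidHom_leftInverse hK (f.stalkMap x).hom
  have key (U : Y.Opens) (hU : f x ∈ U) a b :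
      τ (X.presheaf.germ (f ⁻¹ᵁ U) x hU (f.app U a * b)) =
        Y.presheaf.germ U (f x) hU a * τ (X.presheaf.germ (f ⁻¹ᵁ U) x hU b) := by
    rw [map_mul, ← Hom.germ_stalkMap_apply]
    exact hτ _ _
  refine ⟨τ, fun U hU ↦ ⟨key U hU, fun a ↦ ?_⟩⟩
  have := key U hU a 1
  rwa [mul_one, map_one, hτ₁, mul_one] at this

/-- Functions on proper closed subschemes of an integral scheme `Y` lift to `Y`, if `Y` has a finite
cover by an affine scheme and its proper closed subschemes are affine. -/
lemma subschemeι_appTop_surjective_of_isFinite (f : X ⟶ Y) [IsFinite f] [Surjective f] [IsAffine X]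
    [IsIntegral Y] [IsNoetherian Y]
    (hA : ∀ J : Y.IdealSheafData, J ≠ ⊥ → IsAffine J.subscheme) (J : Y.IdealSheafData)
    (hJ : J ≠ ⊥) : Function.Surjective J.subschemeι.appTop := by
  obtain ⟨x, hx⟩ := f.surjective (genericPoint Y)
  obtain ⟨τ, hτ⟩ := exists_addMonoidHom_stalk f hx
  obtain ⟨ι, _, U, hU, hxU⟩ := exists_finite_affine_cover_mem hx
  let germX (i) : Γ(X, f ⁻¹ᵁ (U i).1) →+* X.presheaf.stalk x :=
    (X.presheaf.germ (f ⁻¹ᵁ (U i).1) x (hxU i)).hom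
  let germY (i) : Γ(Y, (U i).1) →+* Y.presheaf.stalk (f x) :=
    (Y.presheaf.germ (U i).1 (f x) (hxU i)).hom
  let τU (i) : Γ(X, f ⁻¹ᵁ (U i).1) →+ Y.presheaf.stalk (f x) := τ.comp (germX i).toAddMonoidHom
  have hτU (i) : ∀ a b, τU i (f.app (U i).1 a * b) = germY i a * τU i b := (hτ _ (hxU i)).1
  have hd (i) : ∃ d ≠ 0, ∀ b, ∃ c, germY i d * τU i b = germY i c :=
    have : Nonempty (U i).1 := ⟨⟨_, hxU i⟩⟩
    exists_common_denominator (f.finite_app (U i).1 (U i).2)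
      (exists_germ_mul_eq (U i).2 _ (hxU i)) (hτU i)
  choose d hd₀ hd using hd
  obtain ⟨I, hI, hId⟩ := exists_forall_ideal_le_span U d hd₀
  have := hA (J * I) (mul_ne_bot hJ hI)
  have hle : J * I ≤ J := fun _ ↦ Ideal.mul_le_left
  let incl := IdealSheafData.inclusion hle
  have hincl : incl ≫ (J * I).subschemeι = J.subschemeι := IdealSheafData.inclusion_subschemeι hle
  intro s
  obtain ⟨s, rfl⟩ := (IsClosedImmersion.isAffine_surjective_of_isAffine incl).2 s
  obtain ⟨g, hg⟩ := exists_app_sub_mem_map f (J * I) s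
  have key (i) : ∃ t : Γ(Y, (U i).1),
      J.subschemeι.app _ t = J.subscheme.res le_top (incl.appTop s) ∧
      germY i t = τ (X.presheaf.germ ⊤ x trivial g) := by
    obtain ⟨h, hh⟩ := (J * I).subschemeι.app_surjective _ (U i).2
      ((J * I).subscheme.res le_top s)
    obtain ⟨j, hj, hj'⟩ := exists_mem_of_mem_map_mul_span (hτU i) (hd i) (J.ideal (U i))
      (Ideal.map_mono (Ideal.mul_mono_right (hId i)) (hg (U i) h hh))
    refine ⟨h - j, ?_, ?_⟩
    · rw [map_sub, (subschemeι_app_eq_zero_iff J (U i) j).mpr hj, sub_zero,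
        app_eq_res_app hincl.symm]
      change J.subscheme.res _ (incl.app _ ((J * I).subschemeι.app _ h)) = _
      rw [hh, app_res]
      exact res_res ..
    · have h₁ : τU i (f.app (U i).1 h) = germY i h := (hτ _ (hxU i)).2 h
      have h₂ : τU i (X.res le_top g) = τ (X.presheaf.germ ⊤ x trivial g) :=
        congr(τ $(germ_res le_top x (hxU i) g))
      rw [map_sub, h₁, h₂] at hj'
      rw [map_sub, ← hj', sub_sub_cancel]
  choose t ht₁ ht₂ using key
  obtain ⟨v, hv⟩ := exists_glue (fun i ↦ (U i).1) ⊤ (fun _ ↦ le_top) hU.ge t fun i j ↦ by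
    refine germ_injective_of_isIntegral Y (U := (U i).1 ⊓ (U j).1) (f x) ⟨hxU i, hxU j⟩ ?_
    have hi := germ_res (inf_le_left : (U i).1 ⊓ (U j).1 ≤ _) (f x) ⟨hxU i, hxU j⟩ (t i)
    have hj := germ_res (inf_le_right : (U i).1 ⊓ (U j).1 ≤ _) (f x) ⟨hxU i, hxU j⟩ (t j)
    exact hi.trans <| (ht₂ i).trans <| (ht₂ j).symm.trans hj.symm
  refine ⟨v, eq_of_res_eq_of_le_iSup (fun i ↦ J.subschemeι ⁻¹ᵁ (U i).1) (fun _ ↦ le_top) ?_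
    fun i ↦ ?_⟩
  · rw [← Hom.preimage_iSup, hU]
    rfl
  · rw [← ht₁, ← hv i]
    exact (app_res J.subschemeι le_top v).symm

/-- The inductive step in Chevalley's theorem. -/
lemma isAffine_of_isFinite_of_forall_isAffine_subscheme (f : X ⟶ Y) [IsFinite f] [Surjective f]
    [IsAffine X] [IsNoetherian Y]
    (hA : ∀ J : Y.IdealSheafData, J ≠ ⊥ → IsAffine J.subscheme) : IsAffine Y := by
  cases isEmpty_or_nonempty Y
  · infer_instance
  · exact isAffine_of_forall_isAffine_subscheme hA fun _ ↦
      subschemeι_appTop_surjective_of_isFinite f hA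

lemma wellFoundedGT_idealSheafData [IsNoetherian Y] : WellFoundedGT Y.IdealSheafData := by
  let 𝒰 := Y.affineCover.finiteSubcover
  let U : 𝒰.I₀ → Y.affineOpens := fun i ↦ ⟨(𝒰.f i).opensRange, isAffineOpen_opensRange _⟩
  have hU : ⨆ i, (U i).1 = ⊤ := 𝒰.iSup_opensRange
  have h_noeth (i) : IsNoetherianRing Γ(Y, (U i).1) :=
    IsLocallyNoetherian.component_noetherian (U i)
  have hU' (I J : Y.IdealSheafData) :
      Ideal.pi (fun i ↦ I.ideal (U i)) ≤ Ideal.pi (fun i ↦ J.ideal (U i)) ↔ I ≤ J :=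
    Ideal.pi_le_pi_iff.trans
      ⟨IdealSheafData.le_of_iSup_eq_top U hU, fun h i ↦ h (U i)⟩
  have hφ : StrictMono fun I : Y.IdealSheafData ↦ Ideal.pi (fun i ↦ I.ideal (U i)) :=
    fun I J h ↦ lt_of_le_not_ge ((hU' I J).mpr h.le) fun h' ↦ h.not_ge ((hU' J I).mp h')
  exact hφ.wellFoundedGT

lemma isAffine_subscheme_of_isFinite (f : X ⟶ Y) [IsFinite f] [Surjective f] [IsAffine X]
    [IsNoetherian Y] (I : Y.IdealSheafData) : IsAffine I.subscheme := by
  have := wellFoundedGT_idealSheafData (Y := Y)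
  induction I using WellFoundedGT.induction with | ind I ih
  have : IsNoetherian I.subscheme :=
    { LocallyOfFiniteType.isLocallyNoetherian I.subschemeι with
      __ := QuasiCompact.compactSpace_of_compactSpace I.subschemeι }
  have : IsAffine (Limits.pullback f I.subschemeι) :=
    isAffine_of_isAffineHom (Limits.pullback.fst f I.subschemeι)
  refine isAffine_of_isFinite_of_forall_isAffine_subscheme
    (Limits.pullback.snd f I.subschemeι) fun J hJ ↦ ?_
  let K := (J.subschemeι ≫ I.subschemeι).ker
  have hIK : I ≤ K := I.ker_subschemeι.ge.trans (Hom.le_ker_comp _ _)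
  have hK : IsAffine K.subscheme := by
    refine ih K (lt_of_le_of_ne hIK fun h ↦ hJ ?_)
    have := IsClosedImmersion.isIso_of_ker_eq (J.subschemeι ≫ I.subschemeι) I.subschemeι
      J.subschemeι rfl (h.symm.trans I.ker_subschemeι.symm)
    exact (isIso_subschemeι_iff_eq_bot J).mp this
  have := IsClosedImmersion.isIso_lift K.subschemeι (J.subschemeι ≫ I.subschemeι)
    K.ker_subschemeι
  exact IsAffine.of_isIso (IsClosedImmersion.lift K.subschemeι (J.subschemeι ≫ I.subschemeι)
    K.ker_subschemeι.le)

end AlgebraicGeometry.Scheme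

/-- Chevalley: affineness descends along finite surjective morphisms of Noetherian schemes. -/
theorem affine_of_finite_surjective
    {X Y : Scheme} [IsNoetherian X] [IsNoetherian Y]
    (f : X ⟶ Y) [IsFinite f] [Surjective f] [IsAffine X] :
    IsAffine Y := by
  have := Scheme.isAffine_subscheme_of_isFinite f ⊥
  exact IsAffine.of_isIso (inv (⊥ : Y.IdealSheafData).subschemeι)
end
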